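/- arXiv:2001.11058 — 3 statements merged into one kernel-verified Lean document; each statement's English description precedes it below -/
import Mathlib

section
/- Assume that ⟨D,E⟩ is a double-bubble system with E₀ ⊆ E, X ⊆ 2^ω is a canonical E₀-large set, and f : X → 2^ω is a Borel injective map. Then there exist a canonical E₀-large set Y ⊆ X and a double-bubble system ⟨D',E'⟩ which extends ⟨D,E⟩ and accommodates f↾Y, i.e., f(x) E' x for all x ∈ Y. -/
open MeasureTheory

abbrev Cantor : Type := ℕ → Bool

/-- The equivalence relation `E₀`: eventual agreement. -/
def eZero (x y : Cantor) : Prop := {k | x k ≠ y k}.Finite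

/-- The equivalence relation `Eₑ`: the set of disagreements is finite with even cardinality. -/
def eEven (x y : Cantor) : Prop := {k | x k ≠ y k}.Finite ∧ Even ({k | x k ≠ y k}.ncard)

/-- A set is coanalytic (`Π¹₁`) iff its complement is analytic. -/
def IsCoanalytic {α : Type*} [TopologicalSpace α] (S : Set α) : Prop := AnalyticSet Sᶜ

/-- A perfect set: nonempty, closed, no isolated points. -/
def PerfectSet (X : Set Cantor) : Prop := Perfect X ∧ X.Nonempty

/-- `E` restricted to the Borel set `X` is smooth. -/
def RelSmoothOn (E : Cantor → Cantor → Prop) (X : Set Cantor) : Prop :=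
  ∃ f : X → Cantor, Measurable f ∧ ∀ x y : X, (E x y ↔ f x = f y)

/-- A Borel set is `E₀`-large iff `E₀` restricted to it is not smooth. -/
def E0Large (X : Set Cantor) : Prop := ¬ RelSmoothOn eZero X

/-- An `E₀`-array: strings `u n i` with equal positive lengths and `u n 0 ≠ u n 1`. -/
structure E0Array where
  u : ℕ → Bool → List Bool
  len_eq : ∀ n, (u n false).length = (u n true).length
  len_pos : ∀ n, 1 ≤ (u n false).length
  ne : ∀ n, u n false ≠ u n true

/-- The point `x_u^a = u 0 (a 0) ⌢ u 1 (a 1) ⌢ ⋯`. (Since every block has length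
at least one, the join of the first `m+1` blocks has length `> m`.) -/
def xua (U : E0Array) (a : Cantor) : Cantor := fun m =>
  (((List.range (m + 1)).map (fun n => U.u n (a n))).flatten).getD m false

/-- The canonical `E₀`-large set `D_u` determined by the array `u`. -/
def Du (U : E0Array) : Set Cantor := Set.range (xua U)

/-- A double-bubble system. -/
structure DBS (D E : Cantor → Cantor → Prop) : Prop where
  equivD : Equivalence D
  equivE : Equivalence E
  borelD : MeasurableSet {p : Cantor × Cantor | D p.1 p.2}
  borelE : MeasurableSet {p : Cantor × Cantor | E p.1 p.2}
  countableD : ∀ x, {y | D x y}.Countable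
  countableE : ∀ x, {y | E x y}.Countable
  sub : ∀ x y, D x y → E x y
  double : ∀ x, ∃ y, E x y ∧ ¬ D x y ∧ ∀ z, E x z → (D x z ∨ D y z)

/-- `⟨D,E⟩ ⊑ ⟨D',E'⟩`: extension of double-bubble systems. -/
def DBSle (D E D' E' : Cantor → Cantor → Prop) : Prop :=
  (∀ x y, D x y → D' x y) ∧ (∀ x y, E x y → E' x y) ∧
    (∀ x y, E x y → ¬ D x y → ¬ D' x y)

open Set Filter Topology

instance Cantor.instPolishSpace : PolishSpace Cantor := by
  have : TopologicalSpace.IsCompletelyMetrizableSpace Cantor := inferInstance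
  infer_instance

/-- The basic clopen set of all sequences extending the string `l`. -/
def stringNhd {α : Type*} (l : List α) : Set (ℕ → α) :=
  {z | (List.range l.length).map z = l}

theorem mem_stringNhd_map_range {α : Type*} (z : ℕ → α) (n : ℕ) :
    z ∈ stringNhd ((List.range n).map z) := by
  simp [stringNhd]

theorem mem_stringNhd_map_range_iff {α : Type*} {z w : ℕ → α} {n : ℕ} :
    w ∈ stringNhd ((List.range n).map z) ↔ ∀ k < n, w k = z k := by
  simp [stringNhd]

theorem eq_of_mem_stringNhd {α : Type*} {l : List α} {z w : ℕ → α} (hz : z ∈ stringNhd l)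
    (hw : w ∈ stringNhd l) {k : ℕ} (hk : k < l.length) : z k = w k := by
  have h : (List.range l.length).map z = (List.range l.length).map w := hz.trans hw.symm
  simpa using List.map_inj_left.1 h k (List.mem_range.2 hk)

theorem stringNhd_subset {α : Type*} {l : List α} {z w : ℕ → α} {n : ℕ} (hz : z ∈ stringNhd l)
    (hn : l.length ≤ n) (hw : w ∈ stringNhd ((List.range n).map z)) : w ∈ stringNhd l := by
  rw [mem_stringNhd_map_range_iff] at hw
  refine Eq.trans (List.map_inj_left.2 fun k hk => ?_) hz
  exact hw k ((List.mem_range.1 hk).trans_le hn)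

theorem isClosed_stringNhd {α : Type*} [TopologicalSpace α] [T1Space α] (l : List α) :
    IsClosed (stringNhd l) := by
  by_cases h : ∃ z, z ∈ stringNhd l
  · obtain ⟨z, hz⟩ := h
    have : stringNhd l = ⋂ k ∈ Finset.range l.length, {w | w k = z k} := by
      ext w
      simp only [mem_iInter, Finset.mem_range, mem_ofPred_eq]
      refine ⟨fun hw k hk => eq_of_mem_stringNhd hw hz hk, fun hw => ?_⟩
      exact stringNhd_subset hz le_rfl (mem_stringNhd_map_range_iff.2 hw)
    rw [this]
    refine isClosed_biInter fun k _ => ?_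
    exact isClosed_singleton.preimage (continuous_apply (A := fun _ : ℕ => α) k)
  · rw [eq_empty_of_forall_notMem fun z hz => h ⟨z, hz⟩]
    exact isClosed_empty

theorem exists_stringNhd_subset {α : Type*} [TopologicalSpace α] [DiscreteTopology α]
    {O : Set (ℕ → α)} (hO : IsOpen O) {z : ℕ → α} (hz : z ∈ O) :
    ∃ m, ∀ n ≥ m, ∀ w, (∀ k < n, w k = z k) → w ∈ O := by
  obtain ⟨I, u, hu, hI⟩ := isOpen_pi_iff.1 hO z hz
  refine ⟨I.sup id + 1, fun n hn w hw => hI fun i hi => ?_⟩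
  rw [hw i ((Nat.lt_succ_of_le (Finset.le_sup (f := id) hi)).trans_le hn)]
  exact (hu i hi).2

section LusinNovikov

variable {X : Type*} [TopologicalSpace X] [PolishSpace X] [MeasurableSpace X] [BorelSpace X]

/-- An analytic partial function into the Cantor space extends to a Borel function. -/
theorem AnalyticSet.exists_measurable_graph {P : Set (X × Cantor)} (hP : AnalyticSet P)
    (hfun : ∀ x y y', (x, y) ∈ P → (x, y') ∈ P → y = y') :
    ∃ h : X → Cantor, Measurable h ∧ ∀ p ∈ P, p.2 = h p.1 := by
  have hsep : ∀ n, MeasurablySeparable (Prod.fst '' (P ∩ {p | p.2 n = true}))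
      (Prod.fst '' (P ∩ {p | p.2 n = false})) := by
    intro n
    have hc : Continuous fun p : X × Cantor => p.2 n := (continuous_apply n).comp continuous_snd
    have han : ∀ b : Bool, AnalyticSet (Prod.fst '' (P ∩ {p | p.2 n = b})) := by
      intro b
      have hb : IsClosed {p : X × Cantor | p.2 n = b} := isClosed_singleton.preimage hc
      refine AnalyticSet.image_of_continuous ?_ continuous_fst
      have := AnalyticSet.iInter (s := fun i : Bool => bif i then P else {p | p.2 n = b})
        (by rintro (_ | _); exacts [hb.analyticSet, hP])
      refine (congrArg AnalyticSet ?_).mp this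
      ext p
      simp [and_comm]
    refine (han true).measurablySeparable (han false) (Set.disjoint_left.2 ?_)
    rintro x ⟨p, ⟨hp, hpt⟩, rfl⟩ ⟨q, ⟨hq, hqf⟩, hqp⟩
    have := hfun p.1 p.2 q.2 hp (by rw [← hqp]; exact hq)
    simp only [mem_ofPred_eq] at hpt hqf
    rw [← this, hpt] at hqf
    exact absurd hqf (by decide)
  choose S hS hS' hSm using hsep
  classical
  refine ⟨fun x n => decide (x ∈ S n), measurable_pi_lambda _ fun n => ?_, fun p hp => ?_⟩
  · exact measurable_to_bool (by simpa [preimage] using hSm n)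
  · funext n
    rcases h : p.2 n with _ | _
    · have : p.1 ∉ S n := Set.disjoint_left.1 (hS' n) ⟨p, ⟨hp, h⟩, rfl⟩
      simp [this]
    · have : p.1 ∈ S n := hS n ⟨p, ⟨hp, h⟩, rfl⟩
      simp [this]

/-- A finite tuple of strings is large for `φ` if no countable family of Borel graphs meets all
tuples of points through these strings that `φ` sends to a common fibre. -/
def LargeTuple {ι : Type*} (φ : (ℕ → ℕ) → X × Cantor) (a : ι → List ℕ) : Prop :=
  ∀ H : Set (X → Cantor), H.Countable → (∀ h ∈ H, Measurable h) →
    ∃ z : ι → ℕ → ℕ, (∀ i, z i ∈ stringNhd (a i)) ∧ (∀ i j, (φ (z i)).1 = (φ (z j)).1) ∧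
      ∀ i, ∀ h ∈ H, (φ (z i)).2 ≠ h (φ (z i)).1

/-- A large tuple can be doubled to a large tuple of longer strings which separates the two
extensions of a prescribed index. -/
theorem LargeTuple.exists_double {φ : (ℕ → ℕ) → X × Cantor} (hφ : Continuous φ) {n : ℕ}
    {a : (Fin n → Bool) → List ℕ} (ha : LargeTuple φ a) (i₀ : Fin n → Bool) :
    ∃ a' : (Fin (n + 1) → Bool) → List ℕ, LargeTuple φ a' ∧
      (∀ t, stringNhd (a' t) ⊆ stringNhd (a (Fin.init t)) ∧ n + 1 ≤ (a' t).length) ∧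
      ∀ t₀ t₁, Fin.init t₀ = i₀ → Fin.init t₁ = i₀ → t₀ (Fin.last n) = false →
        t₁ (Fin.last n) = true → ∀ z ∈ stringNhd (a' t₀), ∀ w ∈ stringNhd (a' t₁),
          (φ z).2 ≠ (φ w).2 := by
  by_contra! hcon
  have hnot : ∀ a' : (Fin (n + 1) → Bool) → List ℕ, ∃ H : Set (X → Cantor), H.Countable ∧
      (∀ h ∈ H, Measurable h) ∧ (LargeTuple φ a' ∨
      ∀ z : (Fin (n + 1) → Bool) → ℕ → ℕ, (∀ i, z i ∈ stringNhd (a' i)) →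
        (∀ i j, (φ (z i)).1 = (φ (z j)).1) → ∃ i, ∃ h ∈ H, (φ (z i)).2 = h (φ (z i)).1) := by
    intro a'
    by_cases h : LargeTuple φ a'
    · exact ⟨∅, countable_empty, by simp, Or.inl h⟩
    · unfold LargeTuple at h
      push Not at h
      obtain ⟨H, h1, h2, h3⟩ := h
      exact ⟨H, h1, h2, Or.inr h3⟩
  choose H hHc hHm hH using hnot
  set K : Set (X → Cantor) := ⋃ a', H a' with hK
  have hKc : K.Countable := countable_iUnion hHc
  have hKm : ∀ h ∈ K, Measurable h := by
    intro h hh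
    obtain ⟨a', ha'⟩ := mem_iUnion.1 hh
    exact hHm a' h ha'
  set Q : Set ((Fin n → Bool) → ℕ → ℕ) := {z | (∀ i, z i ∈ stringNhd (a i)) ∧
    (∀ i j, (φ (z i)).1 = (φ (z j)).1) ∧ ∀ i, ∀ h ∈ K, (φ (z i)).2 ≠ h (φ (z i)).1} with hQ
  have hev : ∀ i, Measurable fun z : (Fin n → Bool) → ℕ → ℕ => φ (z i) := fun i =>
    hφ.measurable.comp (measurable_pi_apply i)
  have hQm : MeasurableSet Q := by
    have : Q = ((⋂ i, {z | z i ∈ stringNhd (a i)}) ∩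
        (⋂ i, ⋂ j, {z | (φ (z i)).1 = (φ (z j)).1})) ∩
        ⋂ i, ⋂ h ∈ K, {z | (φ (z i)).2 = h (φ (z i)).1}ᶜ := by
      ext z
      simp only [hQ, mem_ofPred_eq, mem_inter_iff, mem_iInter, mem_compl_iff, and_assoc, ne_eq]
    rw [this]
    refine ((MeasurableSet.iInter fun i => ?_).inter (MeasurableSet.iInter fun i =>
      MeasurableSet.iInter fun j => ?_)).inter (MeasurableSet.iInter fun i =>
      MeasurableSet.biInter hKc fun h hh => ?_)
    · exact (isClosed_stringNhd (a i)).measurableSet.preimage (measurable_pi_apply i)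
    · exact measurableSet_eq_fun (hev i).fst (hev j).fst
    · exact (measurableSet_eq_fun (hev i).snd ((hKm h hh).comp (hev i).fst)).compl
  have hfun : ∀ x y y', (x, y) ∈ (fun z => φ (z i₀)) '' Q → (x, y') ∈ (fun z => φ (z i₀)) '' Q →
      y = y' := by
    rintro x y y' ⟨z, ⟨hz1, hz2, hz3⟩, hzx⟩ ⟨w, ⟨hw1, hw2, hw3⟩, hwx⟩
    by_contra hne
    obtain ⟨k, hk⟩ := Function.ne_iff.1 hne
    have hop : ∀ b : Bool, IsOpen {v | (φ v).2 k = b} := fun b =>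
      (isOpen_discrete {b}).preimage ((continuous_apply k).comp (continuous_snd.comp hφ))
    obtain ⟨m₁, hm₁⟩ := exists_stringNhd_subset (hop (y k)) (z := z i₀)
      (by simp only at hzx; simp [hzx])
    obtain ⟨m₂, hm₂⟩ := exists_stringNhd_subset (hop (y' k)) (z := w i₀)
      (by simp only at hwx; simp [hwx])
    set m := max (max m₁ m₂) (max (n + 1) (Finset.univ.sup fun i => (a i).length)) with hm
    have hlen : ∀ i, (a i).length ≤ m := fun i =>
      (Finset.le_sup (f := fun i => (a i).length) (Finset.mem_univ i)).trans
        ((le_max_right _ _).trans (le_max_right _ _))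
    set v : (Fin (n + 1) → Bool) → ℕ → ℕ := fun t =>
      bif t (Fin.last n) then w (Fin.init t) else z (Fin.init t) with hv
    have hvx : ∀ t, (φ (v t)).1 = x := by
      intro t
      rcases h : t (Fin.last n) with _ | _
      · simp only [hv, h, cond_false]
        rw [hz2 _ i₀]
        exact congrArg Prod.fst hzx
      · simp only [hv, h, cond_true]
        rw [hw2 _ i₀]
        exact congrArg Prod.fst hwx
    have hvn : ∀ t, v t ∈ stringNhd (a (Fin.init t)) := by
      intro t
      rcases h : t (Fin.last n) with _ | _
      · simpa only [hv, h, cond_false] using hz1 _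
      · simpa only [hv, h, cond_true] using hw1 _
    have hvK : ∀ t, ∀ h ∈ K, (φ (v t)).2 ≠ h (φ (v t)).1 := by
      intro t
      rcases h : t (Fin.last n) with _ | _
      · simpa only [hv, h, cond_false] using hz3 _
      · simpa only [hv, h, cond_true] using hw3 _
    set a' : (Fin (n + 1) → Bool) → List ℕ := fun t => (List.range m).map (v t) with ha'
    have hbad : ¬ LargeTuple φ a' := by
      intro hl
      obtain ⟨t₀, t₁, h₀, h₁, h₀', h₁', p, hp, q, hq, hpq⟩ := hcon a' hl (fun t =>
        ⟨fun u hu => stringNhd_subset (hvn t) (hlen _) hu, by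
          simp only [ha', List.length_map, List.length_range]
          exact (le_max_left _ _).trans (le_max_right _ _)⟩)
      simp only [ha', hv, h₀', h₁', h₀, h₁, cond_false, cond_true,
        mem_stringNhd_map_range_iff] at hp hq
      have e₁ : (φ p).2 k = y k := hm₁ m ((le_max_left _ _).trans (le_max_left _ _)) p hp
      have e₂ : (φ q).2 k = y' k := hm₂ m ((le_max_right _ _).trans (le_max_left _ _)) q hq
      exact hk (by rw [← e₁, ← e₂, hpq])
    obtain ⟨t, h, hh, he⟩ := (hH a').resolve_left hbad v (fun t => mem_stringNhd_map_range _ _)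
      (fun t s => (hvx t).trans (hvx s).symm)
    exact hvK t h (mem_iUnion.2 ⟨a', hh⟩) he
  obtain ⟨g, hg, hgP⟩ := AnalyticSet.exists_measurable_graph
    (hQm.analyticSet_image (hev i₀)) hfun
  obtain ⟨z, hz1, hz2, hz3⟩ := ha (insert g K) (hKc.insert g) (by
    rintro h (rfl | hh)
    exacts [hg, hKm h hh])
  refine hz3 i₀ g (mem_insert _ _) (hgP _ ⟨z, ⟨hz1, hz2, fun i h hh => ?_⟩, rfl⟩)
  exact hz3 i h (mem_insert_of_mem _ hh)

/-- **Lusin–Novikov**: a Borel set with countable sections is covered by countably many Borel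
graphs. -/
theorem exists_seq_measurable_graph {A : Set (X × Cantor)} (hA : MeasurableSet A)
    (hc : ∀ x, {y | (x, y) ∈ A}.Countable) :
    ∃ h : ℕ → X → Cantor, (∀ n, Measurable (h n)) ∧ ∀ p ∈ A, ∃ n, p.2 = h n p.1 := by
  by_contra! hcon
  have hbig : ∀ H : Set (X → Cantor), H.Countable → (∀ h ∈ H, Measurable h) →
      ∃ p ∈ A, ∀ h ∈ H, p.2 ≠ h p.1 := by
    intro H hH hm
    obtain ⟨h, hh⟩ := (hH.insert fun _ _ => false).exists_eq_range (insert_nonempty _ _)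
    have hhm : ∀ n, Measurable (h n) := by
      intro n
      rcases (hh ▸ mem_range_self n : h n ∈ insert _ H) with h' | h'
      · rw [h']
        exact measurable_const
      · exact hm _ h'
    obtain ⟨p, hp, hpn⟩ := hcon h hhm
    refine ⟨p, hp, fun g hg => ?_⟩
    obtain ⟨n, rfl⟩ : g ∈ range h := hh ▸ mem_insert_of_mem _ hg
    exact hpn n
  obtain ⟨φ, hφ, hφA⟩ : ∃ φ : (ℕ → ℕ) → X × Cantor, Continuous φ ∧ range φ = A := by
    have han := hA.analyticSet
    rw [AnalyticSet] at han
    refine han.resolve_left fun hemp => ?_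
    obtain ⟨p, hp, -⟩ := hbig ∅ countable_empty (by simp)
    simp [hemp] at hp
  obtain ⟨d, hd⟩ := TopologicalSpace.exists_dense_seq Cantor
  have hstep : ∀ n (a : {a : (Fin n → Bool) → List ℕ // LargeTuple φ a}),
      ∃ a' : {a : (Fin (n + 1) → Bool) → List ℕ // LargeTuple φ a},
      (∀ t, stringNhd (a'.1 t) ⊆ stringNhd (a.1 (Fin.init t)) ∧ n + 1 ≤ (a'.1 t).length) ∧
      ∀ t₀ t₁, Fin.init t₀ = (fun k : Fin n => d n.unpair.1 k) →
        Fin.init t₁ = (fun k : Fin n => d n.unpair.1 k) → t₀ (Fin.last n) = false →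
        t₁ (Fin.last n) = true → ∀ z ∈ stringNhd (a'.1 t₀), ∀ w ∈ stringNhd (a'.1 t₁),
          (φ z).2 ≠ (φ w).2 := by
    rintro n ⟨a, ha⟩
    obtain ⟨a', h1, h2⟩ := ha.exists_double hφ fun k : Fin n => d n.unpair.1 k
    exact ⟨⟨a', h1⟩, h2⟩
  choose next hnext hsep using hstep
  have hzero : LargeTuple φ fun _ : Fin 0 → Bool => ([] : List ℕ) := by
    intro H hH hm
    obtain ⟨p, hp, hpH⟩ := hbig H hH hm
    obtain ⟨z, rfl⟩ := hφA ▸ hp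
    exact ⟨fun _ => z, fun _ => by simp [stringNhd], fun _ _ => rfl, fun _ => hpH⟩
  let s : ∀ n, {a : (Fin n → Bool) → List ℕ // LargeTuple φ a} :=
    fun n => Nat.rec ⟨_, hzero⟩ (fun n a => next n a) n
  have hs : ∀ n, s (n + 1) = next n (s n) := fun n => rfl
  let res : Cantor → ∀ n, Fin n → Bool := fun α n k => α k
  have hmono : ∀ α n m, n ≤ m → stringNhd ((s m).1 (res α m)) ⊆ stringNhd ((s n).1 (res α n)) := by
    intro α n m hnm
    induction m, hnm using Nat.le_induction with
    | base => exact subset_rfl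
    | succ m _ ih => exact ((hnext m (s m) (res α (m + 1))).1).trans ih
  have hlen : ∀ α n, n ≤ ((s n).1 (res α n)).length := by
    rintro α (_ | n)
    · exact Nat.zero_le _
    · exact (hnext n (s n) (res α (n + 1))).2
  have hconf : ∀ n, ∃ z : (Fin n → Bool) → ℕ → ℕ, (∀ i, z i ∈ stringNhd ((s n).1 i)) ∧
      ∀ i j, (φ (z i)).1 = (φ (z j)).1 := by
    intro n
    obtain ⟨z, h1, h2, -⟩ := (s n).2 ∅ countable_empty (by simp)
    exact ⟨z, h1, h2⟩
  choose ζ hζ hζx using hconf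
  let lim : Cantor → ℕ → ℕ := fun α k => ζ (k + 1) (res α (k + 1)) k
  have hlim : ∀ α, Tendsto (fun n => ζ n (res α n)) atTop (𝓝 (lim α)) := by
    refine fun α => tendsto_pi_nhds.2 fun k => tendsto_const_nhds.congr' ?_
    filter_upwards [eventually_ge_atTop (k + 1)] with n hn
    exact eq_of_mem_stringNhd (hζ (k + 1) _) (hmono α _ _ hn (hζ n _)) (hlen α (k + 1))
  have hlim_mem : ∀ α n, lim α ∈ stringNhd ((s n).1 (res α n)) := by
    refine fun α n => (isClosed_stringNhd _).mem_of_tendsto (hlim α) ?_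
    filter_upwards [eventually_ge_atTop n] with m hm using hmono α _ _ hm (hζ m _)
  have hlim_cont : Continuous lim := by
    refine continuous_pi fun k => ?_
    have : Continuous fun α : Cantor => res α (k + 1) :=
      continuous_pi fun i => continuous_apply (i : ℕ)
    exact (continuous_of_discreteTopology (f := fun t => ζ (k + 1) t k)).comp this
  have hx : ∀ α β, (φ (lim α)).1 = (φ (lim β)).1 := by
    intro α β
    have h1 := ((continuous_fst.comp hφ).tendsto _).comp (hlim α)
    have h2 := ((continuous_fst.comp hφ).tendsto _).comp (hlim β)
    refine tendsto_nhds_unique h1 (h2.congr fun n => ?_)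
    exact hζx n _ _
  have hcy : (range fun α => (φ (lim α)).2).Countable := by
    refine (hc (φ (lim fun _ => false)).1).mono ?_
    rintro _ ⟨α, rfl⟩
    rw [mem_ofPred_eq, hx (fun _ => false) α, ← hφA]
    exact mem_range_self _
  have hycont : Continuous fun α => (φ (lim α)).2 :=
    continuous_snd.comp (hφ.comp hlim_cont)
  have := hcy.to_subtype
  obtain ⟨⟨y, hy⟩, hint⟩ := nonempty_interior_of_iUnion_of_closed
    (f := fun y : range fun α => (φ (lim α)).2 => {α | (φ (lim α)).2 = y.1})
    (fun y => isClosed_singleton.preimage hycont)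
    (eq_univ_of_forall fun α => mem_iUnion.2 ⟨⟨_, mem_range_self α⟩, rfl⟩)
  obtain ⟨_, hint', k, rfl⟩ := hd.inter_open_nonempty _ isOpen_interior hint
  obtain ⟨m, hm⟩ := exists_stringNhd_subset isOpen_interior hint'
  set n := Nat.pair k m with hn
  have hmn : m ≤ n := Nat.right_le_pair k m
  let e : Bool → Cantor := fun b => Function.update (d k) n b
  have he : ∀ b, e b ∈ interior {α | (φ (lim α)).2 = y} := fun b =>
    hm n hmn _ fun j hj => Function.update_of_ne hj.ne _ _
  have hinit : ∀ b, Fin.init (res (e b) (n + 1)) = fun i : Fin n => d n.unpair.1 i := by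
    intro b
    funext i
    have : n.unpair.1 = k := by simp [hn]
    rw [this]
    exact Function.update_of_ne i.2.ne _ _
  refine hsep n (s n) (res (e false) (n + 1)) (res (e true) (n + 1)) (hinit _) (hinit _)
    (Function.update_self _ _ _) (Function.update_self _ _ _) _ (hlim_mem _ (n + 1)) _
    (hlim_mem _ (n + 1)) ?_
  exact (interior_subset (he false)).trans (interior_subset (he true)).symm

/-- Borel uniformization of Borel sets with countable sections. -/
theorem exists_measurable_uniformization {R : X → Cantor → Prop}
    (hR : MeasurableSet {p : X × Cantor | R p.1 p.2}) (hc : ∀ x, {y | R x y}.Countable) :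
    MeasurableSet {x | ∃ y, R x y} ∧
      ∃ r : X → Cantor, Measurable r ∧ ∀ x, (∃ y, R x y) → R x (r x) := by
  classical
  obtain ⟨h, hm, hcov⟩ := exists_seq_measurable_graph hR hc
  have hex : ∀ x, (∃ y, R x y) ↔ ∃ n, R x (h n x) := fun x =>
    ⟨fun ⟨y, hy⟩ => (hcov (x, y) hy).imp fun n hn => by rw [← show y = h n x from hn]; exact hy,
      fun ⟨n, hn⟩ => ⟨_, hn⟩⟩
  have hRn : ∀ n, MeasurableSet {x | R x (h n x)} := fun n =>
    hR.preimage (measurable_id.prodMk (hm n))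
  have hdom : MeasurableSet {x | ∃ y, R x y} := by
    simp_rw [hex]
    have := MeasurableSet.iUnion hRn
    simpa only [iUnion_ofPred] using this
  refine ⟨hdom, ?_⟩
  let p : ℕ → X → Prop := fun n x => R x (h n x) ∨ ¬ ∃ y, R x y
  have hp : ∀ x, ∃ n, p n x := by
    intro x
    by_cases hx : ∃ y, R x y
    · exact ((hex x).1 hx).imp fun n => Or.inl
    · exact ⟨0, Or.inr hx⟩
  refine ⟨fun x => h (Nat.find (hp x)) x, Measurable.find hm (fun n => ?_) hp, fun x hx => ?_⟩
  · exact (hRn n).union hdom.compl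
  · exact (Nat.find_spec (hp x)).resolve_right (not_not_intro hx)

end LusinNovikov

namespace E0Array

theorem length_eq (U : E0Array) (n : ℕ) (i j : Bool) : (U.u n i).length = (U.u n j).length := by
  cases i <;> cases j <;> simp [U.len_eq n]

theorem length_pos (U : E0Array) (n : ℕ) (i : Bool) : 0 < (U.u n i).length := by
  rw [U.length_eq n i false]
  exact U.len_pos n

theorem u_injective (U : E0Array) (n : ℕ) : Function.Injective (U.u n) := by
  have := U.ne n
  intro i j h
  cases i <;> cases j <;> simp_all

/-- The concatenation of the first `n` blocks of `xua U a`. -/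
def pref (U : E0Array) (a : Cantor) (n : ℕ) : List Bool :=
  ((List.range n).map fun k => U.u k (a k)).flatten

@[simp]
theorem pref_zero (U : E0Array) (a : Cantor) : U.pref a 0 = [] := rfl

theorem pref_succ (U : E0Array) (a : Cantor) (n : ℕ) :
    U.pref a (n + 1) = U.pref a n ++ U.u n (a n) := by
  simp [pref, List.range_succ]

theorem length_pref_eq (U : E0Array) (a b : Cantor) (n : ℕ) :
    (U.pref a n).length = (U.pref b n).length := by
  induction n with
  | zero => rfl
  | succ n ih => simp [pref_succ, ih, U.length_eq n (a n) (b n)]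

theorem le_length_pref (U : E0Array) (a : Cantor) (n : ℕ) : n ≤ (U.pref a n).length := by
  induction n with
  | zero => simp
  | succ n ih =>
    have := U.length_pos n (a n)
    simp only [pref_succ, List.length_append]
    omega

theorem pref_prefix (U : E0Array) (a : Cantor) {n m : ℕ} (h : n ≤ m) :
    U.pref a n <+: U.pref a m := by
  induction m, h using Nat.le_induction with
  | base => exact List.prefix_rfl
  | succ m _ ih => exact ih.trans (U.pref_succ a m ▸ List.prefix_append _ _)

theorem xua_apply (U : E0Array) (a : Cantor) {n m : ℕ} (h : m < (U.pref a n).length) :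
    xua U a m = (U.pref a n).getD m false := by
  have hm : m < (U.pref a (m + 1)).length := U.le_length_pref a (m + 1)
  change (U.pref a (m + 1)).getD m false = _
  rw [List.getD_eq_getElem _ _ hm, List.getD_eq_getElem _ _ h]
  rcases le_total (m + 1) n with h' | h'
  · exact (U.pref_prefix a h').getElem hm
  · exact ((U.pref_prefix a h').getElem h).symm

theorem map_range_xua (U : E0Array) (a : Cantor) (n : ℕ) :
    (List.range (U.pref a n).length).map (xua U a) = U.pref a n := by
  refine List.ext_getElem (by simp) fun k h₁ h₂ => ?_
  simp [U.xua_apply a h₂, h₂]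

theorem pref_congr (U : E0Array) {a b : Cantor} {n : ℕ} (h : ∀ k < n, a k = b k) :
    U.pref a n = U.pref b n := by
  unfold pref
  congr 1
  exact List.map_congr_left fun k hk => by rw [h k (List.mem_range.1 hk)]

theorem continuous_xua (U : E0Array) : Continuous (xua U) := by
  refine continuous_pi fun m => continuous_iff_continuousAt.2 fun a => ?_
  refine tendsto_nhds_of_eventually_eq ?_
  have : ∀ᶠ b : Cantor in 𝓝 a, ∀ k < m + 1, b k = a k := by
    refine (finite_Iio (m + 1)).eventually_all.2 fun k _ => ?_
    exact (isOpen_discrete {a k}).preimage (continuous_apply (A := fun _ => Bool) k)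
      |>.mem_nhds rfl
  filter_upwards [this] with b hb
  change (U.pref b (m + 1)).getD m false = (U.pref a (m + 1)).getD m false
  rw [U.pref_congr hb]

theorem pref_eq_of_xua_eq (U : E0Array) {a b : Cantor} (h : xua U a = xua U b) (n : ℕ) :
    U.pref a n = U.pref b n := by
  rw [← U.map_range_xua a, ← U.map_range_xua b, h, U.length_pref_eq a b]

theorem injective_xua (U : E0Array) : Function.Injective (xua U) := by
  intro a b h
  funext n
  have := U.pref_eq_of_xua_eq h (n + 1)
  rw [pref_succ, pref_succ, U.pref_eq_of_xua_eq h n, List.append_cancel_left_eq] at this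
  exact U.u_injective n this

theorem measurableSet_Du (U : E0Array) : MeasurableSet (Du U) :=
  measurableSet_range_of_continuous_injective U.continuous_xua U.injective_xua

/-- Points of `D_u` whose indices agree from `n` on have the same tail after their first `n`
blocks. -/
theorem xua_add_length_pref (U : E0Array) {a b : Cantor} {n : ℕ} (h : ∀ k ≥ n, a k = b k)
    (m : ℕ) : xua U a (m + (U.pref a n).length) = xua U b (m + (U.pref b n).length) := by
  have key : ∀ N ≥ n, ∃ r, U.pref a N = U.pref a n ++ r ∧ U.pref b N = U.pref b n ++ r := by
    intro N hN
    induction N, hN using Nat.le_induction with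
    | base => exact ⟨[], by simp⟩
    | succ N hN ih =>
      obtain ⟨r, h₁, h₂⟩ := ih
      exact ⟨r ++ U.u N (b N), by rw [pref_succ, h₁, h N hN, List.append_assoc],
        by rw [pref_succ, h₂, List.append_assoc]⟩
  have hl := U.length_pref_eq a b n
  set N := n + m + (U.pref a n).length + 1 with hN
  obtain ⟨r, h₁, h₂⟩ := key N (by omega)
  have ha := U.le_length_pref a N
  have hb := U.le_length_pref b N
  rw [U.xua_apply a (n := N) (by omega), U.xua_apply b (n := N) (by omega), h₁, h₂,
    List.getD_append_right _ _ _ _ (by omega), List.getD_append_right _ _ _ _ (by omega)]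
  simp

theorem eZero_xua (U : E0Array) {a b : Cantor} (h : eZero a b) : eZero (xua U a) (xua U b) := by
  obtain ⟨n, hn⟩ := h.bddAbove
  have hab : ∀ k ≥ n + 1, a k = b k := by
    intro k hk
    by_contra hne
    exact absurd (hn hne) (by omega)
  refine (finite_Iio (U.pref a (n + 1)).length).subset fun k hk => ?_
  by_contra hlt
  obtain ⟨m, rfl⟩ := Nat.exists_eq_add_of_le' (not_lt.1 hlt)
  refine hk ?_
  have := U.xua_add_length_pref hab m
  rwa [U.length_pref_eq b a] at this

/-- The string obtained by substituting the word `w` into the blocks of `U` from `o` on. -/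
def subst (U : E0Array) (o : ℕ) (w : List Bool) : List Bool :=
  ((List.range w.length).map fun j => U.u (o + j) (w.getD j false)).flatten

theorem subst_concat (U : E0Array) (o : ℕ) (w : List Bool) (b : Bool) :
    U.subst o (w ++ [b]) = U.subst o w ++ U.u (o + w.length) b := by
  simp only [subst, List.length_append, List.length_singleton, List.range_succ, List.map_append,
    List.flatten_append, List.map_cons, List.map_nil]
  congr 2
  · refine List.map_congr_left fun j hj => ?_
    rw [List.getD_append _ _ _ _ (List.mem_range.1 hj)]
  · simp

theorem length_subst_eq (U : E0Array) (o : ℕ) {w v : List Bool} (h : w.length = v.length) :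
    (U.subst o w).length = (U.subst o v).length := by
  simp only [subst, List.length_flatten, List.map_map, h]
  congr 1
  exact List.map_congr_left fun j _ => U.length_eq _ _ _

theorem length_subst_ge (U : E0Array) (o : ℕ) (w : List Bool) :
    w.length ≤ (U.subst o w).length := by
  induction w using List.reverseRecOn with
  | nil => simp
  | append_singleton w b ih =>
    have := U.length_pos (o + w.length) b
    simp only [subst_concat, List.length_append, List.length_singleton]
    omega

theorem subst_injective (U : E0Array) (o : ℕ) {w v : List Bool} (hl : w.length = v.length)
    (h : U.subst o w = U.subst o v) : w = v := by
  induction w using List.reverseRecOn generalizing v with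
  | nil => exact (List.length_eq_zero_iff.1 hl.symm).symm
  | append_singleton w b ih =>
    induction v using List.reverseRecOn with
    | nil => simp at hl
    | append_singleton v c _ =>
      have hl' : w.length = v.length := by simpa using hl
      rw [subst_concat, subst_concat] at h
      obtain ⟨h₁, h₂⟩ := List.append_inj h (U.length_subst_eq o hl')
      rw [ih hl' h₁, U.u_injective _ ((hl' ▸ h₂ : U.u (o + w.length) b = U.u (o + w.length) c))]

theorem pref_add (U : E0Array) (c : Cantor) (o l : ℕ) :
    U.pref c (o + l) = U.pref c o ++ U.subst o ((List.range l).map fun j => c (o + j)) := by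
  induction l with
  | zero => simp [subst]
  | succ l ih =>
    rw [← Nat.add_assoc, pref_succ, ih, List.range_succ, List.map_append, List.map_singleton,
      subst_concat, List.append_assoc]
    simp

/-- Composition of `E₀`-arrays. -/
def comp (U W : E0Array) : E0Array where
  u n i := U.subst (W.pref (fun _ => false) n).length (W.u n i)
  len_eq n := U.length_subst_eq _ (W.len_eq n)
  len_pos n := (W.len_pos n).trans (U.length_subst_ge _ _)
  ne n h := W.ne n (U.subst_injective _ (W.len_eq n) h)

theorem pref_comp (U W : E0Array) (a : Cantor) (n : ℕ) :
    (U.comp W).pref a n = U.pref (xua W a) (W.pref a n).length := by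
  induction n with
  | zero => rfl
  | succ n ih =>
    have hblock : (List.range (W.u n (a n)).length).map
        (fun j => xua W a ((W.pref a n).length + j)) = W.u n (a n) := by
      refine List.ext_getElem (by simp) fun k h₁ h₂ => ?_
      rw [List.getElem_map, List.getElem_range,
        W.xua_apply a (n := n + 1) (by rw [pref_succ, List.length_append]; omega), pref_succ,
        List.getD_append_right _ _ _ _ (by omega)]
      simp [h₂]
    rw [pref_succ, ih, pref_succ, List.length_append, pref_add, hblock]
    simp only [comp, W.length_pref_eq (fun _ => false) a n]

theorem xua_comp (U W : E0Array) (a : Cantor) : xua (U.comp W) a = xua U (xua W a) := by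
  funext m
  have hm : m < ((U.comp W).pref a (m + 1)).length := le_length_pref _ a (m + 1)
  rw [xua_apply _ a hm, xua_apply U (xua W a) (by rwa [pref_comp] at hm), pref_comp]

end E0Array

theorem eZero_of_eventually_eq {x y : Cantor} {n : ℕ} (h : ∀ k ≥ n, x k = y k) : eZero x y :=
  (finite_Iio n).subset fun k hk => not_le.1 fun hn => hk (h k hn)

theorem eZero.exists_eq_of_ge {x y : Cantor} (h : eZero x y) : ∃ n, ∀ k ≥ n, x k = y k := by
  obtain ⟨n, hn⟩ := h.bddAbove
  refine ⟨n + 1, fun k hk => ?_⟩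
  by_contra hne
  exact absurd (hn hne) (by omega)

/-- The homeomorphism of the Cantor space which flips the coordinates in `s`. -/
def flipHomeomorph (s : Finset ℕ) : Cantor ≃ₜ Cantor where
  toFun x k := xor (x k) (decide (k ∈ s))
  invFun x k := xor (x k) (decide (k ∈ s))
  left_inv x := by funext k; simp
  right_inv x := by funext k; simp
  continuous_toFun := continuous_pi fun k =>
    continuous_of_discreteTopology (f := fun b : Bool => xor b (decide (k ∈ s))) |>.comp
      (continuous_apply k)
  continuous_invFun := continuous_pi fun k =>
    continuous_of_discreteTopology (f := fun b : Bool => xor b (decide (k ∈ s))) |>.comp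
      (continuous_apply k)

theorem flipHomeomorph_apply (s : Finset ℕ) (x : Cantor) (k : ℕ) :
    flipHomeomorph s x k = xor (x k) (decide (k ∈ s)) := rfl

theorem eZero.exists_flip {x y : Cantor} (h : eZero x y) : ∃ s, y = flipHomeomorph s x := by
  refine ⟨Set.Finite.toFinset h, funext fun k => ?_⟩
  have hk : k ∈ Set.Finite.toFinset h ↔ x k ≠ y k := Set.Finite.mem_toFinset h
  rw [flipHomeomorph_apply]
  by_cases hxy : x k = y k
  · simp [hk, hxy]
  · simpa [hk, hxy] using Bool.eq_not.2 (Ne.symm hxy)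

/-- On the dense `Gδ`, `E₀`-invariant set `G`, the relation `Bad` between `E₀`-equivalent points
and the graphs of the functions `h k` can be avoided on whole cylinders. -/
structure IsDecisive (Bad : Cantor → Cantor → Prop) (h : ℕ → Cantor → Cantor) (G : Set Cantor) :
    Prop where
  isGδ : IsGδ G
  dense : Dense G
  invariant : ∀ x y, eZero x y → x ∈ G → y ∈ G
  bad : ∀ x ∈ G, ∀ y, eZero x y → ¬ Bad x y → ∀ᶠ K in atTop, ∀ x' ∈ G, ∀ y',
    (∀ k < K, x' k = x k) → (∀ k < K, y' k = y k) → (∀ k ≥ K, x' k = y' k) → ¬ Bad x' y'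
  graph : ∀ x ∈ G, ∀ n, ∀ y ≠ h n x, ∀ᶠ K in atTop, ∀ x' ∈ G, ∀ y',
    (∀ k < K, x' k = x k) → (∀ k < K, y' k = y k) → y' ≠ h n x'

theorem exists_isDecisive {Bad : Cantor → Cantor → Prop} {h : ℕ → Cantor → Cantor}
    (hBad : MeasurableSet {p : Cantor × Cantor | Bad p.1 p.2}) (hh : ∀ n, Measurable (h n)) :
    ∃ G, IsDecisive Bad h G := by
  have hflip : ∀ s, MeasurableSet {x | ¬ Bad x (flipHomeomorph s x)} := fun s =>
    (hBad.preimage (measurable_id.prodMk (flipHomeomorph s).continuous.measurable)).compl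
  choose O hO hOe using fun s => (hflip s).residualEq_isOpen
  have hcoord : ∀ i : ℕ × ℕ × Bool, MeasurableSet {x | h i.1 x i.2.1 = i.2.2} := fun i =>
    ((measurable_pi_apply i.2.1).comp (hh i.1)) (measurableSet_singleton i.2.2)
  choose V hV hVe using fun i => (hcoord i).residualEq_isOpen
  have hC : {x | (∀ s, (¬ Bad x (flipHomeomorph s x) ↔ x ∈ O s)) ∧
      ∀ i, (h i.1 x i.2.1 = i.2.2 ↔ x ∈ V i)} ∈ residual Cantor := by
    filter_upwards [eventually_countable_forall.2 fun s => (hOe s).mem_iff,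
      eventually_countable_forall.2 fun i => (hVe i).mem_iff] with x h₁ h₂
    exact ⟨h₁, h₂⟩
  obtain ⟨T, hTC, hTG, hTd⟩ := mem_residual.1 hC
  have hmem : ∀ {x}, x ∈ ⋂ s, flipHomeomorph s ⁻¹' T → x ∈ T := by
    intro x hx
    have := mem_iInter.1 hx ∅
    rwa [mem_preimage, show flipHomeomorph ∅ x = x from
      funext fun k => by simp [flipHomeomorph_apply]] at this
  refine ⟨⋂ s, flipHomeomorph s ⁻¹' T, ?_, ?_, ?_, ?_, ?_⟩
  · exact IsGδ.iInter fun s => hTG.preimage (flipHomeomorph s).continuous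
  · refine dense_of_mem_residual (countable_iInter_mem.2 fun s => ?_)
    exact tendsto_residual_of_isOpenMap (flipHomeomorph s).continuous
      (flipHomeomorph s).isOpenMap (residual_of_dense_Gδ hTG hTd)
  · intro x y hxy hx
    obtain ⟨s, rfl⟩ := hxy.exists_flip
    refine mem_iInter.2 fun t => ?_
    have := mem_iInter.1 hx (symmDiff s t)
    rw [mem_preimage] at this ⊢
    convert this using 1
    funext k
    simp only [flipHomeomorph_apply, Finset.mem_symmDiff]
    by_cases h₁ : k ∈ s <;> by_cases h₂ : k ∈ t <;> simp [h₁, h₂]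
  · intro x hx y hxy hb
    obtain ⟨s, rfl⟩ := hxy.exists_flip
    obtain ⟨m, hm⟩ := exists_stringNhd_subset (hO s) (((hTC (hmem hx)).1 s).1 hb)
    filter_upwards [eventually_ge_atTop m, eventually_gt_atTop (s.sup id)] with K hK hKs
    intro x' hx' y' h₁ h₂ h₃
    have hy' : y' = flipHomeomorph s x' := by
      funext k
      rcases lt_or_ge k K with hk | hk
      · rw [h₂ k hk, flipHomeomorph_apply, flipHomeomorph_apply, h₁ k hk]
      · have : k ∉ s := fun hks =>
          absurd (Finset.le_sup (f := id) hks) (not_le.2 (hKs.trans_le hk))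
        simp [flipHomeomorph_apply, this, h₃ k hk]
    rw [hy']
    exact ((hTC (hmem hx')).1 s).2 (hm K hK x' h₁)
  · intro x hx n y hy
    obtain ⟨j, hj⟩ := Function.ne_iff.1 hy
    obtain ⟨m, hm⟩ := exists_stringNhd_subset (hV (n, j, h n x j))
      (((hTC (hmem hx)).2 (n, j, h n x j)).1 rfl)
    filter_upwards [eventually_ge_atTop m, eventually_gt_atTop j] with K hK hKj
    intro x' hx' y' h₁ h₂ he
    have := ((hTC (hmem hx')).2 (n, j, h n x j)).2 (hm K hK x' h₁)
    refine hj ?_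
    rw [← h₂ j hKj, he]
    exact this

/-- The infinite sequence `p ⌢ z`. -/
def glue (p : List Bool) (z : Cantor) : Cantor := fun m => p.getD m (z (m - p.length))

theorem glue_of_ge {p : List Bool} (z : Cantor) {m : ℕ} (h : p.length ≤ m) :
    glue p z m = z (m - p.length) := by
  simp [glue, h]

theorem map_range_glue (p : List Bool) (z : Cantor) (K : ℕ) :
    (List.range (p.length + K)).map (glue p z) = p ++ (List.range K).map z := by
  refine List.ext_getElem (by simp) fun k h₁ h₂ => ?_
  rw [List.getElem_map, List.getElem_range]
  rcases lt_or_ge k p.length with hk | hk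
  · simp [glue, hk, List.getElem_append_left hk]
  · simp [glue_of_ge z hk, List.getElem_append_right hk]

/-- A finite set of strings of length `L` such that no generic point through one of them is bad
with the point through another one that has the same tail. -/
structure IsLevel (Bad : Cantor → Cantor → Prop) (G : Set Cantor) (L : ℕ)
    (P : Finset (List Bool)) : Prop where
  nonempty : P.Nonempty
  length : ∀ p ∈ P, p.length = L
  not_bad : ∀ p ∈ P, ∀ q ∈ P, ∀ x ∈ stringNhd p, ∀ y ∈ stringNhd q, (∀ m ≥ L, x m = y m) →
    x ∈ G → ¬ Bad x y

theorem IsLevel.exists_blocks {Bad : Cantor → Cantor → Prop} {h : ℕ → Cantor → Cantor}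
    {G : Set Cantor} (hG : IsDecisive Bad h G) (hsymm : ∀ x y, Bad x y → Bad y x)
    (htri : ∀ a b c d, Bad a b → Bad a c → Bad d c → Bad d b)
    {L : ℕ} {P : Finset (List Bool)} (hP : IsLevel Bad G L P) {O : Set Cantor} (hO : IsOpen O)
    (hGO : G ⊆ O) (n : ℕ) :
    ∃ u : Bool → List Bool, (u false).length = (u true).length ∧ 1 ≤ (u false).length ∧
      u false ≠ u true ∧
      IsLevel Bad G (L + (u false).length)
        ((P ×ˢ Finset.univ).image fun r : List Bool × Bool => r.1 ++ u r.2) ∧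
      (∀ p ∈ P, ∀ b, stringNhd (p ++ u b) ⊆ O) ∧
      ∀ p ∈ P, ∀ q ∈ P, ∀ x ∈ stringNhd (p ++ u false), ∀ y ∈ stringNhd (q ++ u true), x ∈ G →
        ∀ k ≤ n, y ≠ h k x := by
  obtain ⟨p₀, hp₀⟩ := hP.nonempty
  have h₀ : (List.range p₀.length).map (glue p₀ fun _ => false) = p₀ := by
    simpa using map_range_glue p₀ (fun _ => false) 0
  have hopen : IsOpen (stringNhd p₀) := by
    have : stringNhd p₀ = {z | ∀ k ∈ Finset.range p₀.length, z k = glue p₀ (fun _ => false) k} := by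
      conv_lhs => rw [← h₀]
      ext z
      simp [mem_stringNhd_map_range_iff]
    rw [this]
    simp only [ofPred_forall]
    exact isOpen_biInter_finset fun k _ => (isOpen_discrete {glue p₀ (fun _ => false) k}).preimage
      (continuous_apply (A := fun _ : ℕ => Bool) k)
  obtain ⟨x₀, hx₀p, hx₀⟩ := hG.dense.inter_open_nonempty _ hopen
    ⟨glue p₀ fun _ => false, h₀⟩
  let z : ℕ → Cantor := fun j i => xor (x₀ (L + i)) (decide (i = j))
  have hzne : ∀ j j', j ≠ j' → z j j ≠ z j' j := by
    intro j j' hj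
    simp [z, hj]
  let pt : List Bool → ℕ → Cantor := fun p j => glue p (z j)
  have hpt_ge : ∀ p ∈ P, ∀ j, ∀ m ≥ L, pt p j m = z j (m - L) := by
    intro p hp j m hm
    have hl := hP.length p hp
    rw [← hl]
    exact glue_of_ge _ (hl ▸ hm)
  have hptG : ∀ p ∈ P, ∀ j, pt p j ∈ G := by
    intro p hp j
    refine hG.invariant x₀ _ (eZero_of_eventually_eq (n := L + j + 1) fun k hk => ?_) hx₀
    rw [hpt_ge p hp j k (by omega)]
    have h₁ : L + (k - L) = k := by omega
    have h₂ : k - L ≠ j := by omega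
    simp [z, h₁, h₂]
  have hpt_eZero : ∀ p ∈ P, ∀ q ∈ P, ∀ j j', eZero (pt p j) (pt q j') := by
    intro p hp q hq j j'
    refine eZero_of_eventually_eq (n := L + j + j' + 1) fun k hk => ?_
    rw [hpt_ge p hp j k (by omega), hpt_ge q hq j' k (by omega)]
    have h₁ : k - L ≠ j := by omega
    have h₂ : k - L ≠ j' := by omega
    simp [z, h₁, h₂]
  have hpt_ne : ∀ p ∈ P, ∀ j j', pt p j = pt p j' → j = j' := by
    intro p hp j j' he
    by_contra hne
    have := congrFun he (L + j)
    rw [hpt_ge p hp j _ (by omega), hpt_ge p hp j' _ (by omega), Nat.add_sub_cancel_left] at this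
    exact hzne j j' hne this
  have hpt_nhd : ∀ p ∈ P, ∀ j K x, x ∈ stringNhd (p ++ (List.range K).map (z j)) ↔
      ∀ k < L + K, x k = pt p j k := by
    intro p hp j K x
    rw [← map_range_glue, mem_stringNhd_map_range_iff, hP.length p hp]
  have hnhd : ∀ p ∈ P, ∀ j K x, (∀ k < L + K, x k = pt p j k) → x ∈ stringNhd p := by
    intro p hp j K x hx
    have := (hpt_nhd p hp j 0 x).2 fun k hk => hx k (by omega)
    simpa using this
  obtain ⟨j, j', hjj', hgr, hbad⟩ : ∃ j j', j' ≠ j ∧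
      (∀ p ∈ P, ∀ q ∈ P, ∀ k ≤ n, pt q j' ≠ h k (pt p j)) ∧
      ∀ p ∈ P, ∀ q ∈ P, ¬ Bad (pt p j) (pt q j') := by
    by_contra! hcon
    have hcof : ∀ j, ∀ᶠ j' in hyperfilter ℕ, j' ≠ j ∧
        ∀ p ∈ P, ∀ q ∈ P, ∀ k ≤ n, pt q j' ≠ h k (pt p j) := by
      intro j
      refine hyperfilter_le_cofinite ?_
      refine (eventually_cofinite_ne j).and ?_
      simp only [eventually_all_finset]
      intro p hp q hq
      refine (finite_Iic n).eventually_all.2 fun k _ => ?_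
      refine (Set.Subsingleton.finite ?_ : {j' | ¬ pt q j' ≠ h k (pt p j)}.Finite)
      intro i hi i' hi'
      simp only [ne_eq, not_not, mem_ofPred_eq] at hi hi'
      exact hpt_ne q hq i i' (hi.trans hi'.symm)
    have hex : ∀ j, ∃ r ∈ (↑(P ×ˢ P) : Set (List Bool × List Bool)),
        ∀ᶠ j' in hyperfilter ℕ, Bad (pt r.1 j) (pt r.2 j') := by
      intro j
      refine (Ultrafilter.eventually_exists_mem_iff (Finset.finite_toSet _)).1 ?_
      filter_upwards [hcof j] with j' hj'
      obtain ⟨p, hp, q, hq, hb⟩ := hcon j j' hj'.1 hj'.2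
      exact ⟨(p, q), by simp [hp, hq], hb⟩
    obtain ⟨⟨p, q⟩, hpq, hev⟩ := (Ultrafilter.eventually_exists_mem_iff
      (Finset.finite_toSet (P ×ˢ P))).1 (Eventually.of_forall (f := (hyperfilter ℕ : Filter ℕ)) hex)
    simp only [Finset.coe_product, mem_prod, Finset.mem_coe] at hpq
    obtain ⟨j₁, h₁⟩ := hev.exists
    obtain ⟨j₂, h₂, h₁₂⟩ := (hev.and h₁).exists
    obtain ⟨j₃, h₁₃, h₂₃⟩ := (h₁.and h₂).exists
    refine hP.not_bad p hpq.1 q hpq.2 (pt p j₂) (hnhd p hpq.1 j₂ 0 _ fun _ _ => rfl) (pt q j₂)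
      (hnhd q hpq.2 j₂ 0 _ fun _ _ => rfl) (fun m hm => ?_) (hptG p hpq.1 j₂)
      (htri _ _ _ _ h₁₂ h₁₃ h₂₃)
    rw [hpt_ge p hpq.1 j₂ m hm, hpt_ge q hpq.2 j₂ m hm]
  have e₁ : ∀ᶠ K in atTop, ∀ p ∈ P, ∀ q ∈ P, ∀ x' ∈ G, ∀ y', (∀ k < K, x' k = pt p j k) →
      (∀ k < K, y' k = pt q j' k) → (∀ k ≥ K, x' k = y' k) → ¬ Bad x' y' := by
    simp only [eventually_all_finset]
    exact fun p hp q hq => hG.bad _ (hptG p hp j) _ (hpt_eZero p hp q hq j j') (hbad p hp q hq)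
  have e₂ : ∀ᶠ K in atTop, ∀ p ∈ P, ∀ q ∈ P, ∀ k ∈ Finset.Iic n, ∀ x' ∈ G, ∀ y',
      (∀ k < K, x' k = pt p j k) → (∀ k < K, y' k = pt q j' k) → y' ≠ h k x' := by
    simp only [eventually_all_finset]
    exact fun p hp q hq k hk => hG.graph _ (hptG p hp j) k _ (hgr p hp q hq k (Finset.mem_Iic.1 hk))
  have e₃ : ∀ i, ∀ᶠ K in atTop, ∀ p ∈ P, ∀ x, (∀ k < K, x k = pt p i k) → x ∈ O := by
    intro i
    simp only [eventually_all_finset]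
    intro p hp
    obtain ⟨m, hm⟩ := exists_stringNhd_subset hO (hGO (hptG p hp i))
    filter_upwards [eventually_ge_atTop m] with K hK using hm K hK
  obtain ⟨M, hM₁, hM₂, hM₃, hM₄, hM⟩ := (e₁.and (e₂.and ((e₃ j).and ((e₃ j').and
    (eventually_ge_atTop (L + j + j' + 1)))))).exists
  obtain ⟨K, rfl⟩ : ∃ K, M = L + K := ⟨M - L, by omega⟩
  let J : Bool → ℕ := fun b => bif b then j' else j
  refine ⟨fun b => (List.range K).map (z (J b)), by simp, by simp; omega, ?_, ?_, ?_, ?_⟩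
  · intro he
    have := List.map_inj_left.1 he j (List.mem_range.2 (by omega))
    exact hzne j j' hjj'.symm this
  · refine ⟨?_, ?_, ?_⟩
    · exact (hP.nonempty.product Finset.univ_nonempty).image _
    · intro r hr
      obtain ⟨⟨p, b⟩, hpb, rfl⟩ := Finset.mem_image.1 hr
      simp [hP.length p (Finset.mem_product.1 hpb).1]
    · intro r hr r' hr' x hx y hy hxy hxG
      obtain ⟨⟨p, b⟩, hpb, rfl⟩ := Finset.mem_image.1 hr
      obtain ⟨⟨q, c⟩, hqc, rfl⟩ := Finset.mem_image.1 hr'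
      have hp := (Finset.mem_product.1 hpb).1
      have hq := (Finset.mem_product.1 hqc).1
      simp only [hpt_nhd p hp, hpt_nhd q hq] at hx hy
      simp only [List.length_map, List.length_range] at hxy
      by_cases hbc : b = c
      · subst hbc
        refine hP.not_bad p hp q hq x (hnhd p hp _ K x hx) y (hnhd q hq _ K y hy) ?_ hxG
        intro m hm
        rcases lt_or_ge m (L + K) with hmK | hmK
        · rw [hx m hmK, hy m hmK, hpt_ge p hp _ m hm, hpt_ge q hq _ m hm]
        · exact hxy m hmK
      · have hyG : y ∈ G := hG.invariant x y (eZero_of_eventually_eq hxy) hxG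
        rcases b with _ | _ <;> rcases c with _ | _
        · exact absurd rfl hbc
        · exact hM₁ p hp q hq x hxG y hx hy hxy
        · exact fun hb => hM₁ q hq p hp y hyG x hy hx (fun k hk => (hxy k hk).symm) (hsymm _ _ hb)
        · exact absurd rfl hbc
  · intro p hp b x hx
    rw [hpt_nhd p hp] at hx
    rcases b with _ | _
    · exact hM₃ p hp x hx
    · exact hM₄ p hp x hx
  · intro p hp q hq x hx y hy hxG k hk
    rw [hpt_nhd p hp] at hx
    rw [hpt_nhd q hq] at hy
    exact hM₂ p hp q hq k (Finset.mem_Iic.2 hk) x hxG y hx hy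

/-- There is a canonical `E₀`-large set on which `Bad` is void between `E₀`-equivalent points and
which avoids the graphs of countably many Borel functions. -/
theorem exists_array_avoiding {Bad : Cantor → Cantor → Prop} {h : ℕ → Cantor → Cantor}
    (hBad : MeasurableSet {p : Cantor × Cantor | Bad p.1 p.2}) (hh : ∀ n, Measurable (h n))
    (hirr : ∀ x, ¬ Bad x x) (hsymm : ∀ x y, Bad x y → Bad y x)
    (htri : ∀ a b c d, Bad a b → Bad a c → Bad d c → Bad d b) :
    ∃ W : E0Array, (∀ a b, eZero a b → ¬ Bad (xua W a) (xua W b)) ∧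
      ∀ a b, (∃ᶠ n in atTop, a n = false ∧ b n = true) → ∀ k, xua W b ≠ h k (xua W a) := by
  obtain ⟨G, hG⟩ := exists_isDecisive hBad hh
  obtain ⟨C, hC, hGC⟩ := isGδ_iff_eq_iInter_nat.1 hG.isGδ
  have hGC' : ∀ n, G ⊆ C n := fun n => hGC ▸ iInter_subset C n
  have hzero : IsLevel Bad G 0 {[]} := by
    refine ⟨Finset.singleton_nonempty _, by simp, ?_⟩
    intro p _ q _ x _ y _ hxy _
    rw [show y = x from funext fun m => (hxy m m.zero_le).symm]
    exact hirr x
  have hstep := fun (n : ℕ) (s : {s : ℕ × Finset (List Bool) // IsLevel Bad G s.1 s.2}) =>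
    s.2.exists_blocks hG hsymm htri (hC n) (hGC' n) n
  choose u hlen hpos hne hlev hopen hgraph using hstep
  let s : ℕ → {s : ℕ × Finset (List Bool) // IsLevel Bad G s.1 s.2} :=
    fun n => Nat.rec ⟨(0, {[]}), hzero⟩ (fun n s => ⟨(_, _), hlev n s⟩) n
  let W : E0Array := ⟨fun n => u n (s n), fun n => hlen n _, fun n => hpos n _, fun n => hne n _⟩
  have hpref : ∀ a n, W.pref a n ∈ (s n).1.2 := by
    intro a n
    induction n with
    | zero => exact Finset.mem_singleton_self _
    | succ n ih =>
      rw [E0Array.pref_succ]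
      exact Finset.mem_image.2 ⟨(W.pref a n, a n),
        Finset.mem_product.2 ⟨ih, Finset.mem_univ _⟩, rfl⟩
  have hnhd : ∀ a n, xua W a ∈ stringNhd (W.pref a n) := fun a n => W.map_range_xua a n
  have hxG : ∀ a, xua W a ∈ G := by
    intro a
    rw [hGC]
    refine mem_iInter.2 fun n => hopen n (s n) _ (hpref a n) (a n) ?_
    exact W.pref_succ a n ▸ hnhd a (n + 1)
  refine ⟨W, fun a b hab => ?_, fun a b hab k => ?_⟩
  · obtain ⟨n, hn⟩ := hab.exists_eq_of_ge
    refine (s n).2.not_bad _ (hpref a n) _ (hpref b n) _ (hnhd a n) _ (hnhd b n) ?_ (hxG a)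
    intro m hm
    obtain ⟨m, rfl⟩ := Nat.exists_eq_add_of_le' hm
    have := W.xua_add_length_pref hn m
    rwa [(s n).2.length _ (hpref a n), (s n).2.length _ (hpref b n)] at this
  · obtain ⟨n, hn, ha, hb⟩ := frequently_atTop.1 hab k
    refine hgraph n (s n) _ (hpref a n) _ (hpref b n) _ ?_ _ ?_ (hxG a) k hn
    · have := hnhd a (n + 1)
      rwa [E0Array.pref_succ, ha] at this
    · have := hnhd b (n + 1)
      rwa [E0Array.pref_succ, hb] at this

namespace DBS

variable {D E : Cantor → Cantor → Prop}

theorem trans_iff (h : DBS D E) {a b c : Cantor} (hab : E a b) (hbc : E b c) :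
    D a c ↔ (D a b ↔ D b c) := by
  have hs := fun {x y : Cantor} => h.equivD.symm (x := x) (y := y)
  have ht := fun {x y z : Cantor} => h.equivD.trans (x := x) (y := y) (z := z)
  obtain ⟨y, _, _, hy⟩ := h.double b
  constructor
  · exact fun hac => ⟨fun h' => ht (hs h') hac, fun h' => ht hac (hs h')⟩
  · intro hiff
    rcases hy a (h.equivE.symm hab) with ha | ha
    · exact ht (hs ha) (hiff.1 (hs ha))
    · rcases hy c hbc with hc | hc
      · exact ht (hiff.2 hc) hc
      · exact ht (hs ha) hc

theorem measurableSet_E (h : DBS D E) {α : Type*} [MeasurableSpace α] {g k : α → Cantor}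
    (hg : Measurable g) (hk : Measurable k) : MeasurableSet {a | E (g a) (k a)} :=
  h.borelE.preimage (hg.prodMk hk)

theorem measurableSet_D (h : DBS D E) {α : Type*} [MeasurableSpace α] {g k : α → Cantor}
    (hg : Measurable g) (hk : Measurable k) : MeasurableSet {a | D (g a) (k a)} :=
  h.borelD.preimage (hg.prodMk hk)

theorem countable_preimage (h : DBS D E) {F : Cantor → Cantor} {X : Set Cantor}
    (hF : InjOn F X) (u : Cantor) : {x | x ∈ X ∧ E u (F x)}.Countable :=
  MapsTo.countable_of_injOn (f := F) (t := {y | E u y}) (fun _ hx => hx.2)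
    (hF.mono fun _ hx => hx.1) (h.countableE u)

/-- A double-bubble system can be pulled back along a Borel map `ρ` for which the preimages of
`E`-classes are countable and which meets both `D`-classes in each `E`-class that it meets. -/
theorem comap (h : DBS D E) {ρ : Cantor → Cantor} (hρ : Measurable ρ)
    (hc : ∀ u, {v | E u (ρ v)}.Countable)
    (hd : ∀ u, ∃ y, E (ρ u) (ρ y) ∧ ¬ D (ρ u) (ρ y)) :
    DBS (fun u v => D (ρ u) (ρ v)) fun u v => E (ρ u) (ρ v) where
  equivD := h.equivD.comap ρ
  equivE := h.equivE.comap ρ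
  borelD := h.measurableSet_D (hρ.comp measurable_fst) (hρ.comp measurable_snd)
  borelE := h.measurableSet_E (hρ.comp measurable_fst) (hρ.comp measurable_snd)
  countableD u := (hc (ρ u)).mono fun v hv => h.sub _ _ hv
  countableE u := hc (ρ u)
  sub u v := h.sub _ _
  double u := by
    obtain ⟨y, hy, hny⟩ := hd u
    refine ⟨y, hy, hny, fun z hz => or_iff_not_imp_left.2 fun hnz => ?_⟩
    exact (h.trans_iff (h.equivE.symm hy) hz).2
      ⟨fun h' => absurd (h.equivD.symm h') hny, fun h' => absurd h' hnz⟩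

/-- A double-bubble system can be extended so as to accommodate a Borel injection `F` on `X`,
provided `F` is compatible with the classes which are already glued. -/
theorem exists_extension (h : DBS D E) {X : Set Cantor} (hX : MeasurableSet X)
    {F : Cantor → Cantor} (hF : Measurable F) (hinj : InjOn F X)
    (hcross : ∀ x ∈ X, ∀ y ∈ X, E (F x) y → E x y)
    (himage : ∀ x ∈ X, ∀ y ∈ X, E (F x) (F y) → E x y)
    (hsign : ∀ x ∈ X, ∀ y ∈ X, E x y → E (F x) (F y) → (D x y ↔ D (F x) (F y))) :
    ∃ D' E', DBS D' E' ∧ DBSle D E D' E' ∧ ∀ x ∈ X, E' (F x) x := by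
  classical
  have hs := fun {x y : Cantor} => h.equivE.symm (x := x) (y := y)
  have ht := fun {x y z : Cantor} => h.equivE.trans (x := x) (y := y) (z := z)
  have hDs : ∀ x y, D x y ↔ D y x := fun x y => ⟨h.equivD.symm, h.equivD.symm⟩
  let Z : Set Cantor := {x | x ∈ X ∧ ¬ E (F x) x}
  have hZm : MeasurableSet Z := hX.inter (h.measurableSet_E hF measurable_id).compl
  have hZ : ∀ x ∈ Z, ∀ y ∈ Z, ¬ E (F x) y := fun x hx y hy hxy =>
    hx.2 (ht hxy (hs (hcross x hx.1 y hy.1 hxy)))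
  obtain ⟨hL, r, hr, hrR⟩ := exists_measurable_uniformization
    (R := fun u x => x ∈ Z ∧ E u (F x))
    ((hZm.preimage measurable_snd).inter
      (h.measurableSet_E measurable_fst (hF.comp measurable_snd)))
    fun u => h.countable_preimage (hinj.mono fun x hx => hx.1) u
  set L : Set Cantor := {u | ∃ x, x ∈ Z ∧ E u (F x)}
  have hLinv : ∀ u v, E u v → u ∈ L → v ∈ L := fun u v huv ⟨x, hx, hux⟩ =>
    ⟨x, hx, ht (hs huv) hux⟩
  have hLZ : ∀ x ∈ Z, x ∉ L := fun x hx ⟨y, hy, hxy⟩ => hZ y hy x hx (hs hxy)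
  obtain ⟨-, r', hr', hrR'⟩ := exists_measurable_uniformization
    (R := fun u w => E (r u) w ∧ (D (r u) w ↔ D u (F (r u))))
    (by
      have h₁ := h.measurableSet_E (hr.comp measurable_fst)
        (measurable_snd : Measurable (Prod.snd : Cantor × Cantor → Cantor))
      have h₂ := h.measurableSet_D (hr.comp measurable_fst)
        (measurable_snd : Measurable (Prod.snd : Cantor × Cantor → Cantor))
      have h₃ := h.measurableSet_D
        (measurable_fst : Measurable (Prod.fst : Cantor × Cantor → Cantor))
        (hF.comp (hr.comp measurable_fst))
      simp only [measurableSet_setOfPred] at h₁ h₂ h₃ ⊢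
      exact h₁.and (h₂.iff h₃))
    fun u => (h.countableE (r u)).mono fun w hw => hw.1
  have hr'E : ∀ u, E (r u) (r' u) ∧ (D (r u) (r' u) ↔ D u (F (r u))) := by
    refine fun u => hrR' u ?_
    by_cases hu : D u (F (r u))
    · exact ⟨r u, h.equivE.refl _, by simp [hu, h.equivD.refl]⟩
    · obtain ⟨y, hy, hny, -⟩ := h.double (r u)
      exact ⟨y, hy, by simp [hu, hny]⟩
  let ρ : Cantor → Cantor := fun u => if u ∈ L then r' u else u
  have hρL : ∀ u ∈ L, ρ u = r' u := fun u hu => if_pos hu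
  have hρ : ∀ u ∉ L, ρ u = u := fun u hu => if_neg hu
  have hρE : ∀ u ∈ L, E (r u) (ρ u) := fun u hu => by
    rw [hρL u hu]
    exact (hr'E u).1
  have hρnot : ∀ u, ∀ w, E (ρ u) w → w ∉ L := by
    intro u w huw hw
    by_cases hu : u ∈ L
    · exact hLZ _ (hrR u hu).1 (hLinv _ _ (hs (ht (hρE u hu) huw)) hw)
    · rw [hρ u hu] at huw
      exact hu (hLinv _ _ (hs huw) hw)
  have hext : ∀ u v, E u v → E (ρ u) (ρ v) ∧ (D u v ↔ D (ρ u) (ρ v)) := by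
    intro u v huv
    by_cases hu : u ∈ L
    · have hv := hLinv u v huv hu
      obtain ⟨huZ, huF⟩ := hrR u hu
      obtain ⟨hvZ, hvF⟩ := hrR v hv
      have hFF : E (F (r u)) (F (r v)) := ht (hs huF) (ht huv hvF)
      have hrr := himage _ huZ.1 _ hvZ.1 hFF
      refine ⟨ht (hs (hρE u hu)) (ht hrr (hρE v hv)), ?_⟩
      have e₁ := h.trans_iff (hs (hρE u hu)) (ht hrr (hρE v hv))
      have e₂ := h.trans_iff hrr (hρE v hv)
      have e₃ := h.trans_iff huF (ht hFF (hs hvF))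
      have e₄ := h.trans_iff hFF (hs hvF)
      have e₅ := hsign _ huZ.1 _ hvZ.1 hrr hFF
      have e₆ := (hr'E u).2
      have e₇ := (hr'E v).2
      rw [← hρL u hu] at e₆
      rw [← hρL v hv] at e₇
      rw [e₁, e₂, e₃, e₄, e₅, hDs (ρ u), e₆, e₇, hDs v]
    · have hv : v ∉ L := fun hv => hu (hLinv v u (hs huv) hv)
      rw [hρ u hu, hρ v hv]
      exact ⟨huv, Iff.rfl⟩
  refine ⟨_, _, h.comap (ρ := ρ) (Measurable.ite hL hr' measurable_id) ?_ ?_, ⟨?_, ?_, ?_⟩, ?_⟩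
  · intro u
    refine ((h.countableE u).union ((h.countableE u |>.mono (s₁ := {x | x ∈ Z ∧ E u x})
      fun _ hx => hx.2).biUnion fun x _ => h.countableE (F x))).mono fun v hv => ?_
    by_cases hvL : v ∈ L
    · obtain ⟨hvZ, hvF⟩ := hrR v hvL
      exact Or.inr (mem_biUnion ⟨hvZ, ht hv (hs (hρE v hvL))⟩ (hs hvF))
    · exact Or.inl (hρ v hvL ▸ hv)
  · intro u
    obtain ⟨y, hy, hny, -⟩ := h.double (ρ u)
    refine ⟨y, ?_⟩
    rw [hρ y (hρnot u y hy)]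
    exact ⟨hy, hny⟩
  · exact fun u v huv => (hext u v (h.sub _ _ huv)).2.1 huv
  · exact fun u v huv => (hext u v huv).1
  · exact fun u v huv hn hD => hn ((hext u v huv).2.2 hD)
  · intro x hx
    by_cases hxE : E (F x) x
    · exact (hext _ _ hxE).1
    · have hxZ : x ∈ Z := ⟨hx, hxE⟩
      have hFx : F x ∈ L := ⟨x, hxZ, h.equivE.refl _⟩
      obtain ⟨hrZ, hrF⟩ := hrR _ hFx
      show E (ρ (F x)) (ρ x)
      rw [hρ x (hLZ x hxZ)]
      exact ht (hs (hρE _ hFx)) (hs (himage _ hx _ hrZ.1 hrF))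

/-- There is an `E₀`-array on which two Borel injections `g` and `k` meet `E` only along `E₀`, with
coherent distribution over the `D`-classes. -/
theorem exists_array (h : DBS D E) {g k : Cantor → Cantor} (hg : Measurable g) (hk : Measurable k)
    (hgi : Function.Injective g) (hki : Function.Injective k) :
    ∃ W : E0Array,
      (∀ a b, E (g (xua W a)) (g (xua W b)) ∨ E (k (xua W a)) (k (xua W b)) ∨
        E (k (xua W a)) (g (xua W b)) → eZero a b) ∧
      ∀ a b, eZero a b → E (g (xua W a)) (g (xua W b)) → E (k (xua W a)) (k (xua W b)) →
        (D (g (xua W a)) (g (xua W b)) ↔ D (k (xua W a)) (k (xua W b))) := by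
  have hs := fun {x y : Cantor} => h.equivE.symm (x := x) (y := y)
  have ht := fun {x y z : Cantor} => h.equivE.trans (x := x) (y := y) (z := z)
  have hDs : ∀ x y, D x y ↔ D y x := fun x y => ⟨h.equivD.symm, h.equivD.symm⟩
  let S : Cantor → Cantor → Prop := fun a b =>
    (E (g a) (g b) ∨ E (k a) (k b)) ∨ E (k a) (g b) ∨ E (g a) (k b)
  have hSs : ∀ a b, S a b → S b a := by
    rintro a b ((h' | h') | h' | h')
    exacts [.inl (.inl (hs h')), .inl (.inr (hs h')), .inr (.inr (hs h')), .inr (.inl (hs h'))]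
  have hSm : MeasurableSet {p : Cantor × Cantor | S p.1 p.2} :=
    ((h.measurableSet_E (hg.comp measurable_fst) (hg.comp measurable_snd)).union
      (h.measurableSet_E (hk.comp measurable_fst) (hk.comp measurable_snd))).union
    ((h.measurableSet_E (hk.comp measurable_fst) (hg.comp measurable_snd)).union
      (h.measurableSet_E (hg.comp measurable_fst) (hk.comp measurable_snd)))
  obtain ⟨φ, hφ, hSφ⟩ := exists_seq_measurable_graph hSm fun a =>
    (((h.countableE (g a)).preimage hgi).union ((h.countableE (k a)).preimage hki)).union
      (((h.countableE (k a)).preimage hgi).union ((h.countableE (g a)).preimage hki))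
  let Bad : Cantor → Cantor → Prop := fun a b =>
    E (g a) (g b) ∧ E (k a) (k b) ∧ ¬ (D (g a) (g b) ↔ D (k a) (k b))
  have hBad : MeasurableSet {p : Cantor × Cantor | Bad p.1 p.2} := by
    have h₁ := h.measurableSet_E (hg.comp measurable_fst) (hg.comp measurable_snd)
    have h₂ := h.measurableSet_E (hk.comp measurable_fst) (hk.comp measurable_snd)
    have h₃ := h.measurableSet_D (hg.comp measurable_fst) (hg.comp measurable_snd)
    have h₄ := h.measurableSet_D (hk.comp measurable_fst) (hk.comp measurable_snd)
    simp only [measurableSet_setOfPred] at h₁ h₂ h₃ h₄ ⊢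
    exact h₁.and (h₂.and (h₃.iff h₄).not)
  obtain ⟨W, hW, hWφ⟩ := exists_array_avoiding hBad hφ
    (fun x hx => hx.2.2 (iff_of_true (h.equivD.refl _) (h.equivD.refl _)))
    (fun x y ⟨h₁, h₂, h₃⟩ => ⟨hs h₁, hs h₂, by rwa [hDs (g y), hDs (k y)]⟩)
    (by
      rintro a b c d ⟨h₁, h₂, h₃⟩ ⟨h₄, h₅, h₆⟩ ⟨h₇, h₈, h₉⟩
      refine ⟨ht h₇ (ht (hs h₄) h₁), ht h₈ (ht (hs h₅) h₂), ?_⟩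
      rw [h.trans_iff h₇ (ht (hs h₄) h₁), h.trans_iff (hs h₄) h₁, h.trans_iff h₈ (ht (hs h₅) h₂),
        h.trans_iff (hs h₅) h₂, hDs (g c), hDs (k c)]
      tauto)
  have hfreq : ∀ a b, S (xua W a) (xua W b) → ¬ ∃ᶠ n in atTop, a n = false ∧ b n = true :=
    fun a b hab hf => by
      obtain ⟨n, hn⟩ := hSφ (xua W a, xua W b) hab
      exact hWφ a b hf n hn
  have hzero : ∀ a b, S (xua W a) (xua W b) → eZero a b := by
    intro a b hab
    have h₁ := not_frequently.1 (hfreq a b hab)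
    have h₂ := not_frequently.1 (hfreq b a (hSs _ _ hab))
    obtain ⟨n, hn⟩ := eventually_atTop.1 (h₁.and h₂)
    refine eZero_of_eventually_eq (n := n) fun m hm => ?_
    have := hn m hm
    revert this
    cases a m <;> cases b m <;> simp
  refine ⟨W, fun a b hab => hzero a b ?_, fun a b hab h₁ h₂ => ?_⟩
  · rcases hab with h' | h' | h'
    exacts [.inl (.inl h'), .inl (.inr h'), .inr (.inl h')]
  · by_contra hn
    exact hW a b hab ⟨h₁, h₂, hn⟩

end DBS

/-- Accommodation lemma, `E₀`-large case: given a DBS `⟨D,E⟩` with `E₀ ⊆ E`, a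
canonical `E₀`-large set `X`, and a Borel injection `f : X → 2^ω`, there are a
canonical `E₀`-large `Y ⊆ X` and a DBS `⟨D',E'⟩` extending `⟨D,E⟩` which
accommodates `f↾Y`. -/
theorem accommodate_e0 (D E : Cantor → Cantor → Prop) (hDE : DBS D E)
    (hE0 : ∀ x y, eZero x y → E x y)
    (U : E0Array) (X : Set Cantor) (hX : X = Du U)
    (f : X → Cantor) (hf : Measurable f) (hfi : Function.Injective f) :
    ∃ V : E0Array, Du V ⊆ X ∧
      ∃ D' E', DBS D' E' ∧ DBSle D E D' E' ∧
        ∀ x : X, ↑x ∈ Du V → E' (f x) ↑x := by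
  subst hX
  obtain ⟨F, hF, hFf⟩ := (MeasurableEmbedding.subtype_coe
    U.measurableSet_Du).exists_measurable_extend hf fun _ => inferInstance
  have hFi : InjOn F (Du U) := fun x hx y hy hxy => by
    have hx' := congrFun hFf ⟨x, hx⟩
    have hy' := congrFun hFf ⟨y, hy⟩
    exact congrArg Subtype.val (hfi (hx'.symm.trans (Eq.trans hxy hy')))
  obtain ⟨W, hzero, hsign⟩ := hDE.exists_array U.continuous_xua.measurable
    (hF.comp U.continuous_xua.measurable) U.injective_xua
    (fun a b hab => U.injective_xua (hFi (mem_range_self a) (mem_range_self b) hab))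
  have hsub : Du (U.comp W) ⊆ Du U := by
    rintro _ ⟨a, rfl⟩
    exact ⟨xua W a, (U.xua_comp W a).symm⟩
  have hE : ∀ a b, eZero a b → E (xua U (xua W a)) (xua U (xua W b)) := fun a b hab =>
    hE0 _ _ (U.eZero_xua (W.eZero_xua hab))
  obtain ⟨D', E', hDBS, hle, hacc⟩ := hDE.exists_extension (U.comp W).measurableSet_Du hF
    (hFi.mono hsub)
    (by
      rintro _ ⟨a, rfl⟩ _ ⟨b, rfl⟩ hab
      rw [U.xua_comp, U.xua_comp] at *
      exact hE a b (hzero a b (.inr (.inr hab))))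
    (by
      rintro _ ⟨a, rfl⟩ _ ⟨b, rfl⟩ hab
      rw [U.xua_comp, U.xua_comp] at *
      exact hE a b (hzero a b (.inr (.inl hab))))
    (by
      rintro _ ⟨a, rfl⟩ _ ⟨b, rfl⟩ h₁ h₂
      rw [U.xua_comp, U.xua_comp] at *
      exact hsign a b (hzero a b (.inl h₁)) h₁ h₂)
  refine ⟨U.comp W, hsub, D', E', hDBS, hle, fun x hx => ?_⟩
  rw [← hFf]
  exact hacc x hx
end

section
/- Let ⟨D,E⟩ be a double-bubble system with E₀ ⊆ E, and let R, X ⊆ 2^ω be canonical E₀-large sets. Then there exist: a canonical E₀-large set Y ⊆ X, canonical maps f, g : Y → R (i.e., maps of the form h_{u,v} where Y = D_u and the image D_v is contained in R), and a double-bubble system ⟨D',E'⟩ which extends ⟨D,E⟩, positively accommodates f (f(x) D' x for all x ∈ Y), and negatively accommodates g (g(x) E' x but not g(x) D' x, for all x ∈ Y). -/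
open MeasureTheory

/-! ### The relation `E₀` and finite flips -/

/-- Flip the bits of `x` at the positions in `g`. -/
def bitFlip (g : Finset ℕ) (x : Cantor) : Cantor := fun k => if k ∈ g then !x k else x k

theorem bitFlip_bitFlip (g : Finset ℕ) (x : Cantor) : bitFlip g (bitFlip g x) = x := by
  funext k
  by_cases h : k ∈ g <;> simp [bitFlip, h]

theorem bitFlip_empty (x : Cantor) : bitFlip ∅ x = x := by
  funext k
  simp [bitFlip]

theorem bitFlip_insert {k : ℕ} {g : Finset ℕ} (hk : k ∉ g) (x : Cantor) :
    bitFlip (insert k g) x = bitFlip {k} (bitFlip g x) := by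
  funext m
  by_cases h : m = k
  · subst h
    simp [bitFlip, hk]
  · by_cases h' : m ∈ g <;> simp [bitFlip, h, h']

theorem continuous_bitFlip (g : Finset ℕ) : Continuous (bitFlip g) := by
  refine continuous_pi fun k => ?_
  by_cases h : k ∈ g
  · have : Continuous fun x : Cantor => !x k :=
      (continuous_of_discreteTopology (f := Bool.not)).comp (continuous_apply (A := fun _ => Bool) k)
    simpa [bitFlip, h] using this
  · simpa [bitFlip, h] using continuous_apply k

/-- Flipping a finite set of bits, as a self-homeomorphism of the Cantor space. -/
def bitFlipHomeo (g : Finset ℕ) : Cantor ≃ₜ Cantor where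
  toFun := bitFlip g
  invFun := bitFlip g
  left_inv := bitFlip_bitFlip g
  right_inv := bitFlip_bitFlip g
  continuous_toFun := continuous_bitFlip g
  continuous_invFun := continuous_bitFlip g

theorem eZero_bitFlip (g : Finset ℕ) (x : Cantor) : eZero x (bitFlip g x) := by
  refine g.finite_toSet.subset fun k hk => ?_
  by_contra h
  simp [bitFlip, Finset.mem_coe.not.mp h] at hk

theorem eZero.exists_bitFlip {x y : Cantor} (h : eZero x y) : ∃ g, bitFlip g x = y := by
  refine ⟨Set.Finite.toFinset h, funext fun k => ?_⟩
  have hmem : k ∈ Set.Finite.toFinset h ↔ x k ≠ y k := Set.Finite.mem_toFinset h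
  by_cases hk : x k = y k
  · simp [bitFlip, hmem, hk]
  · simp only [bitFlip, hmem, ne_eq, hk, not_false_eq_true, if_true]
    cases hx : x k <;> cases hy : y k <;> simp_all

theorem eZero.refl (x : Cantor) : eZero x x := by simp [eZero]

theorem eZero.symm {x y : Cantor} (h : eZero x y) : eZero y x := by
  simpa [eZero, eq_comm] using h

theorem eZero.trans {x y z : Cantor} (h : eZero x y) (h' : eZero y z) : eZero x z := by
  refine (h.union h').subset fun k hk => ?_
  by_contra hc
  simp only [Set.mem_union, Set.mem_ofPred_eq, not_or, not_not] at hc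
  exact hk (hc.1.trans hc.2)

theorem countable_setOf_eZero (x : Cantor) : {y | eZero x y}.Countable :=
  (Set.countable_range fun g => bitFlip g x).mono fun _ hy => hy.exists_bitFlip

/-- A relation that is preserved by single flips and is an equivalence contains `E₀`. -/
theorem rel_of_eZero {r : Cantor → Cantor → Prop} (hr : Equivalence r)
    (h : ∀ k x, r x (bitFlip {k} x)) {x y : Cantor} (hxy : eZero x y) : r x y := by
  obtain ⟨g, rfl⟩ := hxy.exists_bitFlip
  clear hxy
  induction g using Finset.induction_on with
  | empty => rw [bitFlip_empty]; exact hr.refl x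
  | insert k g hk ih => rw [bitFlip_insert hk]; exact hr.trans ih (h k _)

/-! ### Canonical maps in terms of blocks of positions -/

/-- Between the positions `L n` and `L (n + 1)`, the point `h a` is determined by `a n`, and
different bits give different blocks. -/
structure IsBlockMap (L : ℕ → ℕ) (h : Cantor → Cantor) : Prop where
  zero : L 0 = 0
  mono : StrictMono L
  congr : ∀ n a b, a n = b n → ∀ m, L n ≤ m → m < L (n + 1) → h a m = h b m
  sep : ∀ n a b, a n ≠ b n → ∃ m, L n ≤ m ∧ m < L (n + 1) ∧ h a m ≠ h b m

theorem exists_block {L : ℕ → ℕ} (h0 : L 0 = 0) (hL : StrictMono L) (m : ℕ) :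
    ∃ n, L n ≤ m ∧ m < L (n + 1) := by
  have hex : ∃ n, m < L n := ⟨m + 1, hL.le_apply⟩
  obtain ⟨n, hn⟩ : ∃ n, Nat.find hex = n + 1 := by
    refine Nat.exists_eq_succ_of_ne_zero fun h => ?_
    have := Nat.find_spec hex
    rw [h, h0] at this
    exact absurd this (Nat.not_lt_zero _)
  refine ⟨n, ?_, hn ▸ Nat.find_spec hex⟩
  exact not_lt.mp (Nat.find_min hex (m := n) (by omega))

theorem block_unique {L : ℕ → ℕ} (hL : StrictMono L) {m n k : ℕ} (h1 : L n ≤ m)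
    (h2 : m < L (n + 1)) (h3 : L k ≤ m) (h4 : m < L (k + 1)) : n = k := by
  have := hL.lt_iff_lt.mp (h1.trans_lt h4)
  have := hL.lt_iff_lt.mp (h3.trans_lt h2)
  omega

namespace IsBlockMap

variable {L K : ℕ → ℕ} {h k : Cantor → Cantor}

theorem continuous (H : IsBlockMap L h) : Continuous h := by
  refine continuous_pi fun m => ?_
  obtain ⟨n, hn, hn'⟩ := exists_block H.zero H.mono m
  have : (fun a => h a m) = (fun b : Bool => h (fun _ => b) m) ∘ fun a : Cantor => a n := by
    funext a
    exact H.congr n a (fun _ => a n) rfl m hn hn'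
  rw [this]
  exact continuous_of_discreteTopology.comp (continuous_apply n)

theorem injective (H : IsBlockMap L h) : Function.Injective h := by
  intro a b hab
  funext n
  by_contra hn
  obtain ⟨m, -, -, hm⟩ := H.sep n a b hn
  exact hm (congrFun hab m)

theorem eZero_map (H : IsBlockMap L h) {a b : Cantor} (hab : eZero a b) :
    eZero (h a) (h b) := by
  refine (hab.biUnion fun n _ => Set.finite_Iio (L (n + 1))).subset fun m hm => ?_
  obtain ⟨n, hn, hn'⟩ := exists_block H.zero H.mono m
  simp only [Set.mem_iUnion]
  exact ⟨n, fun he => hm (H.congr n a b he m hn hn'), hn'⟩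

theorem eZero_of_map (H : IsBlockMap L h) {a b : Cantor} (hab : eZero (h a) (h b)) :
    eZero a b := by
  choose! f hf using fun n (hn : a n ≠ b n) => H.sep n a b hn
  refine Set.Finite.of_finite_image (hab.subset ?_) (f := f) ?_
  · rintro _ ⟨n, hn, rfl⟩
    exact (hf n hn).2.2
  · intro n hn k hk hnk
    have h1 := hf n hn
    have h2 := hf k hk
    rw [← hnk] at h2
    exact block_unique H.mono h1.1 h1.2.1 h2.1 h2.2.1

theorem comp (H : IsBlockMap L h) (J : IsBlockMap K k) :
    IsBlockMap (L ∘ K) (h ∘ k) where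
  zero := by simp [H.zero, J.zero]
  mono := H.mono.comp J.mono
  congr n a b hab m hm hm' := by
    obtain ⟨j, hj, hj'⟩ := exists_block H.zero H.mono m
    have h1 := H.mono.lt_iff_lt.mp (hm.trans_lt hj')
    have h2 := H.mono.lt_iff_lt.mp (hj.trans_lt hm')
    exact H.congr j _ _ (J.congr n a b hab j (by omega) h2) m hj hj'
  sep n a b hab := by
    obtain ⟨j, hj, hj', hne⟩ := J.sep n a b hab
    obtain ⟨m, hm, hm', hne'⟩ := H.sep j _ _ hne
    exact ⟨m, (H.mono.monotone hj).trans hm, hm'.trans_le (H.mono.monotone hj'), hne'⟩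

end IsBlockMap

/-- The position at which the `n`-th block of an array starts. -/
def E0Array.start (U : E0Array) (n : ℕ) : ℕ := ∑ k ∈ Finset.range n, (U.u k false).length

theorem E0Array.length_u (U : E0Array) (n : ℕ) (i : Bool) :
    (U.u n i).length = (U.u n false).length := by
  cases i
  · rfl
  · exact (U.len_eq n).symm

theorem E0Array.length_flatten (U : E0Array) (a : Cantor) (n : ℕ) :
    (((List.range n).map fun k => U.u k (a k)).flatten).length = U.start n := by
  induction n with
  | zero => simp [start]
  | succ n ih =>
    rw [List.range_succ, List.map_append, List.flatten_append, List.length_append, ih]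
    simp [start, Finset.sum_range_succ, U.length_u n (a n)]

theorem E0Array.start_succ (U : E0Array) (n : ℕ) :
    U.start (n + 1) = U.start n + (U.u n false).length := by
  simp [start, Finset.sum_range_succ]

theorem E0Array.strictMono_start (U : E0Array) : StrictMono U.start :=
  strictMono_nat_of_lt_succ fun n => by
    have := U.len_pos n
    rw [U.start_succ]
    omega

theorem xua_apply (U : E0Array) (a : Cantor) {n m : ℕ} (h1 : U.start n ≤ m)
    (h2 : m < U.start (n + 1)) : xua U a m = (U.u n (a n)).getD (m - U.start n) false := by
  have hn : n ≤ m := U.strictMono_start.le_apply.trans h1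
  obtain ⟨d, hd⟩ := Nat.exists_eq_add_of_le (Nat.succ_le_succ hn)
  simp only [Nat.succ_eq_add_one] at hd
  rw [xua, hd, List.range_add, List.map_append, List.flatten_append,
    List.getD_append _ _ _ _ (by rwa [U.length_flatten]), List.range_succ, List.map_append,
    List.flatten_append, List.getD_append_right _ _ _ _ (by rwa [U.length_flatten]),
    U.length_flatten]
  simp

theorem isBlockMap_xua (U : E0Array) : IsBlockMap U.start (xua U) where
  zero := by simp [E0Array.start]
  mono := U.strictMono_start
  congr n a b hab m h1 h2 := by rw [xua_apply U a h1 h2, xua_apply U b h1 h2, hab]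
  sep n a b hab := by
    by_contra! hc
    have hu : U.u n (a n) = U.u n (b n) := by
      refine List.ext_getElem (by rw [U.length_u, U.length_u n (b n)]) fun i h1 h2 => ?_
      have hi : i < (U.u n false).length := by rwa [U.length_u] at h1
      have hs := U.start_succ n
      have := hc (U.start n + i) (by omega) (by omega)
      rw [xua_apply U a (n := n) (by omega) (by omega),
        xua_apply U b (n := n) (by omega) (by omega), Nat.add_sub_cancel_left,
        List.getD_eq_getElem _ _ h1, List.getD_eq_getElem _ _ h2] at this
      exact this
    have := U.ne n
    cases ha : a n <;> cases hb : b n <;> simp_all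

theorem IsBlockMap.exists_xua_eq {L : ℕ → ℕ} {h : Cantor → Cantor} (H : IsBlockMap L h) :
    ∃ U : E0Array, xua U = h := by
  have hlt : ∀ n, L n < L (n + 1) := fun n => H.mono n.lt_succ_self
  let U : E0Array :=
    { u := fun n i => (List.range' (L n) (L (n + 1) - L n)).map (h fun _ => i)
      len_eq := fun n => by simp
      len_pos := fun n => by have := hlt n; simp; omega
      ne := fun n he => by
        obtain ⟨m, h1, h2, h3⟩ := H.sep n (fun _ => false) (fun _ => true) (by simp)
        rw [List.map_inj_left] at he
        exact h3 (he m (by rw [List.mem_range'_1]; omega)) }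
  have hU : ∀ n, U.start n = L n := fun n => by
    induction n with
    | zero => simp [E0Array.start, H.zero]
    | succ n ih => have := hlt n; rw [U.start_succ, ih]; simp [U]; omega
  refine ⟨U, funext fun a => funext fun m => ?_⟩
  obtain ⟨n, hn, hn'⟩ := exists_block H.zero H.mono m
  rw [xua_apply U a (n := n) (by rwa [hU]) (by rwa [hU]), hU,
    List.getD_eq_getElem _ _ (by simp [U]; omega)]
  simp only [U, List.getElem_map, List.getElem_range']
  rw [show L n + 1 * (m - L n) = m by omega]
  exact H.congr n (fun _ => a n) a rfl m hn hn'

/-- Block maps can be built by choosing successive pairs of blocks, subject to a condition `P` on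
the index, the end points and the two blocks. -/
theorem exists_isBlockMap (P : ℕ → ℕ → ℕ → Cantor → Cantor → Prop)
    (hP : ∀ n l, ∃ l' z w, (∃ m, l ≤ m ∧ m < l' ∧ z m ≠ w m) ∧ P n l l' z w) :
    ∃ (L : ℕ → ℕ) (z w : ℕ → Cantor) (h : Cantor → Cantor), IsBlockMap L h ∧
      (∀ n, P n (L n) (L (n + 1)) (z n) (w n)) ∧
      ∀ n a m, L n ≤ m → m < L (n + 1) → h a m = (bif a n then w n else z n) m := by
  choose l' z w hne hP using hP
  let L : ℕ → ℕ := fun n => Nat.rec 0 (fun n l => l' n l) n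
  have hL : StrictMono L := strictMono_nat_of_lt_succ fun n => by
    obtain ⟨m, h1, h2, -⟩ := hne n (L n)
    exact h1.trans_lt h2
  choose blk hblk hblk' using exists_block (L := L) rfl hL
  let h : Cantor → Cantor := fun a m =>
    (bif a (blk m) then w (blk m) (L (blk m)) else z (blk m) (L (blk m))) m
  have hh : ∀ n a m, L n ≤ m → m < L (n + 1) →
      h a m = (bif a n then w n (L n) else z n (L n)) m := fun n a m h1 h2 => by
    rw [block_unique hL h1 h2 (hblk m) (hblk' m)]
  refine ⟨L, fun n => z n (L n), fun n => w n (L n), h, ⟨rfl, hL, ?_, ?_⟩, fun n => hP n (L n), hh⟩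
  · intro n a b hab m h1 h2
    rw [hh n a m h1 h2, hh n b m h1 h2, hab]
  · intro n a b hab
    obtain ⟨m, h1, h2, h3⟩ := hne n (L n)
    refine ⟨m, h1, h2, ?_⟩
    rw [hh n a m h1 h2, hh n b m h1 h2]
    cases ha : a n <;> cases hb : b n
    · simp [ha, hb] at hab
    · simpa using h3
    · simpa using h3.symm
    · simp [ha, hb] at hab

/-- Interleave a point with a fixed sequence `c`. -/
def interleave (c a : Cantor) : Cantor := fun m => if m % 2 = 0 then a (m / 2) else c (m / 2)

theorem isBlockMap_interleave (c : Cantor) : IsBlockMap (fun n => 2 * n) (interleave c) where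
  zero := rfl
  mono := fun a b h => by dsimp only; omega
  congr n a b hab m h1 h2 := by
    have : m / 2 = n := by omega
    simp [interleave, this, hab]
  sep n a b hab := ⟨2 * n, le_rfl, by omega, by simpa [interleave] using hab⟩

theorem eZero_of_interleave {c d a b : Cantor}
    (h : eZero (interleave c a) (interleave d b)) : eZero c d := by
  refine Set.Finite.of_finite_image (f := fun n => 2 * n + 1) (h.subset ?_)
    fun m _ n _ hmn => by simpa using hmn
  rintro _ ⟨n, hn, rfl⟩
  have h1 : (2 * n + 1) % 2 = 1 := by omega
  have h2 : (2 * n + 1) / 2 = n := by omega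
  simpa [interleave, h1, h2] using hn

/-! ### Category -/

open Filter Topology in
theorem eventually_eventually_residual_of_prod {α β : Type*} [TopologicalSpace α]
    [TopologicalSpace β] [SecondCountableTopology β] {G : Set (α × β)}
    (hG : G ∈ residual (α × β)) : ∀ᶠ x in residual α, ∀ᶠ y in residual β, (x, y) ∈ G := by
  obtain ⟨S, hSo, hSd, hSc, hSG⟩ := mem_residual_iff.mp hG
  have key : ∀ O ∈ S, ∀ᶠ x in residual α, ∀ᶠ y in residual β, (x, y) ∈ O := by
    intro O hO
    have hV : ∀ V ∈ TopologicalSpace.countableBasis β,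
        {x : α | ∃ y ∈ V, (x, y) ∈ O} ∈ residual α := by
      intro V hV
      have hVo := TopologicalSpace.isOpen_of_mem_countableBasis hV
      refine residual_of_dense_open ?_ ?_
      · have : {x : α | ∃ y ∈ V, (x, y) ∈ O} = Prod.fst '' (O ∩ Set.univ ×ˢ V) := by
          ext x
          simp [and_comm]
        rw [this]
        exact isOpenMap_fst _ ((hSo O hO).inter (isOpen_univ.prod hVo))
      · refine dense_iff_inter_open.mpr fun A hA hAne => ?_
        obtain ⟨⟨x, y⟩, ⟨hx, hy⟩, hxy⟩ := (hSd O hO).inter_open_nonempty _ (hA.prod hVo)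
          (hAne.prod (TopologicalSpace.nonempty_of_mem_countableBasis hV))
        exact ⟨x, hx, y, hy, hxy⟩
    filter_upwards [(countable_bInter_mem (TopologicalSpace.countable_countableBasis β)).mpr hV]
      with x hx
    refine residual_of_dense_open ((hSo O hO).preimage (Continuous.prodMk_right x)) ?_
    refine (TopologicalSpace.isBasis_countableBasis β).dense_iff.mpr fun V hV _ => ?_
    obtain ⟨y, hyV, hy⟩ := Set.mem_iInter₂.mp hx V hV
    exact ⟨y, hyV, hy⟩
  have h2 : ∀ᶠ x in residual α, ∀ O ∈ S, ∀ᶠ y in residual β, (x, y) ∈ O :=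
    (eventually_countable_ball hSc).mpr key
  filter_upwards [h2] with x hx
  filter_upwards [(eventually_countable_ball hSc).mpr hx] with y hy
  exact hSG fun O hO => hy O hO

theorem exists_ne_agree (x : Cantor) (N : ℕ) : ∃ y : Cantor, y ≠ x ∧ ∀ m < N, y m = x m := by
  refine ⟨bitFlip {N} x, fun h => ?_, fun m hm => ?_⟩
  · simpa [bitFlip] using congrFun h N
  · simp [bitFlip, hm.ne]

open Filter Topology in
theorem eventually_agree_subset {O : Set Cantor} (hO : IsOpen O) {x : Cantor} (hx : x ∈ O) :
    ∀ᶠ N in atTop, ∀ y : Cantor, (∀ m < N, y m = x m) → y ∈ O := by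
  obtain ⟨V, ⟨z, N, rfl⟩, hxV, hVO⟩ :=
    (PiNat.isTopologicalBasis_cylinders fun _ => Bool).exists_subset_of_mem_open hx hO
  filter_upwards [eventually_ge_atTop N] with M hM y hy
  refine hVO (PiNat.mem_cylinder_iff.mpr fun m hm => ?_)
  rw [hy m (hm.trans_le hM), PiNat.mem_cylinder_iff.mp hxV m hm]

theorem compl_countable_mem_residual {S : Set Cantor} (hS : S.Countable) :
    Sᶜ ∈ residual Cantor := by
  have : Sᶜ = ⋂ x ∈ S, {x}ᶜ := by
    ext
    simp only [Set.mem_compl_iff, Set.mem_iInter, Set.mem_singleton_iff]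
    exact ⟨fun h x hx he => h (he ▸ hx), fun h hx => h _ hx rfl⟩
  rw [this]
  refine (countable_bInter_mem hS).mpr fun x _ => ?_
  refine residual_of_dense_open isOpen_compl_singleton (dense_iff_inter_open.mpr ?_)
  rintro V hV ⟨y, hy⟩
  obtain ⟨N, hN⟩ := (eventually_agree_subset hV hy).exists
  by_cases hyx : y = x
  · obtain ⟨z, hz, hzy⟩ := exists_ne_agree y N
    exact ⟨z, hN z hzy, fun h => hz (h.trans hyx.symm)⟩
  · exact ⟨y, hy, hyx⟩

open Filter in
/-- A Borel set with countable vertical sections is meager. -/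
theorem compl_mem_residual_of_countable_sections {F : Set (Cantor × Cantor)}
    (hF : MeasurableSet F) (hc : ∀ x, {y | (x, y) ∈ F}.Countable) :
    Fᶜ ∈ residual (Cantor × Cantor) := by
  obtain ⟨O, hO, hFO⟩ := hF.residualEq_isOpen
  have hG : {p | p ∈ F ↔ p ∈ O} ∈ residual (Cantor × Cantor) := by
    filter_upwards [hFO] with p hp using Iff.of_eq hp
  have hOe : O = ∅ := by
    by_contra hne
    obtain ⟨⟨x₀, y₀⟩, hxy⟩ := Set.nonempty_iff_ne_empty.mpr hne
    obtain ⟨A, B, hA, hB, hxA, hyB, hAB⟩ := isOpen_prod_iff.mp hO x₀ y₀ hxy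
    obtain ⟨x, hxA', hx⟩ := (dense_of_mem_residual
      (eventually_eventually_residual_of_prod hG)).inter_open_nonempty A hA ⟨x₀, hxA⟩
    have hx' : {y | (x, y) ∈ {p | p ∈ F ↔ p ∈ O}} ∈ residual Cantor := hx
    obtain ⟨y, hyB', hy, hyF⟩ := (dense_of_mem_residual
      (inter_mem hx' (compl_countable_mem_residual (hc x)))).inter_open_nonempty B hB ⟨y₀, hyB⟩
    exact hyF (Iff.mpr hy (hAB ⟨hxA', hyB'⟩))
  filter_upwards [hG] with p hp
  intro hpF
  have := Iff.mp hp hpF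
  simp [hOe] at this

open Filter in
/-- If every point that agrees with `z` and `w` beyond `l` lies in the open set `O`, then finitely
many coordinates beyond `l` suffice. -/
theorem eventually_agree_from_prod {O : Set (Cantor × Cantor)} (hO : IsOpen O) (l : ℕ)
    {z w : Cantor} (h : ∀ g ∈ (Finset.range l).powerset, ∀ g' ∈ (Finset.range l).powerset,
      (bitFlip g z, bitFlip g' w) ∈ O) :
    ∀ᶠ N in atTop, ∀ x y : Cantor, (∀ m, l ≤ m → m < N → x m = z m) →
      (∀ m, l ≤ m → m < N → y m = w m) → (x, y) ∈ O := by
  have key : ∀ g ∈ (Finset.range l).powerset, ∀ g' ∈ (Finset.range l).powerset,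
      ∀ᶠ N in atTop, ∀ x y : Cantor, (∀ m < N, x m = bitFlip g z m) →
        (∀ m < N, y m = bitFlip g' w m) → (x, y) ∈ O := by
    intro g hg g' hg'
    obtain ⟨A, B, hA, hB, hxA, hyB, hAB⟩ := isOpen_prod_iff.mp hO _ _ (h g hg g' hg')
    filter_upwards [eventually_agree_subset hA hxA, eventually_agree_subset hB hyB]
      with N h1 h2 x y hx hy
    exact hAB ⟨h1 x hx, h2 y hy⟩
  have key' := (Finset.eventually_all _).mpr fun g hg => (Finset.eventually_all _).mpr (key g hg)
  filter_upwards [key'] with N hN x y hx hy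
  have aux : ∀ u v : Cantor, (∀ m, l ≤ m → m < N → u m = v m) →
      ∀ m < N, u m = bitFlip ((Finset.range l).filter fun m => u m ≠ v m) v m := by
    intro u v huv m hm
    by_cases hml : m < l
    · by_cases he : u m = v m
      · simp [bitFlip, he]
      · simp only [bitFlip, Finset.mem_filter, Finset.mem_range, hml, ne_eq, he,
          not_false_eq_true, and_self, if_true]
        cases hu : u m <;> cases hv : v m <;> simp_all
    · simp [bitFlip, hml, huv m (not_lt.mp hml) hm]
  exact hN _ (Finset.mem_powerset.mpr (Finset.filter_subset _ _)) _
    (Finset.mem_powerset.mpr (Finset.filter_subset _ _)) x y (aux x z hx) (aux y w hy)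

open Filter in
theorem eventually_agree_from {O : Set Cantor} (hO : IsOpen O) (l : ℕ)
    {z : Cantor} (h : ∀ g ∈ (Finset.range l).powerset, bitFlip g z ∈ O) :
    ∀ᶠ N in atTop, ∀ x : Cantor, (∀ m, l ≤ m → m < N → x m = z m) → x ∈ O := by
  filter_upwards [eventually_agree_from_prod (hO.prod isOpen_univ) l (z := z) (w := z)
    fun g hg _ _ => ⟨h g hg, trivial⟩] with N hN x hx
  exact (hN x x hx hx).1

open Filter in
theorem exists_seq_isOpen_of_mem_residual {α : Type*} [TopologicalSpace α] {G : Set α}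
    (hG : G ∈ residual α) :
    ∃ O : ℕ → Set α, (∀ i, IsOpen (O i)) ∧ (∀ i, O i ∈ residual α) ∧ ⋂ i, O i ⊆ G := by
  obtain ⟨S, hSo, hSd, hSc, hSG⟩ := mem_residual_iff.mp hG
  obtain ⟨O, hO⟩ := (hSc.insert Set.univ).exists_eq_range (Set.insert_nonempty _ _)
  have h : ∀ i, O i = Set.univ ∨ O i ∈ S := fun i => by
    have : O i ∈ insert Set.univ S := hO ▸ Set.mem_range_self i
    simpa using this
  refine ⟨O, fun i => ?_, fun i => ?_, fun x hx => hSG fun V hV => ?_⟩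
  · rcases h i with h | h
    · exact h ▸ isOpen_univ
    · exact hSo _ h
  · rcases h i with h | h
    · exact h ▸ univ_mem
    · exact residual_of_dense_open (hSo _ h) (hSd _ h)
  · obtain ⟨i, rfl⟩ : V ∈ Set.range O := hO ▸ Set.mem_insert_of_mem _ hV
    exact Set.mem_iInter.mp hx i

/-! ### Fusion -/

open Filter in
/-- A meager set containing `E₀` meets the square of some canonical set only in `E₀`. -/
theorem exists_isBlockMap_avoid {F : Set (Cantor × Cantor)}
    (hF : Fᶜ ∈ residual (Cantor × Cantor)) (hF0 : ∀ x y, eZero x y → (x, y) ∈ F) :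
    ∃ L h, IsBlockMap L h ∧ ∀ a b, (h a, h b) ∈ F → eZero a b := by
  obtain ⟨O, hOo, hOr, hOF⟩ := exists_seq_isOpen_of_mem_residual hF
  have hgen : ∀ᶠ p in residual (Cantor × Cantor), ∀ g g' i,
      (bitFlip g p.1, bitFlip g' p.2) ∈ O i ∧ (bitFlip g' p.2, bitFlip g p.1) ∈ O i := by
    refine eventually_countable_forall.mpr fun g => eventually_countable_forall.mpr fun g' =>
      eventually_countable_forall.mpr fun i => ?_
    let e : Cantor × Cantor ≃ₜ Cantor × Cantor := (bitFlipHomeo g).prodCongr (bitFlipHomeo g')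
    let e' := e.trans (Homeomorph.prodComm _ _)
    filter_upwards [tendsto_residual_of_isOpenMap e.continuous e.isOpenMap (hOr i),
      tendsto_residual_of_isOpenMap e'.continuous e'.isOpenMap (hOr i)] with p h1 h2
    exact ⟨h1, h2⟩
  obtain ⟨⟨z, w⟩, hzw⟩ := (dense_of_mem_residual hgen).nonempty
  have hzw : ∀ g g' i, (bitFlip g z, bitFlip g' w) ∈ O i ∧ (bitFlip g' w, bitFlip g z) ∈ O i := hzw
  have hinf : ¬ eZero z w := fun h => by
    refine hOF (Set.mem_iInter.mpr fun i => (hzw ∅ ∅ i).1) (hF0 _ _ ?_)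
    simpa only [bitFlip_empty] using h
  obtain ⟨L, z', w', h, H, hP, hh⟩ := exists_isBlockMap
    (fun n l l' z' w' => ∀ x y : Cantor, (∀ m, l ≤ m → m < l' → x m = z' m) →
      (∀ m, l ≤ m → m < l' → y m = w' m) → ∀ i ≤ n, (x, y) ∈ O i ∧ (y, x) ∈ O i) <| by
    intro n l
    obtain ⟨m, hm, hlm⟩ : ∃ m, z m ≠ w m ∧ l ≤ m := by
      by_contra! hc
      exact hinf ((Set.finite_Iio l).subset fun m hm => hc m hm)
    have h1 := (Set.finite_Iic n).eventually_all.mpr fun i _ =>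
      eventually_agree_from_prod (hOo i) l fun g _ g' _ => (hzw g g' i).1
    have h2 := (Set.finite_Iic n).eventually_all.mpr fun i _ =>
      eventually_agree_from_prod (hOo i) l fun g _ g' _ => (hzw g' g i).2
    obtain ⟨l', h1, h2, h3⟩ := (h1.and (h2.and (eventually_gt_atTop m))).exists
    exact ⟨l', z, w, ⟨m, hlm, h3, hm⟩, fun x y hx hy i hi => ⟨h1 i hi x y hx hy, h2 i hi y x hy hx⟩⟩
  refine ⟨L, h, H, fun a b hab => ?_⟩
  by_contra hne
  refine hOF (Set.mem_iInter.mpr fun i => ?_) hab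
  obtain ⟨n, hn, hin⟩ : ∃ n, a n ≠ b n ∧ i ≤ n := by
    by_contra! hc
    exact hne ((Set.finite_Iio i).subset fun m hm => hc m hm)
  have ha := hh n a
  have hb := hh n b
  cases hai : a n <;> cases hbi : b n <;> rw [hai] at ha <;> rw [hbi] at hb
  · exact absurd (hai.trans hbi.symm) hn
  · exact (hP n _ _ ha hb i hin).1
  · exact (hP n _ _ hb ha i hin).2
  · exact absurd (hai.trans hbi.symm) hn

open Filter in
/-- If each class of `E ⊇ E₀` splits into at most two classes of the Borel relation `D`, then `D`
contains `E₀` on some canonical set. -/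
theorem exists_isBlockMap_rel {D : Cantor → Cantor → Prop} (hD : Equivalence D)
    (hDm : MeasurableSet {p : Cantor × Cantor | D p.1 p.2})
    (h2 : ∀ x y z, eZero x y → eZero x z → ¬ D x y → ¬ D x z → D y z) :
    ∃ L h, IsBlockMap L h ∧ ∀ a b, eZero a b → D (h a) (h b) := by
  have hS : ∀ g : Finset ℕ, ∃ V : Set Cantor, IsOpen V ∧
      ∀ᶠ z in residual Cantor, (D z (bitFlip g z) ↔ z ∈ V) := fun g => by
    have hm : MeasurableSet {z : Cantor | D z (bitFlip g z)} :=
      hDm.preimage (measurable_id.prodMk (continuous_bitFlip g).measurable)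
    obtain ⟨V, hV, hSV⟩ := hm.residualEq_isOpen
    refine ⟨V, hV, ?_⟩
    filter_upwards [hSV] with z hz using Iff.of_eq hz
  choose V hVo hV using hS
  obtain ⟨O, hOo, hOr, hO⟩ := exists_seq_isOpen_of_mem_residual (eventually_countable_forall.mpr hV)
  have hO' : ∀ z, (∀ i, z ∈ O i) → ∀ g, D z (bitFlip g z) ↔ z ∈ V g := fun z hz =>
    hO (Set.mem_iInter.mpr hz)
  have hgen : ∀ᶠ z in residual Cantor, ∀ g g' i, bitFlip g (bitFlip g' z) ∈ O i := by
    refine eventually_countable_forall.mpr fun g => eventually_countable_forall.mpr fun g' =>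
      eventually_countable_forall.mpr fun i => ?_
    let e := (bitFlipHomeo g').trans (bitFlipHomeo g)
    exact tendsto_residual_of_isOpenMap e.continuous e.isOpenMap (hOr i)
  obtain ⟨z, hz⟩ := (dense_of_mem_residual hgen).nonempty
  have hz : ∀ g g' i, bitFlip g (bitFlip g' z) ∈ O i := hz
  obtain ⟨L, z', w', h, H, hP, hh⟩ := exists_isBlockMap
    (fun n l l' z' w' =>
      (∀ x : Cantor, (∀ m, l ≤ m → m < l' → x m = z' m) → ∀ i ≤ n, x ∈ O i) ∧
      (∀ x : Cantor, (∀ m, l ≤ m → m < l' → x m = w' m) → ∀ i ≤ n, x ∈ O i) ∧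
      ∀ x y : Cantor, (∀ i, x ∈ O i) → (∀ m, l ≤ m → m < l' → x m = z' m) →
        (∀ m, l ≤ m → m < l' → y m = w' m) → (∀ m, ¬ (l ≤ m ∧ m < l') → x m = y m) →
        D x y) <| by
    intro n l
    obtain ⟨k, k', hkk, hcol⟩ := Finite.exists_ne_map_eq_of_infinite
      fun (k : ℕ) (g : (Finset.range l).powerset) =>
        D (bitFlip g z) (bitFlip g (bitFlip {l + k} z))
    have hD' : ∀ g ∈ (Finset.range l).powerset,
        D (bitFlip g (bitFlip {l + k} z)) (bitFlip g (bitFlip {l + k'} z)) := by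
      intro g hg
      have hg' := Iff.of_eq (congrFun hcol ⟨g, hg⟩)
      have he : ∀ j, eZero (bitFlip g z) (bitFlip g (bitFlip {l + j} z)) := fun j =>
        (eZero_bitFlip g z).symm.trans ((eZero_bitFlip {l + j} z).trans (eZero_bitFlip g _))
      by_cases hc : D (bitFlip g z) (bitFlip g (bitFlip {l + k} z))
      · exact hD.trans (hD.symm hc) (hg'.mp hc)
      · exact h2 _ _ _ (he k) (he k') hc (mt hg'.mpr hc)
    let q : Finset ℕ := {l + k, l + k'}
    have hq : ∀ g ∈ (Finset.range l).powerset,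
        bitFlip q (bitFlip g (bitFlip {l + k} z)) = bitFlip g (bitFlip {l + k'} z) := by
      intro g hg
      funext m
      by_cases h1 : m ∈ g
      · have := Finset.mem_range.mp (Finset.mem_powerset.mp hg h1)
        have h3 : m ≠ l + k := by omega
        have h4 : m ≠ l + k' := by omega
        simp [bitFlip, q, h1, h3, h4]
      · by_cases h3 : m = l + k
        · subst h3
          simp [bitFlip, q, h1, hkk]
        · by_cases h4 : m = l + k'
          · subst h4
            simp [bitFlip, q, h1, hkk.symm]
          · simp [bitFlip, q, h1, h3, h4]
    have hV' : ∀ g ∈ (Finset.range l).powerset, bitFlip g (bitFlip {l + k} z) ∈ V q := by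
      intro g hg
      rw [← hO' _ (hz g {l + k}), hq g hg]
      exact hD' g hg
    have e1 := (Set.finite_Iic n).eventually_all.mpr fun i _ =>
      eventually_agree_from (hOo i) l fun g _ => hz g {l + k} i
    have e2 := (Set.finite_Iic n).eventually_all.mpr fun i _ =>
      eventually_agree_from (hOo i) l fun g _ => hz g {l + k'} i
    obtain ⟨l', h1, h2, h3, h4, h5⟩ := (e1.and (e2.and ((eventually_agree_from (hVo q) l hV').and
      ((eventually_gt_atTop (l + k)).and (eventually_gt_atTop (l + k')))))).exists
    refine ⟨l', bitFlip {l + k} z, bitFlip {l + k'} z, ⟨l + k, by omega, h4, ?_⟩,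
      fun x hx i hi => h1 i hi x hx, fun x hx i hi => h2 i hi x hx, ?_⟩
    · simp [bitFlip, hkk]
    · intro x y hxO hx hy hxy
      have : y = bitFlip q x := by
        funext m
        by_cases hm : l ≤ m ∧ m < l'
        · have := congrFun (hq ∅ (by simp)) m
          simp only [bitFlip_empty] at this
          rw [hy m hm.1 hm.2, ← this]
          simp only [bitFlip, hx m hm.1 hm.2]
        · have h6 : m ≠ l + k := by omega
          have h7 : m ≠ l + k' := by omega
          simp [bitFlip, q, h6, h7, hxy m hm]
      rw [this, hO' x hxO q]
      exact h3 x hx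
  refine ⟨L, h, H, fun a b hab => ?_⟩
  have hmem : ∀ a i, h a ∈ O i := fun a i => by
    have ha := hh i a
    cases hai : a i <;> rw [hai] at ha
    · exact (hP i).1 _ ha i le_rfl
    · exact (hP i).2.1 _ ha i le_rfl
  have hstep : ∀ n a b, a n = false → b n = true → (∀ k ≠ n, a k = b k) → D (h a) (h b) := by
    intro n a b ha hb hab
    have ha' := hh n a
    have hb' := hh n b
    rw [ha] at ha'
    rw [hb] at hb'
    refine (hP n).2.2 _ _ (hmem a) ha' hb' fun m hm => ?_
    obtain ⟨k, hk, hk'⟩ := exists_block H.zero H.mono m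
    exact H.congr k a b (hab k fun he => hm (he ▸ ⟨hk, hk'⟩)) m hk hk'
  refine rel_of_eZero (r := fun a b => D (h a) (h b))
    ⟨fun _ => hD.refl _, hD.symm, hD.trans⟩ (fun k a => ?_) hab
  have hother : ∀ j ≠ k, a j = bitFlip {k} a j := fun j hj => by simp [bitFlip, hj]
  cases ha : a k
  · exact hstep k _ _ ha (by simp [bitFlip, ha]) hother
  · exact hD.symm (hstep k _ _ (by simp [bitFlip, ha]) ha fun j hj => (hother j hj).symm)

/-! ### Projections with countable sections -/

open TopologicalSpace in
/-- A measurable map with countable fibers has measurable range as soon as the set of points of `U`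
that are alone in their fiber within `U` is measurable for every measurable `U`. -/
theorem measurableSet_range_of_countable_fibers {Y Z : Type*} [MeasurableSpace Y]
    [StandardBorelSpace Y] [TopologicalSpace Z] [PolishSpace Z] [MeasurableSpace Z] [BorelSpace Z]
    {f : Y → Z} (hf : Measurable f) (hc : ∀ y, {y' | f y' = f y}.Countable)
    (hU : ∀ U : Set Y, MeasurableSet U →
      MeasurableSet {y | y ∈ U ∧ ∀ y' ∈ U, f y' = f y → y' = y}) :
    MeasurableSet (Set.range f) := by
  let s := upgradeStandardBorel Y
  obtain ⟨τ, hle, hfc, hτ⟩ := hf.exists_continuous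
  have hbor : @borel Y τ = ‹MeasurableSpace Y› := by
    rw [borel_eq_borel_of_le hτ s.toPolishSpace hle, ← eq_borel_upgradeStandardBorel Y]
  let := τ
  have : BorelSpace Y := ⟨hbor.symm⟩
  let T : Set Y → Set Y := fun U => {y | y ∈ U ∧ ∀ y' ∈ U, f y' = f y → y' = y}
  have hT : Set.range f = ⋃ U ∈ countableBasis Y, f '' T U := by
    refine Set.Subset.antisymm ?_ (Set.iUnion₂_subset fun _ _ => Set.image_subset_range _ _)
    rintro _ ⟨y, rfl⟩
    let K : Set Y := {y' | f y' = f y}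
    have hK : IsClosed K := isClosed_singleton.preimage hfc
    have : PolishSpace K := hK.polishSpace
    have : Countable K := (hc y).to_subtype
    have : Nonempty K := ⟨⟨y, rfl⟩⟩
    obtain ⟨k, hk⟩ := nonempty_interior_of_iUnion_of_closed (f := fun k : K => ({k} : Set K))
      (fun _ => isClosed_singleton) (Set.iUnion_of_singleton K)
    obtain ⟨j, hj⟩ := hk
    obtain ⟨W, hW, hWj⟩ := isOpen_induced_iff.mp (isOpen_interior (s := ({k} : Set K)))
    have hjW : (j : Y) ∈ W := by
      rw [← hWj] at hj
      exact hj
    obtain ⟨U, hUb, hjU, hUW⟩ := (isBasis_countableBasis Y).exists_subset_of_mem_open hjW hW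
    refine Set.mem_iUnion₂.mpr ⟨U, hUb, j, ⟨hjU, fun y' hy' hfy => ?_⟩, j.2⟩
    have hmem : ∀ i : K, (i : Y) ∈ W → i = k := fun i hi => by
      have : i ∈ interior ({k} : Set K) := hWj ▸ hi
      exact Set.mem_singleton_iff.mp (interior_subset this)
    have h1 := hmem ⟨y', hfy.trans j.2⟩ (hUW hy')
    have h2 := hmem j hjW
    exact congrArg Subtype.val (h1.trans h2.symm)
  rw [hT]
  refine MeasurableSet.biUnion (countable_countableBasis Y) fun U hUb => ?_
  refine (hU U (isOpen_of_mem_countableBasis hUb).measurableSet).image_of_measurable_injOn hf ?_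
  intro a ha b hb hab
  exact hb.2 a ha.1 hab

/-- The projection of a Borel set all of whose sections lie in single `E₀`-classes is Borel. -/
theorem measurableSet_exists_of_eZero {Z : Type*} [TopologicalSpace Z] [PolishSpace Z]
    [MeasurableSpace Z] [BorelSpace Z] {Q : Z → Cantor → Prop}
    (hQ : MeasurableSet {p : Z × Cantor | Q p.1 p.2})
    (h : ∀ z a b, Q z a → Q z b → eZero a b) : MeasurableSet {z | ∃ a, Q z a} := by
  let S : Set (Z × Cantor) := {p | Q p.1 p.2}
  have : StandardBorelSpace S := hQ.standardBorel
  have hrange : {z | ∃ a, Q z a} = Set.range fun p : S => (p : Z × Cantor).1 := by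
    ext z
    exact ⟨fun ⟨a, ha⟩ => ⟨⟨(z, a), ha⟩, rfl⟩, fun ⟨p, hp⟩ => ⟨p.1.2, hp ▸ p.2⟩⟩
  rw [hrange]
  refine measurableSet_range_of_countable_fibers (measurable_fst.comp measurable_subtype_coe) ?_ ?_
  · rintro ⟨⟨z, a⟩, hza⟩
    refine Set.MapsTo.countable_of_injOn (f := fun p : S => (p : Z × Cantor).2)
      (t := {b | eZero a b}) ?_ ?_ (countable_setOf_eZero a)
    · rintro ⟨⟨z', b⟩, hb⟩ (rfl : z' = z)
      exact h _ _ _ hza hb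
    · rintro ⟨⟨z', b⟩, hb⟩ (rfl : z' = z) ⟨⟨z'', b'⟩, hb'⟩ (hz : z'' = z') (hbb : b = b')
      subst hz hbb
      rfl
  · intro U hU
    have hU' : MeasurableSet (Subtype.val '' U : Set (Z × Cantor)) :=
      hQ.subtype_image hU
    have hEq : {y : S | y ∈ U ∧ ∀ y' ∈ U, (y' : Z × Cantor).1 = (y : Z × Cantor).1 → y' = y} =
        U ∩ ⋂ g : Finset ℕ, {y : S | ((y : Z × Cantor).1, bitFlip g (y : Z × Cantor).2) ∈
          (Subtype.val '' U : Set (Z × Cantor)) → bitFlip g (y : Z × Cantor).2 = (y : Z × Cantor).2} := by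
      ext ⟨⟨z, a⟩, hza⟩
      simp only [Set.mem_ofPred_eq, Set.mem_inter_iff, Set.mem_iInter, and_congr_right_iff]
      intro _
      constructor
      · rintro hy g ⟨y', hy', he⟩
        have := hy y' hy' (congrArg Prod.fst he)
        subst this
        exact (congrArg Prod.snd he).symm
      · rintro hy ⟨⟨z', b⟩, hb⟩ hbU (rfl : z' = z)
        obtain ⟨g, rfl⟩ := (h _ _ _ hza hb).exists_bitFlip
        have := hy g ⟨_, hbU, rfl⟩
        exact Subtype.ext (Prod.ext rfl this)
    refine hEq ▸ hU.inter (MeasurableSet.iInter fun g => ?_)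
    have hm : Measurable fun y : S => bitFlip g (y : Z × Cantor).2 :=
      (continuous_bitFlip g).measurable.comp (measurable_snd.comp measurable_subtype_coe)
    refine MeasurableSet.imp ?_ ?_
    · exact hU'.preimage ((measurable_fst.comp measurable_subtype_coe).prodMk hm)
    · exact measurableSet_eq_fun hm (measurable_snd.comp measurable_subtype_coe)

/-! ### Gluing classes of a double-bubble system along `E₀`-classes -/

/-- A double-bubble system can be extended by gluing, for each `a`, the classes of the points
`θ i a`, where `σ i` prescribes the side on which `θ i a` is placed. -/
theorem exists_dbs_glue {ι : Type*} [Finite ι] {D E : Cantor → Cantor → Prop} (hDE : DBS D E)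
    (θ : ι → Cantor → Cantor) (hθ : ∀ i, Measurable (θ i)) (σ : ι → Prop)
    (hE : ∀ i j a b, E (θ i a) (θ j b) → i = j ∧ eZero a b)
    (hD : ∀ i a b, eZero a b → D (θ i a) (θ i b)) :
    ∃ D' E', DBS D' E' ∧ DBSle D E D' E' ∧
      ∀ i j a, E' (θ i a) (θ j a) ∧ (D' (θ i a) (θ j a) ↔ (σ i ↔ σ j)) := by
  have : PolishSpace Cantor := {}
  have iff_of_not_iff : ∀ {p q r : Prop}, ¬ (p ↔ q) → ¬ (p ↔ r) → (q ↔ r) := by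
    intro p q r
    tauto
  let S : Cantor → Cantor → Prop := fun x a => ∃ i, E x (θ i a)
  let P : Cantor → Cantor → Prop := fun x a => ∃ i, E x (θ i a) ∧ (D x (θ i a) ↔ σ i)
  have hDsymm : ∀ {x y}, D x y → D y x := fun h => hDE.equivD.symm h
  have hDtrans : ∀ {x y z}, D x y → D y z → D x z := fun h h' => hDE.equivD.trans h h'
  have hEsymm : ∀ {x y}, E x y → E y x := fun h => hDE.equivE.symm h
  have hEtrans : ∀ {x y z}, E x y → E y z → E x z := fun h h' => hDE.equivE.trans h h'
  have two : ∀ {x y z}, E x y → E x z → ¬ D x y → ¬ D x z → D y z := by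
    intro x y z hy hz hny hnz
    obtain ⟨w, -, -, hw⟩ := hDE.double x
    exact hDtrans (hDsymm ((hw y hy).resolve_left hny)) ((hw z hz).resolve_left hnz)
  have hP : ∀ {x a i}, E x (θ i a) → (P x a ↔ (D x (θ i a) ↔ σ i)) := by
    intro x a i hi
    refine ⟨fun ⟨j, hj, h⟩ => ?_, fun h => ⟨i, hi, h⟩⟩
    obtain ⟨rfl, -⟩ := hE j i a a (hEtrans (hEsymm hj) hi)
    exact h
  have hSE : ∀ {x y a}, E x y → S x a → S y a := fun h ⟨i, hi⟩ => ⟨i, hEtrans (hEsymm h) hi⟩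
  have hS0 : ∀ {x a b}, S x a → S x b → eZero a b := fun ⟨i, hi⟩ ⟨j, hj⟩ =>
    (hE i j _ _ (hEtrans (hEsymm hi) hj)).2
  have hSb : ∀ {x a b}, eZero a b → S x a → S x b := fun h ⟨i, hi⟩ =>
    ⟨i, hEtrans hi (hDE.sub _ _ (hD i _ _ h))⟩
  have hPb : ∀ {x a b}, eZero a b → S x a → (P x a ↔ P x b) := by
    rintro x a b h ⟨i, hi⟩
    have hab := hD i _ _ h
    rw [hP hi, hP (hEtrans hi (hDE.sub _ _ hab))]
    exact iff_congr ⟨fun h => hDtrans h hab, fun h => hDtrans h (hDsymm hab)⟩ Iff.rfl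
  have hPD : ∀ {x y a}, E x y → S x a → (D x y ↔ (P x a ↔ P y a)) := by
    rintro x y a hxy ⟨i, hi⟩
    have hyi := hEtrans (hEsymm hxy) hi
    rw [hP hi, hP hyi]
    by_cases h1 : D x (θ i a) <;> by_cases h2 : D y (θ i a)
    · simp [h1, h2, hDtrans h1 (hDsymm h2)]
    · have : ¬ D x y := fun h => h2 (hDtrans (hDsymm h) h1)
      simp only [this, h1, h2]
      tauto
    · have : ¬ D x y := fun h => h1 (hDtrans h h2)
      simp only [this, h1, h2]
      tauto
    · simp [h1, h2, hDsymm (two (hEsymm hyi) (hEsymm hi) (mt hDsymm h2) (mt hDsymm h1))]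
  let E' : Cantor → Cantor → Prop := fun x y => E x y ∨ ∃ a, S x a ∧ S y a
  let D' : Cantor → Cantor → Prop := fun x y => D x y ∨ ∃ a, S x a ∧ S y a ∧ (P x a ↔ P y a)
  have hD'E : ∀ x y, E x y → ¬ D x y → ¬ D' x y := by
    rintro x y hxy hn (h | ⟨a, ha, -, h⟩)
    · exact hn h
    · exact hn ((hPD hxy ha).mpr h)
  have hsub : ∀ x y, D' x y → E' x y := by
    rintro x y (h | ⟨a, hx, hy, -⟩)
    · exact Or.inl (hDE.sub _ _ h)
    · exact Or.inr ⟨a, hx, hy⟩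
  have hcount : ∀ x, {y | E' x y}.Countable := by
    intro x
    by_cases hx : ∃ a, S x a
    · obtain ⟨a, ha⟩ := hx
      refine ((hDE.countableE x).union
        (Set.countable_iUnion fun i => hDE.countableE (θ i a))).mono ?_
      rintro y (h | ⟨b, hxb, hyb⟩)
      · exact Or.inl h
      · obtain ⟨i, hi⟩ := hSb (hS0 hxb ha) hyb
        exact Or.inr (Set.mem_iUnion.mpr ⟨i, hEsymm hi⟩)
    · refine (hDE.countableE x).mono ?_
      rintro y (h | ⟨b, hxb, -⟩)
      · exact h
      · exact absurd ⟨b, hxb⟩ hx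
  have hpre : ∀ {r : Cantor → Cantor → Prop}, MeasurableSet {p : Cantor × Cantor | r p.1 p.2} →
      ∀ i, MeasurableSet {p : Cantor × Cantor | r p.1 (θ i p.2)} := fun h i =>
    h.preimage (measurable_fst.prodMk ((hθ i).comp measurable_snd))
  have hSm : MeasurableSet {p : Cantor × Cantor | S p.1 p.2} := by
    have : {p : Cantor × Cantor | S p.1 p.2} = ⋃ i, {p | E p.1 (θ i p.2)} := by ext; simp [S]
    rw [this]
    exact MeasurableSet.iUnion fun i => hpre hDE.borelE i
  have hPm : MeasurableSet {p : Cantor × Cantor | P p.1 p.2} := by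
    have : {p : Cantor × Cantor | P p.1 p.2} =
        ⋃ i, {p | E p.1 (θ i p.2) ∧ (D p.1 (θ i p.2) ↔ σ i)} := by ext; simp [P]
    rw [this]
    exact MeasurableSet.iUnion fun i =>
      (hpre hDE.borelE i).inter ((hpre hDE.borelD i).iff (MeasurableSet.const _))
  have hl : Measurable fun q : (Cantor × Cantor) × Cantor => (q.1.1, q.2) := by fun_prop
  have hr : Measurable fun q : (Cantor × Cantor) × Cantor => (q.1.2, q.2) := by fun_prop
  refine ⟨D', E', ⟨⟨?_, ?_, ?_⟩, ⟨?_, ?_, ?_⟩, ?_, ?_, ?_, hcount, hsub, ?_⟩,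
    ⟨fun _ _ => Or.inl, fun _ _ => Or.inl, hD'E⟩, ?_⟩
  · exact fun x => Or.inl (hDE.equivD.refl x)
  · rintro x y (h | ⟨a, hx, hy, h⟩)
    · exact Or.inl (hDsymm h)
    · exact Or.inr ⟨a, hy, hx, h.symm⟩
  · rintro x y z (h | ⟨a, hx, hy, h⟩) (h' | ⟨b, hy', hz, h'⟩)
    · exact Or.inl (hDtrans h h')
    · have hxb := hSE (hEsymm (hDE.sub _ _ h)) hy'
      exact Or.inr ⟨b, hxb, hz, ((hPD (hDE.sub _ _ h) hxb).mp h).trans h'⟩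
    · exact Or.inr ⟨a, hx, hSE (hDE.sub _ _ h') hy, h.trans ((hPD (hDE.sub _ _ h') hy).mp h')⟩
    · have hab := hS0 hy hy'
      exact Or.inr ⟨a, hx, hSb hab.symm hz,
        (h.trans (hPb hab hy)).trans (h'.trans (hPb hab.symm hz))⟩
  · exact fun x => Or.inl (hDE.equivE.refl x)
  · rintro x y (h | ⟨a, hx, hy⟩)
    · exact Or.inl (hEsymm h)
    · exact Or.inr ⟨a, hy, hx⟩
  · rintro x y z (h | ⟨a, hx, hy⟩) (h' | ⟨b, hy', hz⟩)
    · exact Or.inl (hEtrans h h')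
    · exact Or.inr ⟨b, hSE (hEsymm h) hy', hz⟩
    · exact Or.inr ⟨a, hx, hSE h' hy⟩
    · exact Or.inr ⟨a, hx, hSb (hS0 hy hy').symm hz⟩
  · refine hDE.borelD.union (measurableSet_exists_of_eZero (Z := Cantor × Cantor)
      (Q := fun p a => S p.1 a ∧ S p.2 a ∧ (P p.1 a ↔ P p.2 a)) ?_ fun _ _ _ h h' => hS0 h.1 h'.1)
    exact (hSm.preimage hl).inter ((hSm.preimage hr).inter
      ((hPm.preimage hl).iff (hPm.preimage hr)))
  · refine hDE.borelE.union (measurableSet_exists_of_eZero (Z := Cantor × Cantor)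
      (Q := fun p a => S p.1 a ∧ S p.2 a) ?_ fun _ _ _ h h' => hS0 h.1 h'.1)
    exact (hSm.preimage hl).inter (hSm.preimage hr)
  · exact fun x => (hcount x).mono fun y hy => hsub x y hy
  · intro x
    obtain ⟨y, hxy, hn, hy⟩ := hDE.double x
    refine ⟨y, Or.inl hxy, hD'E x y hxy hn, ?_⟩
    rintro z (h | ⟨a, hx, hz⟩)
    · exact (hy z h).imp Or.inl Or.inl
    · have hxy' := mt (hPD hxy hx).mpr hn
      by_cases h : P x a ↔ P z a
      · exact Or.inl (Or.inr ⟨a, hx, hz, h⟩)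
      · exact Or.inr (Or.inr ⟨a, hSE hxy hx, hz, iff_of_not_iff hxy' h⟩)
  · intro i j a
    have hSi : ∀ i, S (θ i a) a := fun i => ⟨i, hDE.equivE.refl _⟩
    have hPi : ∀ i, P (θ i a) a ↔ σ i := fun i => by
      rw [hP (hDE.equivE.refl _)]
      simp [hDE.equivD.refl (θ i a)]
    refine ⟨Or.inr ⟨a, hSi i, hSi j⟩, ?_⟩
    rw [← hPi i, ← hPi j]
    refine ⟨?_, fun h => Or.inr ⟨a, hSi i, hSi j, h⟩⟩
    rintro (h | ⟨b, hi, hj, h⟩)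
    · exact (hPD (hDE.sub _ _ h) (hSi i)).mp h
    · have hab := hS0 hi (hSi i)
      exact ((hPb hab hi).symm.trans h).trans (hPb hab hj)

/-- Three points that are pairwise not `E₀`-equivalent. -/
def separatedPoint (i : Fin 3) : Cantor := fun n => if n % 2 = 0 then i = 0 else i = 1

theorem separatedPoint_eq_of_eZero {i j : Fin 3} (h : eZero (separatedPoint i) (separatedPoint j)) :
    i = j := by
  by_contra hij
  have key : ∀ r < 2, ∃ n ∉ {k | separatedPoint i k ≠ separatedPoint j k}, n % 2 = r := by
    intro r hr
    by_contra! hc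
    refine (Set.infinite_of_injective_forall_mem (f := fun n => 2 * n + r) ?_ fun n => ?_) h
    · intro m n hmn
      simpa using hmn
    · by_contra hn
      exact hc _ hn (by omega)
  obtain ⟨m, hm, hm'⟩ := key 0 (by omega)
  obtain ⟨n, hn, hn'⟩ := key 1 (by omega)
  simp only [separatedPoint, Set.mem_ofPred_eq, not_not, hm', hn'] at hm hn
  have separates : ∀ i j : Fin 3, decide (i = 0) = decide (j = 0) →
      decide (i = 1) = decide (j = 1) → i = j := by decide
  exact hij (separates i j (by simpa using hm) (by simpa using hn))

/-- Accommodation lemma, `E₀`-large case, two canonical maps: given a DBS `⟨D,E⟩` with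
`E₀ ⊆ E` and canonical `E₀`-large sets `R, X`, there are a canonical `E₀`-large set
`Y = D_u ⊆ X`, canonical maps `f = h_{u,v}, g = h_{u,w} : Y → R` (with `D_v, D_w ⊆ R`),
and a DBS `⟨D',E'⟩` extending `⟨D,E⟩` which positively accommodates `f` and negatively
accommodates `g`. -/
theorem accommodate_e0_two (D E : Cantor → Cantor → Prop) (hDE : DBS D E)
    (hE0 : ∀ x y, eZero x y → E x y)
    (UR UX : E0Array) (R X : Set Cantor) (hR : R = Du UR) (hX : X = Du UX) :
    ∃ U V W : E0Array, Du U ⊆ X ∧ Du V ⊆ R ∧ Du W ⊆ R ∧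
      ∃ D' E', DBS D' E' ∧ DBSle D E D' E' ∧
        (∀ a : Cantor, D' (xua V a) (xua U a)) ∧
        (∀ a : Cantor, E' (xua W a) (xua U a) ∧ ¬ D' (xua W a) (xua U a)) := by
  subst hR hX
  let φ : Fin 3 → Cantor → Cantor := fun i => if i = 0 then xua UX else xua UR
  have hφ : ∀ i, ∃ L, IsBlockMap L (φ i) := fun i => by
    by_cases hi : i = 0
    · exact ⟨_, by simpa [φ, hi] using isBlockMap_xua UX⟩
    · exact ⟨_, by simpa [φ, hi] using isBlockMap_xua UR⟩
  choose Lφ hφ using hφ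
  have hm : ∀ i j, Measurable fun p : Cantor × Cantor => (φ i p.1, φ j p.2) := fun i j =>
    ((hφ i).continuous.measurable.comp measurable_fst).prodMk
      ((hφ j).continuous.measurable.comp measurable_snd)
  obtain ⟨LT, T, HT, hT⟩ := exists_isBlockMap_avoid
    (F := ⋃ i, ⋃ j, {p : Cantor × Cantor | E (φ i p.1) (φ j p.2)})
    (compl_mem_residual_of_countable_sections
      (MeasurableSet.iUnion fun i => MeasurableSet.iUnion fun j => hDE.borelE.preimage (hm i j))
      fun x => by
        have : {y | (x, y) ∈ ⋃ i, ⋃ j, {p : Cantor × Cantor | E (φ i p.1) (φ j p.2)}} =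
            ⋃ i, ⋃ j, φ j ⁻¹' {y | E (φ i x) y} := by ext; simp
        rw [this]
        exact Set.countable_iUnion fun i => Set.countable_iUnion fun j =>
          (hDE.countableE _).preimage (hφ j).injective)
    fun x y hxy => Set.mem_iUnion₂.mpr ⟨0, 0, hE0 _ _ ((hφ 0).eZero_map hxy)⟩
  let ψ : Fin 3 → Cantor → Cantor := fun i => T ∘ interleave (separatedPoint i)
  have Hψ : ∀ i, IsBlockMap _ (ψ i) := fun i => HT.comp (isBlockMap_interleave _)
  have hB : ∀ i, ∃ L h, IsBlockMap L h ∧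
      ∀ a b, eZero a b → D (φ i (ψ i (h a))) (φ i (ψ i (h b))) := fun i => by
    have H := (hφ i).comp (Hψ i)
    refine exists_isBlockMap_rel (D := fun x y => D (φ i (ψ i x)) (φ i (ψ i y)))
      ⟨fun _ => hDE.equivD.refl _, hDE.equivD.symm, hDE.equivD.trans⟩
      (hDE.borelD.preimage ((H.continuous.measurable.comp measurable_fst).prodMk
        (H.continuous.measurable.comp measurable_snd))) fun x y z hy hz hny hnz => ?_
    obtain ⟨w, -, -, hw⟩ := hDE.double (φ i (ψ i x))
    exact hDE.equivD.trans
      (hDE.equivD.symm ((hw _ (hE0 _ _ (H.eZero_map hy))).resolve_left hny))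
      ((hw _ (hE0 _ _ (H.eZero_map hz))).resolve_left hnz)
  choose LB B HB hB using hB
  have HU : ∀ i, IsBlockMap _ (φ i ∘ ψ i ∘ B i) := fun i => (hφ i).comp ((Hψ i).comp (HB i))
  choose U hU using fun i => (HU i).exists_xua_eq
  have hsub : ∀ i, Du (U i) ⊆ Set.range (φ i) := by
    rintro i _ ⟨a, rfl⟩
    exact ⟨ψ i (B i a), by rw [hU]; rfl⟩
  obtain ⟨D', E', hD', hle, hglue⟩ := exists_dbs_glue hDE (fun i => xua (U i))
    (fun i => (isBlockMap_xua _).continuous.measurable) (fun i => i ≠ 2)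
    (fun i j a b hab => by
      rw [hU, hU] at hab
      have h0 := hT _ _ (Set.mem_iUnion₂.mpr ⟨i, j, hab⟩)
      obtain rfl := separatedPoint_eq_of_eZero (eZero_of_interleave h0)
      exact ⟨rfl, (HB i).eZero_of_map ((isBlockMap_interleave _).eZero_of_map h0)⟩)
    (fun i a b hab => by simp only [hU]; exact hB i a b hab)
  refine ⟨U 0, U 1, U 2, hsub 0, hsub 1, hsub 2, D', E', hD', hle, fun a => ?_, fun a => ?_⟩
  · exact (hglue 1 0 a).2.mpr (by simp)
  · exact ⟨(hglue 2 0 a).1, fun h => by simpa using (hglue 2 0 a).2.mp h⟩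
end

section
/- Assume the Continuum Hypothesis. Then there is an ⊑-increasing transfinite sequence ⟨D_α, E_α⟩, α < ω₁, of double-bubble systems on 2^ω, beginning with E_0 = E₀ and D_0 = Eₑ, such that: (1) if X ⊆ 2^ω is perfect and f : X → 2^ω is Borel and injective, then there exist a perfect set X' ⊆ X and an ordinal α < ω₁ such that ⟨D_α, E_α⟩ accommodates f↾X' (i.e., f(x) E_α x for all x ∈ X'); and (2) if X, R ⊆ 2^ω are perfect sets, then there exist a perfect set Y ⊆ X, an ordinal α < ω₁, and Borel injective maps f, g : Y → R such that ⟨D_α, E_α⟩ positively accommodates f (f(x) D_α x for all x ∈ Y) and negatively accommodates g (g(x) E_α x but not g(x) D_α x, for all x ∈ Y). -/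
open MeasureTheory

namespace DoubleBubble

open Set Topology

/-! ### Topology of the Cantor space -/

instance : PolishSpace Cantor := by
  have : TopologicalSpace.IsCompletelyMetrizableSpace Cantor := inferInstance
  constructor

instance neBot_nhdsNE (x : Cantor) : (𝓝[≠] x).NeBot := by
  have h : Filter.Tendsto (fun n => Function.update x n (!x n)) Filter.atTop (𝓝[≠] x) := by
    refine tendsto_nhdsWithin_iff.2 ⟨tendsto_pi_nhds.2 fun k => ?_, ?_⟩
    · refine tendsto_const_nhds.congr' ?_
      filter_upwards [Filter.eventually_gt_atTop k] with n hn
      rw [Function.update_of_ne hn.ne]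
    · refine Filter.Eventually.of_forall fun n h => ?_
      have := congrFun (h : _ = x) n
      simp at this
  exact h.neBot

theorem dense_compl_of_countable {S : Set Cantor} (hS : S.Countable) : Dense Sᶜ := by
  have := hS.to_subtype
  have h := dense_iInter_of_isOpen (f := fun s : S => ({(s : Cantor)}ᶜ : Set Cantor))
    (fun _ => isOpen_compl_singleton) (fun s => dense_compl_singleton _)
  refine h.mono fun x hx hxS => ?_
  exact (mem_iInter.1 hx ⟨x, hxS⟩) rfl

theorem not_countable_univ : ¬ (univ : Set Cantor).Countable := fun h => by
  simpa using (dense_compl_of_countable h).nonempty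

theorem perfectSet_range {h : Cantor → Cantor} (hc : Continuous h) (hi : Function.Injective h) :
    PerfectSet (range h) := by
  refine ⟨⟨(isCompact_range hc).isClosed, ?_⟩, range_nonempty h⟩
  rintro _ ⟨a, rfl⟩
  rw [accPt_iff_nhds]
  intro U hU
  have h1 : h ⁻¹' U ∈ 𝓝[≠] a := nhdsWithin_le_nhds (hc.continuousAt.preimage_mem_nhds hU)
  obtain ⟨b, hbU, hb⟩ := Filter.nonempty_of_mem (Filter.inter_mem h1 self_mem_nhdsWithin)
  exact ⟨h b, ⟨hbU, mem_range_self b⟩, fun e => hb (hi e)⟩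

theorem PerfectSet.exists_injection {X : Set Cantor} (hX : PerfectSet X) :
    ∃ p : Cantor → Cantor, Continuous p ∧ Function.Injective p ∧ ∀ a, p a ∈ X := by
  let := TopologicalSpace.upgradeIsCompletelyMetrizable Cantor
  obtain ⟨p, hp, hc, hi⟩ := hX.1.exists_nat_bool_injection hX.2
  exact ⟨p, hc, hi, fun a => hp (mem_range_self a)⟩

theorem exists_continuous_comp_of_continuous {X : Type*} [TopologicalSpace X] [PolishSpace X]
    {ι Y : Type*} [TopologicalSpace Y] {F : X → (ι → Y) × Bool} (hF : Continuous F)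
    (hu : ¬ {x | (F x).2 = true}.Countable) :
    ∃ j : Cantor → X, (∀ a, (F (j a)).2 = true) ∧ Function.Injective j ∧ Continuous j ∧
      ∀ i, Continuous ((fun x => (F x).1 i) ∘ j) := by
  have hcl : IsClosed {x | (F x).2 = true} :=
    (isClosed_discrete {true}).preimage (continuous_snd.comp hF)
  obtain ⟨j, hjS, hjc, hji⟩ := hcl.exists_nat_bool_injection_of_not_countable hu
  refine ⟨j, fun a => hjS (mem_range_self a), hji, hjc, fun i => ?_⟩
  exact (continuous_apply i).comp (continuous_fst.comp (hF.comp hjc))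

/-- An uncountable Borel set contains a copy of the Cantor space on which countably many given
Borel functions are continuous. -/
theorem exists_continuous_comp {S : Set Cantor} (hS : MeasurableSet S) (hu : ¬ S.Countable)
    {ι : Type*} [Countable ι] {f : ι → Cantor → Cantor} (hf : ∀ i, Measurable (f i)) :
    ∃ j : Cantor → Cantor, Continuous j ∧ Function.Injective j ∧ (∀ a, j a ∈ S) ∧
      ∀ i, Continuous (f i ∘ j) := by
  classical
  let F : Cantor → (ι → Cantor) × Bool := fun x => (fun i => f i x, decide (x ∈ S))
  have hF : Measurable F := by
    refine (measurable_pi_lambda _ hf).prodMk ?_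
    refine measurable_to_bool ?_
    convert hS using 1
    ext x; simp
  obtain ⟨t, ht, hFc, hP⟩ := hF.exists_continuous
  obtain ⟨j, hjS, hji, hjc, hj⟩ := @exists_continuous_comp_of_continuous _ t hP ι Cantor
    Pi.topologicalSpace F hFc
    ((mt fun h => h.mono fun x hx => by simpa [F] using hx) hu)
  exact ⟨j, continuous_le_rng ht hjc, hji, fun a => by simpa [F] using hjS a, hj⟩

/-- Finitely many points can be picked from given nonempty open sets so that they are pairwise
unrelated, for a relation with countable sections. -/
theorem exists_pairwise_unrelated {F : Type*} {W : F → Set Cantor}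
    (hW : ∀ s, IsOpen (W s)) (hne : ∀ s, (W s).Nonempty) {G : Set (Cantor × Cantor)}
    (h1 : ∀ a, {b | (a, b) ∈ G}.Countable) (h2 : ∀ b, {a | (a, b) ∈ G}.Countable)
    (T : Finset F) :
    ∃ y : F → Cantor, (∀ s ∈ T, y s ∈ W s) ∧
      ∀ s ∈ T, ∀ t ∈ T, s ≠ t → (y s, y t) ∉ G := by
  classical
  induction T using Finset.induction_on with
  | empty => exact ⟨fun _ _ => false, by simp, by simp⟩
  | insert s T hs ih =>
    obtain ⟨y, hy, hyG⟩ := ih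
    have hc : (⋃ t ∈ T, ({b | (y t, b) ∈ G} ∪ {a | (a, y t) ∈ G})).Countable :=
      T.countable_toSet.biUnion fun t _ => (h1 _).union (h2 _)
    obtain ⟨z, hz, hzc⟩ := (dense_compl_of_countable hc).inter_open_nonempty _ (hW s) (hne s)
    simp only [mem_compl_iff, mem_iUnion, mem_union, mem_ofPred_eq, not_exists, not_or] at hzc
    have hT : ∀ t ∈ T, Function.update y s z t = y t := fun t ht =>
      Function.update_of_ne (by rintro rfl; exact hs ht) _ _
    refine ⟨Function.update y s z, fun t ht => ?_, fun t ht t' ht' hne => ?_⟩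
    · rcases Finset.mem_insert.1 ht with rfl | ht
      · simpa using hz
      · rw [hT t ht]; exact hy t ht
    · rcases Finset.mem_insert.1 ht with rfl | ht <;>
        rcases Finset.mem_insert.1 ht' with h' | ht'
      · exact absurd h'.symm hne
      · rw [hT t' ht', Function.update_self]; exact (hzc t' ht').2
      · rw [h', hT t ht, Function.update_self]; exact (hzc t ht).1
      · rw [hT t ht, hT t' ht']; exact hyG t ht t' ht' hne

theorem baireSpace_continuousMap {X Y : Type*} [TopologicalSpace X] [CompactSpace X]
    [TopologicalSpace Y] [TopologicalSpace.IsCompletelyMetrizableSpace Y] :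
    BaireSpace C(X, Y) := by
  let := TopologicalSpace.upgradeIsCompletelyMetrizable Y
  let h : MetricSpace C(X, Y) := inferInstance
  have : TopologicalSpace.IsCompletelyMetrizableSpace C(X, Y) := ⟨h, rfl, inferInstance⟩
  infer_instance

theorem exists_dist_lt_of_agree {Y : Type*} [PseudoMetricSpace Y] {q : Cantor → Y}
    (hq : Continuous q) {ε : ℝ} (hε : 0 < ε) (k : ℕ) :
    ∃ m, k < m ∧ ∀ a b, (∀ i < m, a i = b i) → dist (q a) (q b) < ε := by
  let : MetricSpace Cantor := PiNat.metricSpace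
  have : @UniformContinuous _ _ PseudoMetricSpace.toUniformSpace _ q :=
    @CompactSpace.uniformContinuous_of_continuous _ _ PseudoMetricSpace.toUniformSpace _ _ _ hq
  obtain ⟨δ, hδ, h⟩ := Metric.uniformContinuous_iff.1 this ε hε
  obtain ⟨m, hm⟩ := exists_pow_lt_of_lt_one hδ (by norm_num : (1 / 2 : ℝ) < 1)
  refine ⟨max m (k + 1), by simp, fun a b hab => h (lt_of_le_of_lt ?_ hm)⟩
  exact PiNat.mem_cylinder_iff_dist_le.1
    (PiNat.mem_cylinder_iff.2 fun i hi => hab i (by simp [hi]))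

theorem isOpen_setOf_unrelated {G : Set (Cantor × Cantor)} (hG : IsClosed G) (k : ℕ) :
    IsOpen {q : C(Cantor, Cantor) | ∀ a b, a k ≠ b k → (q a, q b) ∉ G} := by
  have hK : IsCompact {c : Cantor × Cantor | c.1 k ≠ c.2 k} := by
    refine IsClosed.isCompact ?_
    have : Continuous fun c : Cantor × Cantor => (c.1 k, c.2 k) := by fun_prop
    exact (isClosed_discrete {c : Bool × Bool | c.1 ≠ c.2}).preimage this
  have hcont : Continuous fun q : C(Cantor, Cantor) => q.prodMap q :=
    ContinuousMap.continuous_of_continuous_uncurry _ (by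
      simp only [Function.uncurry_def, ContinuousMap.prodMap_apply, Prod.map]
      fun_prop)
  convert (ContinuousMap.isOpen_setOfPred_mapsTo hK hG.isOpen_compl).preimage hcont using 1
  ext q
  simp only [mem_ofPred_eq, mem_preimage, MapsTo, Prod.forall]
  rfl

theorem dense_setOf_unrelated {G : Set (Cantor × Cantor)}
    (h1 : ∀ a, {b | (a, b) ∈ G}.Countable) (h2 : ∀ b, {a | (a, b) ∈ G}.Countable) (k : ℕ) :
    Dense {q : C(Cantor, Cantor) | ∀ a b, a k ≠ b k → (q a, q b) ∉ G} := by
  let := TopologicalSpace.upgradeIsCompletelyMetrizable Cantor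
  refine Metric.dense_iff.2 fun q₀ ε hε => ?_
  obtain ⟨m, hkm, hm⟩ := exists_dist_lt_of_agree q₀.continuous (half_pos hε) k
  let ext : (Fin m → Bool) → Cantor := fun s i => if h : i < m then s ⟨i, h⟩ else false
  let res : Cantor → (Fin m → Bool) := fun a i => a i
  obtain ⟨y, hyW, hyG⟩ := exists_pairwise_unrelated
    (W := fun s : Fin m → Bool => Metric.ball (q₀ (ext s)) (ε / 2))
    (fun _ => Metric.isOpen_ball) (fun _ => ⟨_, Metric.mem_ball_self (half_pos hε)⟩) h1 h2
    Finset.univ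
  have hres : Continuous res := by fun_prop
  refine ⟨⟨y ∘ res, continuous_of_discreteTopology.comp hres⟩, ?_, fun a b hab => ?_⟩
  · rw [Metric.mem_ball, ContinuousMap.dist_lt_iff hε]
    intro a
    have e1 : dist (y (res a)) (q₀ (ext (res a))) < ε / 2 := hyW _ (Finset.mem_univ _)
    have e2 : dist (q₀ (ext (res a))) (q₀ a) < ε / 2 := hm _ _ fun i hi => by simp [ext, res, hi]
    calc dist (y (res a)) (q₀ a) ≤ _ := dist_triangle _ (q₀ (ext (res a))) _
      _ < ε := by linarith
  · exact hyG _ (Finset.mem_univ _) _ (Finset.mem_univ _) fun e => hab (congrFun e ⟨k, hkm⟩)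

/-- A Mycielski-type theorem: countably many closed relations with countable sections admit a
Cantor set of pairwise unrelated points. -/
theorem exists_unrelated {ι : Type*} [Countable ι] {G : ι → Set (Cantor × Cantor)}
    (hG : ∀ i, IsClosed (G i)) (h1 : ∀ i a, {b | (a, b) ∈ G i}.Countable)
    (h2 : ∀ i b, {a | (a, b) ∈ G i}.Countable) :
    ∃ q : Cantor → Cantor, Continuous q ∧ ∀ a b, a ≠ b → ∀ i, (q a, q b) ∉ G i := by
  have : BaireSpace C(Cantor, Cantor) := baireSpace_continuousMap
  have hd := dense_iInter_of_isOpen (f := fun n : ι × ℕ =>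
    {q : C(Cantor, Cantor) | ∀ a b, a n.2 ≠ b n.2 → (q a, q b) ∉ G n.1})
    (fun n => isOpen_setOf_unrelated (hG _) _) (fun n => dense_setOf_unrelated (h1 _) (h2 _) _)
  obtain ⟨q, hq⟩ := hd.nonempty
  refine ⟨q, q.continuous, fun a b hab i => ?_⟩
  obtain ⟨k, hk⟩ := Function.ne_iff.1 hab
  exact mem_iInter.1 hq (i, k) a b hk

/-! ### Relations covered by countably many Borel functions -/

/-- A relation is enumerable if it is a countable union of graphs of Borel partial functions. -/
def BorelEnumerable (P : Cantor → Cantor → Prop) : Prop :=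
  ∃ (A : ℕ → Set Cantor) (φ : ℕ → Cantor → Cantor), (∀ n, MeasurableSet (A n)) ∧
    (∀ n, Measurable (φ n)) ∧ ∀ x y, P x y ↔ ∃ n, x ∈ A n ∧ φ n x = y

namespace BorelEnumerable

variable {P Q : Cantor → Cantor → Prop}

theorem of_countable {ι : Type*} [Countable ι] {A : ι → Set Cantor} {φ : ι → Cantor → Cantor}
    (hA : ∀ i, MeasurableSet (A i)) (hφ : ∀ i, Measurable (φ i))
    (h : ∀ x y, P x y ↔ ∃ i, x ∈ A i ∧ φ i x = y) : BorelEnumerable P := by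
  rcases isEmpty_or_nonempty ι with hι | hι
  · exact ⟨fun _ => ∅, fun _ => id, fun _ => .empty, fun _ => measurable_id, by simp [h]⟩
  · obtain ⟨e, he⟩ := exists_surjective_nat ι
    exact ⟨A ∘ e, φ ∘ e, fun n => hA _, fun n => hφ _, fun x y => by
      rw [h]; exact (he.exists (p := fun i => x ∈ A i ∧ φ i x = y))⟩

theorem iUnion {ι : Type*} [Countable ι] {P : ι → Cantor → Cantor → Prop}
    (h : ∀ i, BorelEnumerable (P i)) : BorelEnumerable fun x y => ∃ i, P i x y := by
  choose A φ hA hφ hP using h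
  exact of_countable (ι := ι × ℕ) (A := fun i => A i.1 i.2) (φ := fun i => φ i.1 i.2)
    (fun _ => hA _ _) (fun _ => hφ _ _) fun x y => by simp [hP, Prod.exists]

theorem or (hP : BorelEnumerable P) (hQ : BorelEnumerable Q) :
    BorelEnumerable fun x y => P x y ∨ Q x y := by
  have := iUnion (P := fun b : Bool => bif b then P else Q) (by simp [hP, hQ])
  simpa [or_comm] using this

theorem comp (hP : BorelEnumerable P) (hQ : BorelEnumerable Q) :
    BorelEnumerable fun x z => ∃ y, P x y ∧ Q y z := by
  obtain ⟨A, φ, hA, hφ, hP⟩ := hP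
  obtain ⟨B, ψ, hB, hψ, hQ⟩ := hQ
  refine of_countable (ι := ℕ × ℕ) (A := fun i => A i.1 ∩ φ i.1 ⁻¹' B i.2)
    (φ := fun i => ψ i.2 ∘ φ i.1) (fun i => (hA _).inter (hφ _ (hB _)))
    (fun i => (hψ _).comp (hφ _)) fun x z => ?_
  constructor
  · rintro ⟨y, hxy, hyz⟩
    obtain ⟨n, hn, rfl⟩ := (hP _ _).1 hxy
    obtain ⟨m, hm, rfl⟩ := (hQ _ _).1 hyz
    exact ⟨(n, m), ⟨hn, hm⟩, rfl⟩
  · rintro ⟨⟨n, m⟩, ⟨hn, hm⟩, rfl⟩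
    exact ⟨φ n x, (hP _ _).2 ⟨n, hn, rfl⟩, (hQ _ _).2 ⟨m, hm, rfl⟩⟩

theorem of_measurable {f : Cantor → Cantor} (hf : Measurable f) :
    BorelEnumerable fun x y => f x = y :=
  of_countable (ι := Unit) (A := fun _ => univ) (φ := fun _ => f) (fun _ => .univ) (fun _ => hf)
    (by simp)

theorem of_injective {u v : Cantor → Cantor} (hu : Measurable u) (hi : Function.Injective u)
    (hv : Measurable v) : BorelEnumerable fun x y => ∃ a, x = u a ∧ v a = y := by
  have he := hu.measurableEmbedding hi
  refine of_countable (ι := Unit) (A := fun _ => range u) (φ := fun _ => Function.extend u v id)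
    (fun _ => he.measurableSet_range) (fun _ => he.measurable_extend hv measurable_id)
    fun x y => ?_
  constructor
  · rintro ⟨a, rfl, rfl⟩
    exact ⟨(), mem_range_self a, hi.extend_apply _ _ _⟩
  · rintro ⟨-, ⟨a, rfl⟩, h⟩
    exact ⟨a, rfl, by rw [← h, hi.extend_apply]⟩

theorem measurableSet (hP : BorelEnumerable P) :
    MeasurableSet {p : Cantor × Cantor | P p.1 p.2} := by
  obtain ⟨A, φ, hA, hφ, hP⟩ := hP
  have : {p : Cantor × Cantor | P p.1 p.2} =
      ⋃ n, (Prod.fst ⁻¹' A n ∩ {p | φ n p.1 = p.2}) := by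
    ext p; simp [hP]
  rw [this]
  exact .iUnion fun n => (measurable_fst (hA n)).inter
    (measurableSet_eq_fun ((hφ n).comp measurable_fst) measurable_snd)

theorem countable (hP : BorelEnumerable P) (x : Cantor) : {y | P x y}.Countable := by
  obtain ⟨A, φ, -, -, hP⟩ := hP
  refine (countable_range fun n => φ n x).mono fun y hy => ?_
  obtain ⟨n, -, hn⟩ := (hP x y).1 hy
  exact ⟨n, hn⟩

/-- For reflexive relations total functions suffice. -/
theorem exists_total (hP : BorelEnumerable P) (hr : ∀ x, P x x) :
    ∃ φ : ℕ → Cantor → Cantor, (∀ n, Measurable (φ n)) ∧ ∀ x y, P x y ↔ ∃ n, φ n x = y := by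
  classical
  obtain ⟨A, φ, hA, hφ, hP⟩ := hP
  refine ⟨fun n => (A n).piecewise (φ n) id, fun n => (hφ n).piecewise (hA n) measurable_id,
    fun x y => ⟨fun h => ?_, ?_⟩⟩
  · obtain ⟨n, hn, h⟩ := (hP x y).1 h
    exact ⟨n, by simpa [hn] using h⟩
  · rintro ⟨n, rfl⟩
    by_cases hn : x ∈ A n
    · simpa [hn] using (hP _ _).2 ⟨n, hn, rfl⟩
    · simpa [hn] using hr x

end BorelEnumerable

/-! ### Double-bubble systems as invariant relations -/

/-- The involution of the Cantor space that flips the first bit. -/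
def flip (x : Cantor) : Cantor := Function.update x 0 (!x 0)

@[simp] theorem flip_flip (x : Cantor) : flip (flip x) = x := by
  simp [flip]

theorem flip_injective : Function.Injective flip := fun x y h => by
  simpa using congrArg flip h

theorem continuous_flip : Continuous flip := by
  refine continuous_id.update 0 ?_
  exact (continuous_of_discreteTopology (f := Bool.not)).comp (continuous_apply 0)

/-- The relation `E` of the double-bubble system determined by `D`. -/
def hull (D : Cantor → Cantor → Prop) (x y : Cantor) : Prop := D x y ∨ D (flip x) y

theorem hull_flip_left {D : Cantor → Cantor → Prop} {x y : Cantor} :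
    hull D (flip x) y ↔ hull D x y := by
  simp [hull, or_comm]

/-- Flip-invariant equivalence relations that give rise to a double-bubble system. -/
structure Bubble (D : Cantor → Cantor → Prop) : Prop where
  equiv : Equivalence D
  enum : BorelEnumerable D
  flip_flip : ∀ {x y}, D x y → D (flip x) (flip y)
  not_flip : ∀ x, ¬ D x (flip x)

namespace Bubble

variable {D : Cantor → Cantor → Prop}

theorem flip_left (h : Bubble D) {x y : Cantor} : D (flip x) y ↔ D x (flip y) :=
  ⟨fun hx => by simpa using h.flip_flip hx, fun hx => by simpa using h.flip_flip hx⟩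

theorem equiv_hull (h : Bubble D) : Equivalence (hull D) where
  refl x := .inl (h.equiv.refl x)
  symm := by
    rintro x y (hxy | hxy)
    · exact .inl (h.equiv.symm hxy)
    · exact .inr (h.equiv.symm (h.flip_left.1 hxy))
  trans := by
    rintro x y z (hxy | hxy) (hyz | hyz)
    · exact .inl (h.equiv.trans hxy hyz)
    · exact .inr (h.equiv.trans (h.flip_flip hxy) hyz)
    · exact .inr (h.equiv.trans hxy hyz)
    · exact .inl (h.equiv.trans (h.flip_left.1 hxy) hyz)

theorem hull_flip_right (h : Bubble D) {x y : Cantor} : hull D x (flip y) ↔ hull D x y := by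
  simp only [hull, ← h.flip_left, DoubleBubble.flip_flip, or_comm]

theorem enum_hull (h : Bubble D) : BorelEnumerable (hull D) := by
  have := h.enum.or ((BorelEnumerable.of_measurable continuous_flip.measurable).comp h.enum)
  simp only [exists_eq_left'] at this
  exact this

theorem dbs (h : Bubble D) : DBS D (hull D) where
  equivD := h.equiv
  equivE := h.equiv_hull
  borelD := h.enum.measurableSet
  borelE := h.enum_hull.measurableSet
  countableD := h.enum.countable
  countableE := h.enum_hull.countable
  sub _ _ := .inl
  double x := ⟨flip x, .inr (h.equiv.refl _), h.not_flip x, fun _ hz => hz⟩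

theorem dbsLe {D' : Cantor → Cantor → Prop} (h' : Bubble D')
    (hle : ∀ x y, D x y → D' x y) : DBSle D (hull D) D' (hull D') := by
  refine ⟨hle, fun x y => Or.imp (hle _ _) (hle _ _), fun x y hE hD hD' => ?_⟩
  rcases hE with hE | hE
  · exact hD hE
  · exact h'.not_flip x (h'.equiv.trans hD' (h'.equiv.symm (hle _ _ hE)))

theorem iUnion {ι : Type*} [Countable ι] [Nonempty ι] {D : ι → Cantor → Cantor → Prop}
    (h : ∀ i, Bubble (D i))
    (hdir : ∀ i j, (∀ x y, D i x y → D j x y) ∨ ∀ x y, D j x y → D i x y) :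
    Bubble fun x y => ∃ i, D i x y where
  equiv :=
    { refl x := ⟨Classical.arbitrary ι, (h _).equiv.refl x⟩
      symm := by
        rintro x y ⟨i, hi⟩
        exact ⟨i, (h i).equiv.symm hi⟩
      trans := by
        rintro x y z ⟨i, hi⟩ ⟨j, hj⟩
        rcases hdir i j with hij | hij
        · exact ⟨j, (h j).equiv.trans (hij _ _ hi) hj⟩
        · exact ⟨i, (h i).equiv.trans hi (hij _ _ hj)⟩ }
  enum := .iUnion fun i => (h i).enum
  flip_flip := by
    rintro x y ⟨i, hi⟩
    exact ⟨i, (h i).flip_flip hi⟩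
  not_flip := by
    rintro x ⟨i, hi⟩
    exact (h i).not_flip x hi

/-- Pairwise inequivalent classes can be glued: the class of `v a` is merged into the class
of `u a`. -/
theorem exists_glue (h : Bubble D) {u v : Cantor → Cantor} (hu : Measurable u)
    (hv : Measurable v) (huu : ∀ a b, a ≠ b → ¬ hull D (u a) (u b))
    (hvv : ∀ a b, a ≠ b → ¬ hull D (v a) (v b)) (huv : ∀ a b, ¬ hull D (u a) (v b)) :
    ∃ D', Bubble D' ∧ (∀ x y, D x y → D' x y) ∧ ∀ a, D' (u a) (v a) := by
  classical
  have hE := h.equiv_hull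
  have hui : Function.Injective u := fun a b e => by
    by_contra hab
    exact huu a b hab (e ▸ hE.refl _)
  have hvi : Function.Injective v := fun a b e => by
    by_contra hab
    exact hvv a b hab (e ▸ hE.refl _)
  let U : Cantor × Bool → Cantor := fun c => bif c.2 then flip (u c.1) else u c.1
  let V : Cantor × Bool → Cantor := fun c => bif c.2 then flip (v c.1) else v c.1
  have hUf : ∀ a s, flip (U (a, s)) = U (a, !s) := by rintro a (_ | _) <;> simp [U]
  have hVf : ∀ a s, flip (V (a, s)) = V (a, !s) := by rintro a (_ | _) <;> simp [V]
  have hVE : ∀ c c', hull D (V c) (V c') ↔ hull D (v c.1) (v c'.1) := by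
    rintro ⟨a, _ | _⟩ ⟨b, _ | _⟩ <;> simp [V, hull_flip_left, h.hull_flip_right]
  have hUVE : ∀ c c', hull D (U c) (V c') ↔ hull D (u c.1) (v c'.1) := by
    rintro ⟨a, _ | _⟩ ⟨b, _ | _⟩ <;> simp [U, V, hull_flip_left, h.hull_flip_right]
  have hVV : ∀ c c', D (V c) (V c') → c = c' := by
    rintro ⟨a, s⟩ ⟨b, t⟩ hc
    have hab : a = b := by
      by_contra hab
      exact hvv a b hab ((hVE _ _).1 (.inl hc))
    subst hab
    by_contra hne
    have hst : t = !s := by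
      cases s <;> cases t <;> simp_all
    rw [hst, ← hVf] at hc
    exact h.not_flip _ hc
  have hUV : ∀ c c', ¬ D (U c) (V c') := fun c c' hc => huv _ _ ((hUVE _ _).1 (.inl hc))
  let ρ : Cantor → Cantor := fun x => if hx : ∃ c, D x (V c) then U hx.choose else x
  have ρ_pos : ∀ x c, D x (V c) → ρ x = U c := by
    intro x c hx
    have hex : ∃ c, D x (V c) := ⟨c, hx⟩
    simp only [ρ, dif_pos hex]
    exact congrArg U (hVV _ _ (h.equiv.trans (h.equiv.symm hex.choose_spec) hx))
  have ρ_neg : ∀ x, (¬ ∃ c, D x (V c)) → ρ x = x := fun x hx => by simp only [ρ, dif_neg hx]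
  have hρU : ∀ c, ρ (U c) = U c := fun c => ρ_neg _ fun ⟨c', hc'⟩ => hUV _ _ hc'
  have hρV : ∀ c, ρ (V c) = U c := fun c => ρ_pos _ _ (h.equiv.refl _)
  have ρ_congr : ∀ x y, D x y → D (ρ x) (ρ y) := by
    intro x y hxy
    by_cases hx : ∃ c, D x (V c)
    · obtain ⟨c, hc⟩ := hx
      rw [ρ_pos x c hc, ρ_pos y c (h.equiv.trans (h.equiv.symm hxy) hc)]
      exact h.equiv.refl _
    · rw [ρ_neg x hx, ρ_neg y fun ⟨c, hc⟩ => hx ⟨c, h.equiv.trans hxy hc⟩]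
      exact hxy
  have ρ_flip : ∀ x, ρ (flip x) = flip (ρ x) := by
    intro x
    by_cases hx : ∃ c, D x (V c)
    · obtain ⟨⟨a, s⟩, hc⟩ := hx
      have hc' := h.flip_flip hc
      rw [hVf] at hc'
      rw [ρ_pos _ _ hc, ρ_pos _ _ hc', hUf]
    · rw [ρ_neg x hx, ρ_neg]
      rintro ⟨⟨a, s⟩, hc⟩
      rw [h.flip_left, hVf] at hc
      exact hx ⟨_, hc⟩
  have heq : Equivalence fun x y => D (ρ x) (ρ y) :=
    ⟨fun x => h.equiv.refl _, fun hxy => h.equiv.symm hxy, fun hxy hyz => h.equiv.trans hxy hyz⟩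
  have hfm := continuous_flip.measurable
  let Γ : Cantor → Cantor → Prop := fun x y => ∃ c, x = U c ∧ V c = y
  let Γ' : Cantor → Cantor → Prop := fun x y => ∃ c, x = V c ∧ U c = y
  have hΓ : BorelEnumerable Γ := by
    have := (BorelEnumerable.of_injective hu hui hv).or (BorelEnumerable.of_injective
      (hfm.comp hu) (flip_injective.comp hui) (hfm.comp hv))
    simpa [Γ, U, V, Prod.exists, ← exists_or] using this
  have hΓ' : BorelEnumerable Γ' := by
    have := (BorelEnumerable.of_injective hv hvi hu).or (BorelEnumerable.of_injective
      (hfm.comp hv) (flip_injective.comp hvi) (hfm.comp hu))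
    simpa [Γ', U, V, Prod.exists, ← exists_or] using this
  have hDΓ' := h.enum.comp hΓ'
  have hΓD := hΓ.comp h.enum
  have hK := (h.enum.or (h.enum.comp hΓD)).or ((hDΓ'.comp h.enum).or (hDΓ'.comp
    (h.enum.comp hΓD)))
  refine ⟨fun x y => D (ρ x) (ρ y), ⟨heq, ?_, ?_, ?_⟩, ρ_congr, fun a => ?_⟩
  · convert hK using 3 with x y
    have hΓρ : ∀ {x y}, Γ x y → D (ρ x) (ρ y) := by
      rintro _ _ ⟨c, rfl, rfl⟩
      rw [hρU, hρV]; exact h.equiv.refl _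
    have hΓρ' : ∀ {x y}, Γ' x y → D (ρ x) (ρ y) := by
      rintro _ _ ⟨c, rfl, rfl⟩
      rw [hρU, hρV]; exact h.equiv.refl _
    constructor
    · intro hxy
      by_cases hx : ∃ c, D x (V c)
      · obtain ⟨c, hc⟩ := hx
        rw [ρ_pos x c hc] at hxy
        by_cases hy : ∃ c, D y (V c)
        · obtain ⟨c', hc'⟩ := hy
          rw [ρ_pos y c' hc'] at hxy
          exact .inr (.inr ⟨U c, ⟨V c, hc, c, rfl, rfl⟩, U c', hxy, V c', ⟨c', rfl, rfl⟩,
            h.equiv.symm hc'⟩)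
        · rw [ρ_neg y hy] at hxy
          exact .inr (.inl ⟨U c, ⟨V c, hc, c, rfl, rfl⟩, hxy⟩)
      · rw [ρ_neg x hx] at hxy
        by_cases hy : ∃ c, D y (V c)
        · obtain ⟨c', hc'⟩ := hy
          rw [ρ_pos y c' hc'] at hxy
          exact .inl (.inr ⟨U c', hxy, V c', ⟨c', rfl, rfl⟩, h.equiv.symm hc'⟩)
        · rw [ρ_neg y hy] at hxy
          exact .inl (.inl hxy)
    · rintro ((hxy | ⟨p, h1, q, h2, h3⟩) |
        (⟨p, ⟨q, h1, h2⟩, h3⟩ | ⟨p, ⟨q, h1, h2⟩, r, h3, s, h4, h5⟩))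
      · exact ρ_congr _ _ hxy
      · exact heq.trans (ρ_congr _ _ h1) (heq.trans (hΓρ h2) (ρ_congr _ _ h3))
      · exact heq.trans (ρ_congr _ _ h1) (heq.trans (hΓρ' h2) (ρ_congr _ _ h3))
      · exact heq.trans (ρ_congr _ _ h1) (heq.trans (hΓρ' h2) (heq.trans (ρ_congr _ _ h3)
          (heq.trans (hΓρ h4) (ρ_congr _ _ h5))))
  · intro x y hxy
    simp only [ρ_flip]
    exact h.flip_flip hxy
  · intro x hx
    rw [ρ_flip] at hx
    exact h.not_flip _ hx
  · have h1 := hρU (a, false)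
    have h2 := hρV (a, false)
    simp only [U, V, cond_false] at h1 h2
    simp only [h1, h2]
    exact h.equiv.refl _

end Bubble

/-! ### The initial system -/

theorem even_ncard_symmDiff {A B : Set ℕ} (hA : A.Finite) (hB : B.Finite) :
    Even (symmDiff A B).ncard ↔ (Even A.ncard ↔ Even B.ncard) := by
  have h1 : (symmDiff A B).ncard = (A \ B).ncard + (B \ A).ncard :=
    ncard_union_eq (disjoint_sdiff_left.mono_right sdiff_subset) hA.sdiff hB.sdiff
  have h2 := ncard_inter_add_ncard_sdiff_eq_ncard A B hA
  have h3 := ncard_inter_add_ncard_sdiff_eq_ncard B A hB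
  rw [inter_comm] at h3
  rw [h1, ← h2, ← h3]
  simp only [Nat.even_add]
  tauto

theorem setOf_ne_symmDiff (x y z : Cantor) :
    symmDiff {k | x k ≠ y k} {k | y k ≠ z k} = {k | x k ≠ z k} := by
  ext k
  simp only [mem_symmDiff, mem_ofPred_eq]
  cases x k <;> cases y k <;> cases z k <;> simp

theorem setOf_flip_ne (x : Cantor) : {k | flip x k ≠ x k} = {0} := by
  ext k
  rcases eq_or_ne k 0 with rfl | hk <;> simp [flip, *]

theorem finite_flip_ne {x y : Cantor} (h : {k | x k ≠ y k}.Finite) :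
    {k | flip x k ≠ y k}.Finite := by
  rw [← setOf_ne_symmDiff _ x]
  exact (by simp [setOf_flip_ne] : {k | flip x k ≠ x k}.Finite).symmDiff h

theorem even_flip_ne {x y : Cantor} (h : {k | x k ≠ y k}.Finite) :
    Even {k | flip x k ≠ y k}.ncard ↔ ¬ Even {k | x k ≠ y k}.ncard := by
  rw [← setOf_ne_symmDiff _ x, even_ncard_symmDiff (by simp [setOf_flip_ne]) h, setOf_flip_ne]
  simp

theorem hull_eEven : hull eEven = eZero := by
  ext x y
  simp only [hull, eEven, eZero]
  constructor
  · rintro (h | h)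
    · exact h.1
    · simpa using finite_flip_ne h.1
  · intro h
    rw [even_flip_ne h]
    have := finite_flip_ne h
    tauto

theorem bubble_eEven : Bubble eEven where
  equiv :=
    { refl x := by simp [eEven]
      symm := by
        rintro x y h
        simpa only [eEven, ne_comm] using h
      trans := by
        rintro x y z h1 h2
        simp only [eEven, ← setOf_ne_symmDiff x y z]
        exact ⟨h1.1.symmDiff h2.1, (even_ncard_symmDiff h1.1 h2.1).2 (by simp [h1.2, h2.2])⟩ }
  enum := by
    refine .of_countable (ι := {s : Finset ℕ // Even s.card}) (A := fun _ => univ)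
      (φ := fun s x k => if k ∈ s.1 then !x k else x k) (fun _ => .univ) (fun s => ?_)
      fun x y => ⟨fun h => ?_, ?_⟩
    · refine measurable_pi_lambda _ fun k => ?_
      split_ifs
      · exact (measurable_of_countable Bool.not).comp (measurable_pi_apply k)
      · exact measurable_pi_apply k
    · refine ⟨⟨h.1.toFinset, ?_⟩, mem_univ _, ?_⟩
      · rw [← ncard_eq_toFinset_card _ h.1]; exact h.2
      · ext k
        simp only [Finite.mem_toFinset, mem_ofPred_eq]
        cases x k <;> cases y k <;> simp
    · rintro ⟨⟨s, hs⟩, -, rfl⟩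
      have : {k | x k ≠ if k ∈ s then !x k else x k} = (s : Set ℕ) := by
        ext k
        by_cases hk : k ∈ s <;> simp [hk]
      simp only [eEven, this]
      exact ⟨s.finite_toSet, by rwa [ncard_coe_finset]⟩
  flip_flip := by
    intro x y h
    have : {k | flip x k ≠ flip y k} = {k | x k ≠ y k} := by
      ext k
      rcases eq_or_ne k 0 with rfl | hk <;> simp [flip, *]
    simpa only [eEven, this] using h
  not_flip x h := by
    have h2 := h.2
    simp only [ne_comm (a := x _), setOf_flip_ne] at h2
    simp at h2

/-! ### Extending a system -/

/-- The points `a` coded by sequences starting with a given bit. -/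
def cons (b : Bool) (a : Cantor) : Cantor := fun n => Nat.casesOn n b a

theorem continuous_cons (b : Bool) : Continuous (cons b) := by
  refine continuous_pi fun n => ?_
  cases n
  · exact continuous_const
  · exact continuous_apply _

theorem cons_ne {b c : Bool} (h : b ≠ c) (a a' : Cantor) : cons b a ≠ cons c a' :=
  fun e => h (congrFun e 0)

theorem cons_injective (b : Bool) : Function.Injective (cons b) := fun _ _ e =>
  funext fun n => congrFun e (n + 1)

namespace Bubble

variable {D : Cantor → Cantor → Prop}

/-- Two injective Borel maps can be restricted to a common Cantor set on which their values are
pairwise inequivalent. -/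
theorem exists_independent (h : Bubble D) {p : Bool → Cantor → Cantor}
    (hp : ∀ s, Measurable (p s)) (hi : ∀ s, Function.Injective (p s)) :
    ∃ q : Cantor → Cantor, Continuous q ∧ Function.Injective q ∧
      ∀ s t a b, a ≠ b → ¬ hull D (p s (q a)) (p t (q b)) := by
  have hE := h.equiv_hull
  obtain ⟨φ, hφ, hφE⟩ := h.enum_hull.exists_total hE.refl
  obtain ⟨j, hjc, hji, -, hj⟩ := exists_continuous_comp MeasurableSet.univ not_countable_univ
    (ι := Bool × Option ℕ) (f := fun i => i.2.elim (p i.1) fun n => φ n ∘ p i.1) (by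
      rintro ⟨s, _ | n⟩
      · exact hp s
      · exact (hφ n).comp (hp s))
  have hjp : ∀ s, Continuous (p s ∘ j) := fun s => hj (s, none)
  have hjφ : ∀ n s, Continuous (φ n ∘ p s ∘ j) := fun n s => hj (s, some n)
  have hc : ∀ t x, {b | hull D x (p t (j b))}.Countable := fun t x =>
    (h.enum_hull.countable x).preimage ((hi t).comp hji)
  obtain ⟨q, hq, hqi⟩ := exists_unrelated (ι := ℕ × Bool × Bool)
    (G := fun i => {c | φ i.1 (p i.2.1 (j c.1)) = p i.2.2 (j c.2)})
    (fun i => isClosed_eq ((hjφ _ _).comp continuous_fst) ((hjp _).comp continuous_snd))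
    (fun i a => (hc i.2.2 (p i.2.1 (j a))).mono fun b hb => (hφE _ _).2 ⟨_, hb⟩)
    (fun i b => (hc i.2.1 (p i.2.2 (j b))).mono fun a ha => hE.symm ((hφE _ _).2 ⟨_, ha⟩))
  have hind : ∀ s t a b, a ≠ b → ¬ hull D (p s (j (q a))) (p t (j (q b))) := by
    intro s t a b hab hh
    obtain ⟨n, hn⟩ := (hφE _ _).1 hh
    exact hqi a b hab (n, s, t) hn
  refine ⟨j ∘ q, hjc.comp hq, fun a b e => ?_, hind⟩
  by_contra hab
  refine hind true true a b hab ?_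
  have : j (q a) = j (q b) := e
  rw [this]
  exact hE.refl _

theorem exists_extension_accommodating (h : Bubble D) {p r : Cantor → Cantor}
    (hp : Continuous p) (hr : Continuous r) (hpi : Function.Injective p)
    (hri : Function.Injective r) :
    ∃ D', Bubble D' ∧ (∀ x y, D x y → D' x y) ∧ ∃ q : Cantor → Cantor, Continuous q ∧
      Function.Injective q ∧ ∀ a, hull D' (r (q a)) (p (q a)) := by
  have hS : MeasurableSet {a | hull D (r a) (p a)} :=
    (hr.prodMk hp).measurable h.enum_hull.measurableSet
  by_cases hc : {a | hull D (r a) (p a)}.Countable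
  · have hc' : ¬ {a | hull D (r a) (p a)}ᶜ.Countable := fun hc' =>
      not_countable_univ (by simpa using hc.union hc')
    obtain ⟨j, hjc, hji, hjS, -⟩ := exists_continuous_comp (ι := Empty) (f := nofun) hS.compl hc'
      nofun
    obtain ⟨q, hq, hqi, hind⟩ := h.exists_independent
      (p := fun s => bif s then r ∘ j else p ∘ j)
      (by rintro (_ | _); exacts [(hp.comp hjc).measurable, (hr.comp hjc).measurable])
      (by rintro (_ | _); exacts [hpi.comp hji, hri.comp hji])
    obtain ⟨D', hD', hle, hD⟩ := h.exists_glue (u := r ∘ j ∘ q) (v := p ∘ j ∘ q)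
      (hr.comp (hjc.comp hq)).measurable (hp.comp (hjc.comp hq)).measurable
      (hind true true) (hind false false) (fun a b => by
        rcases eq_or_ne a b with rfl | hab
        · exact hjS (q a)
        · exact hind true false a b hab)
    exact ⟨D', hD', hle, j ∘ q, hjc.comp hq, hji.comp hqi, fun a => .inl (hD a)⟩
  · obtain ⟨j, hjc, hji, hjS, -⟩ := exists_continuous_comp (ι := Empty) (f := nofun) hS hc nofun
    exact ⟨D, h, fun _ _ => id, j, hjc, hji, hjS⟩

theorem exists_extension_related (h : Bubble D) {p r : Cantor → Cantor}
    (hp : Continuous p) (hr : Continuous r) (hpi : Function.Injective p)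
    (hri : Function.Injective r) :
    ∃ D', Bubble D' ∧ (∀ x y, D x y → D' x y) ∧ ∃ q q' : Cantor → Cantor, Continuous q ∧
      Function.Injective q ∧ Continuous q' ∧ Function.Injective q' ∧
      ∀ a, D' (r (q' a)) (p (q a)) := by
  obtain ⟨q, hq, hqi, hind⟩ := h.exists_independent (p := fun s => bif s then r else p)
      (by rintro (_ | _); exacts [hp.measurable, hr.measurable])
      (by rintro (_ | _); exacts [hpi, hri])
  have hq0 := hq.comp (continuous_cons false)
  have hq1 := hq.comp (continuous_cons true)
  obtain ⟨D', hD', hle, hD⟩ := h.exists_glue (hr.comp hq1).measurable (hp.comp hq0).measurable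
    (fun a b hab => hind true true _ _ ((cons_injective true).ne hab))
    (fun a b hab => hind false false _ _ ((cons_injective false).ne hab))
    (fun a b => hind true false _ _ (cons_ne (by simp) a b))
  exact ⟨D', hD', hle, _, _, hq0, hqi.comp (cons_injective _), hq1,
    hqi.comp (cons_injective _), hD⟩

end Bubble

/-- `D` accommodates the pair of parametrizations `p`, `r` in all the required ways. -/
def Accommodates (D : Cantor → Cantor → Prop) (p r : Cantor → Cantor) : Prop :=
  (∃ q : Cantor → Cantor, Continuous q ∧ Function.Injective q ∧
    ∀ a, hull D (r (q a)) (p (q a))) ∧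
  ∃ q q₁ q₂ : Cantor → Cantor, Continuous q ∧ Function.Injective q ∧ Continuous q₁ ∧
    Function.Injective q₁ ∧ Continuous q₂ ∧ Function.Injective q₂ ∧
    ∀ a, D (r (q₁ a)) (p (q a)) ∧ D (flip (r (q₂ a))) (p (q a))

theorem Accommodates.mono {D D' : Cantor → Cantor → Prop} {p r : Cantor → Cantor}
    (h : Accommodates D p r) (hle : ∀ x y, D x y → D' x y) : Accommodates D' p r := by
  obtain ⟨⟨q, hq, hqi, hD⟩, q', q₁, q₂, h1, h2, h3, h4, h5, h6, hD'⟩ := h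
  exact ⟨⟨q, hq, hqi, fun a => (hD a).imp (hle _ _) (hle _ _)⟩, q', q₁, q₂, h1, h2, h3, h4, h5,
    h6, fun a => (hD' a).imp (hle _ _) (hle _ _)⟩

theorem Bubble.exists_extension {D : Cantor → Cantor → Prop} (h : Bubble D)
    {p r : Cantor → Cantor} (hp : Continuous p) (hr : Continuous r)
    (hpi : Function.Injective p) (hri : Function.Injective r) :
    ∃ D', Bubble D' ∧ (∀ x y, D x y → D' x y) ∧ Accommodates D' p r := by
  obtain ⟨D₁, h₁, hle₁, q, hq, hqi, hD₁⟩ := h.exists_extension_accommodating hp hr hpi hri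
  obtain ⟨D₂, h₂, hle₂, q₀, q₁, hq₀, hqi₀, hq₁, hqi₁, hD₂⟩ :=
    h₁.exists_extension_related hp hr hpi hri
  obtain ⟨D₃, h₃, hle₃, s, s', hs, hsi, hs', hsi', hD₃⟩ :=
    h₂.exists_extension_related (hp.comp hq₀) (continuous_flip.comp hr) (hpi.comp hqi₀)
      (flip_injective.comp hri)
  exact ⟨D₃, h₃, fun x y hxy => hle₃ _ _ (hle₂ _ _ (hle₁ _ _ hxy)),
    ⟨q, hq, hqi, fun a => (hD₁ a).imp (fun e => hle₃ _ _ (hle₂ _ _ e))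
      fun e => hle₃ _ _ (hle₂ _ _ e)⟩,
    q₀ ∘ s, q₁ ∘ s, s', hq₀.comp hs, hqi₀.comp hsi, hq₁.comp hs, hqi₁.comp hsi, hs', hsi',
    fun a => ⟨hle₃ _ _ (hD₂ _), hD₃ a⟩⟩

section Enumeration

open Cardinal

universe u v

theorem countable_Iio {α : Ordinal.{u}} (hα : α < (aleph 1).ord) : (Iio α).Countable := by
  rw [← le_aleph0_iff_set_countable, ← lt_aleph_one_iff, mk_Iio_ordinal]
  have h := lift_lt.{u, u + 1}.2 (lt_ord.1 hα)
  rwa [lift_aleph, Ordinal.lift_one] at h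

theorem add_one_lt {α : Ordinal.{u}} (hα : α < (aleph 1).ord) : α + 1 < (aleph 1).ord :=
  (isSuccLimit_ord (aleph0_le_aleph 1)).add_one_lt hα

theorem mk_continuousMap_le : #C(Cantor, Cantor) ≤ 𝔠 := by
  have h : Function.Injective fun (f : C(Cantor, Cantor)) (n : ℕ) =>
      f (TopologicalSpace.denseSeq Cantor n) := fun f g e =>
    DFunLike.coe_injective <| f.continuous.ext_on (TopologicalSpace.denseRange_denseSeq Cantor)
      g.continuous (by rintro _ ⟨n, rfl⟩; exact congrFun e n)
  refine (mk_le_of_injective h).trans (le_of_eq ?_)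
  simp

theorem exists_enumeration {T : Type} [Nonempty T] (hT : #T ≤ 𝔠)
    (hCH : continuum.{v} = aleph.{v} 1) :
    ∃ e : Ordinal.{u} → T, ∀ t, ∃ α < (aleph 1).ord, e α = t := by
  have h₁ : lift.{v, 0} 𝔠 = lift.{v, 0} (aleph 1) := by
    rw [lift_continuum, lift_aleph, Ordinal.lift_one, hCH]
  have h₂ : lift.{u + 1} #T ≤ lift.{0} #(Iio (aleph.{u} 1).ord) := by
    rw [mk_Iio_ordinal, card_ord, lift_aleph, Ordinal.lift_one, lift_id'.{0, u + 1}]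
    have h := lift_le.{u + 1}.2 (hT.trans_eq (lift_injective h₁))
    rwa [lift_aleph, Ordinal.lift_one] at h
  obtain ⟨i⟩ := lift_mk_le'.1 h₂
  exact ⟨fun α => Function.extend (fun t => (i t : Ordinal)) id (fun _ => Classical.arbitrary T) α,
    fun t => ⟨i t, (i t).2, (Subtype.val_injective.comp i.injective).extend_apply _ _ _⟩⟩

end Enumeration

/-- Iterate the extension operator `ext` along the ordinals, starting from `eEven` and taking
unions at limits. -/
def iterate (ext : Ordinal → (Cantor → Cantor → Prop) → Cantor → Cantor → Prop) (α : Ordinal)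
    (x y : Cantor) : Prop :=
  eEven x y ∨ ∃ β : Iio α, ext β (iterate ext β) x y
termination_by α
decreasing_by exact β.2

section Iterate

variable {ext : Ordinal → (Cantor → Cantor → Prop) → Cantor → Cantor → Prop}

theorem iterate_zero : iterate ext 0 = eEven := by
  funext x y
  rw [iterate]
  simp

theorem iterate_of_eEven {α : Ordinal} {x y : Cantor} (h : eEven x y) : iterate ext α x y := by
  rw [iterate]
  exact .inl h

theorem iterate_of_ext {α β : Ordinal} (hβ : β < α) {x y : Cantor}
    (h : ext β (iterate ext β) x y) : iterate ext α x y := by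
  rw [iterate]
  exact .inr ⟨⟨β, hβ⟩, h⟩

theorem iterate_mono {α β : Ordinal} (h : α ≤ β) {x y : Cantor} (hxy : iterate ext α x y) :
    iterate ext β x y := by
  rw [iterate] at hxy
  rcases hxy with hxy | ⟨γ, hγ⟩
  · exact iterate_of_eEven hxy
  · exact iterate_of_ext (γ.2.trans_le h) hγ

theorem bubble_iterate (hle : ∀ β D x y, D x y → ext β D x y)
    (hext : ∀ β D, Bubble D → Bubble (ext β D)) (α : Ordinal)
    (hα : α < (Cardinal.aleph 1).ord) : Bubble (iterate ext α) := by
  induction α using WellFoundedLT.induction with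
  | ind α ih =>
    have : Countable (Iio α) := (countable_Iio hα).to_subtype
    let F : Option (Iio α) → Cantor → Cantor → Prop
      | none => eEven
      | some β => ext β (iterate ext β)
    have hF : Bubble fun x y => ∃ i, F i x y := by
      refine .iUnion ?_ ?_
      · rintro (_ | β)
        · exact bubble_eEven
        · exact hext _ _ (ih β β.2 (β.2.trans hα))
      · have hnone : ∀ i x y, F none x y → F i x y := by
          rintro (_ | β) x y h
          · exact h
          · exact hle _ _ _ _ (iterate_of_eEven h)
        have hsome : ∀ β γ : Iio α, β ≤ γ → ∀ x y, F (some β) x y → F (some γ) x y := by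
          rintro β γ h x y hxy
          rcases h.eq_or_lt with rfl | h
          · exact hxy
          · exact hle _ _ _ _ (iterate_of_ext h hxy)
        rintro (_ | β) (_ | γ)
        · exact .inl (hnone none)
        · exact .inl (hnone (some γ))
        · exact .inr (hnone (some β))
        · exact (le_total β γ).imp (hsome _ _) (hsome _ _)
    convert hF with x y
    rw [iterate, Option.exists]

end Iterate

/-- Pairs of continuous injections of the Cantor space into itself. -/
abbrev InjectionPair : Type :=
  {t : C(Cantor, Cantor) × C(Cantor, Cantor) // Function.Injective t.1 ∧ Function.Injective t.2}

theorem mk_injectionPair_le : Cardinal.mk InjectionPair ≤ Cardinal.continuum := by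
  refine (Cardinal.mk_subtype_le _).trans ?_
  rw [Cardinal.mk_prod, Cardinal.lift_id]
  exact (mul_le_mul' mk_continuousMap_le mk_continuousMap_le).trans
    Cardinal.continuum_mul_self.le

theorem exists_increasing_bubbles (hCH : Cardinal.continuum = Cardinal.aleph 1) :
    ∃ D : Ordinal → Cantor → Cantor → Prop, D 0 = eEven ∧
      (∀ α β, α ≤ β → ∀ x y, D α x y → D β x y) ∧
      (∀ α < (Cardinal.aleph 1).ord, Bubble (D α)) ∧
      ∀ p r : Cantor → Cantor, Continuous p → Continuous r → Function.Injective p →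
        Function.Injective r → ∃ α < (Cardinal.aleph 1).ord, Accommodates (D α) p r := by
  have : Nonempty InjectionPair :=
    ⟨⟨(.id _, .id _), Function.injective_id, Function.injective_id⟩⟩
  obtain ⟨e, he⟩ := exists_enumeration mk_injectionPair_le hCH
  have h : ∀ (t : InjectionPair) (D : Cantor → Cantor → Prop),
      ∃ D', (∀ x y, D x y → D' x y) ∧ (Bubble D → Bubble D' ∧ Accommodates D' t.1.1 t.1.2) := by
    intro t D
    by_cases hD : Bubble D
    · obtain ⟨D', h₁, h₂, h₃⟩ :=
        hD.exists_extension t.1.1.continuous t.1.2.continuous t.2.1 t.2.2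
      exact ⟨D', h₂, fun _ => ⟨h₁, h₃⟩⟩
    · exact ⟨D, fun _ _ => id, fun h => (hD h).elim⟩
  choose ext hle hext using h
  have hB := bubble_iterate (ext := fun β => ext (e β)) (fun β => hle (e β))
    fun β D hD => (hext (e β) D hD).1
  refine ⟨iterate fun β => ext (e β), iterate_zero, fun α β h x y => iterate_mono h, hB,
    fun p r hp hr hpi hri => ?_⟩
  obtain ⟨α, hα, hαe⟩ := he ⟨(⟨p, hp⟩, ⟨r, hr⟩), hpi, hri⟩
  have hacc := (hext (e α) _ (hB α hα)).2
  rw [hαe] at hacc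
  refine ⟨α + 1, add_one_lt hα, hacc.mono fun x y hxy => iterate_of_ext (lt_add_one α) ?_⟩
  rwa [hαe]

/-- A continuous injection of the Cantor space, and a measurable injection, give a measurable
injection defined on the range of the former. -/
theorem exists_factor {h k : Cantor → Cantor} (hh : Continuous h) (hhi : Function.Injective h)
    (hk : Measurable k) (hki : Function.Injective k) :
    ∃ f : range h → Cantor, Measurable f ∧ Function.Injective f ∧ (∀ y, f y ∈ range k) ∧
      ∀ a, f ⟨h a, mem_range_self a⟩ = k a := by
  have hE := hh.measurableEmbedding hhi
  let E := hE.equivRange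
  exact ⟨k ∘ E.symm, hk.comp E.symm.measurable, hki.comp E.symm.injective,
    fun y => mem_range_self _, fun a => congrArg k (hE.equivRange_symm_apply_mk a)⟩

end DoubleBubble

/-- Under CH there is a `⊑`-increasing `ω₁`-sequence of double-bubble systems, starting
with `⟨Eₑ, E₀⟩`, which accommodates Borel injections defined on perfect sets, and which,
for any pair of perfect sets `X, R`, positively and negatively accommodates suitable
Borel injections of a perfect subset of `X` into `R`. -/
theorem increasing_dbs_sequence_sacks
    (hCH : Cardinal.continuum = Cardinal.aleph 1) :
    ∃ D E : Ordinal → Cantor → Cantor → Prop,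
      (∀ α < (Cardinal.aleph 1).ord, DBS (D α) (E α)) ∧
      (∀ α β : Ordinal, α ≤ β → β < (Cardinal.aleph 1).ord →
        DBSle (D α) (E α) (D β) (E β)) ∧
      D 0 = eEven ∧ E 0 = eZero ∧
      (∀ X : Set Cantor, PerfectSet X → ∀ f : X → Cantor, Measurable f →
        Function.Injective f →
        ∃ X', X' ⊆ X ∧ PerfectSet X' ∧ ∃ α < (Cardinal.aleph 1).ord,
          ∀ x : X, ↑x ∈ X' → E α (f x) ↑x) ∧
      (∀ X R : Set Cantor, PerfectSet X → PerfectSet R →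
        ∃ Y, Y ⊆ X ∧ PerfectSet Y ∧ ∃ α < (Cardinal.aleph 1).ord,
          ∃ f g : Y → Cantor, Measurable f ∧ Measurable g ∧
            Function.Injective f ∧ Function.Injective g ∧
            (∀ y : Y, f y ∈ R) ∧ (∀ y : Y, g y ∈ R) ∧
            (∀ y : Y, D α (f y) ↑y) ∧
            (∀ y : Y, E α (g y) ↑y ∧ ¬ D α (g y) ↑y)) := by
  obtain ⟨D, h0, hmono, hB, hacc⟩ := DoubleBubble.exists_increasing_bubbles hCH
  refine ⟨D, fun α => DoubleBubble.hull (D α), fun α hα => (hB α hα).dbs,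
    fun α β h hβ => (hB β hβ).dbsLe (hmono α β h), h0, ?_, fun X hX f hf hfi => ?_,
    fun X R hX hR => ?_⟩
  · simp only [h0, DoubleBubble.hull_eEven]
  · obtain ⟨p, hp, hpi, hpX⟩ := DoubleBubble.PerfectSet.exists_injection hX
    obtain ⟨j, hj, hji, -, hfj⟩ := DoubleBubble.exists_continuous_comp MeasurableSet.univ
      DoubleBubble.not_countable_univ (f := fun (_ : Unit) a => f ⟨p a, hpX a⟩)
      fun _ => hf.comp (hp.measurable.subtype_mk)
    obtain ⟨α, hα, ⟨q, hq, hqi, hD⟩, -⟩ := hacc (p ∘ j) _ (hp.comp hj) (hfj ()) (hpi.comp hji)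
      fun a b e => hji (hpi (congrArg Subtype.val (hfi e)))
    refine ⟨Set.range ((p ∘ j) ∘ q), Set.range_subset_iff.2 fun a => hpX _,
      DoubleBubble.perfectSet_range ((hp.comp hj).comp hq) ((hpi.comp hji).comp hqi), α, hα, ?_⟩
    rintro ⟨_, _⟩ ⟨a, rfl⟩
    exact hD a
  · obtain ⟨p, hp, hpi, hpX⟩ := DoubleBubble.PerfectSet.exists_injection hX
    obtain ⟨r, hr, hri, hrR⟩ := DoubleBubble.PerfectSet.exists_injection hR
    obtain ⟨α, hα, -, q, q₁, q₂, hq, hqi, hq₁, hqi₁, hq₂, hqi₂, hD⟩ := hacc p r hp hr hpi hri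
    obtain ⟨f, hf, hfi, hfR, hfD⟩ := DoubleBubble.exists_factor (hp.comp hq) (hpi.comp hqi)
      (hr.comp hq₁).measurable (hri.comp hqi₁)
    obtain ⟨g, hg, hgi, hgR, hgD⟩ := DoubleBubble.exists_factor (hp.comp hq) (hpi.comp hqi)
      (hr.comp hq₂).measurable (hri.comp hqi₂)
    refine ⟨Set.range (p ∘ q), Set.range_subset_iff.2 fun a => hpX _,
      DoubleBubble.perfectSet_range (hp.comp hq) (hpi.comp hqi), α, hα, f, g, hf, hg, hfi, hgi,
      fun y => ?_, fun y => ?_, ?_, ?_⟩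
    · obtain ⟨a, ha⟩ := hfR y
      exact ha ▸ hrR _
    · obtain ⟨a, ha⟩ := hgR y
      exact ha ▸ hrR _
    · rintro ⟨_, a, rfl⟩
      rw [hfD]
      exact (hD a).1
    · rintro ⟨_, a, rfl⟩
      rw [hgD]
      exact ⟨.inr (hD a).2, fun h => (hB α hα).not_flip _
        ((hB α hα).equiv.trans h ((hB α hα).equiv.symm (hD a).2))⟩
end
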